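/- (Gibbs concentration of increments.) Let ψ be the (σ,λ)-GFF on V_N and let λ_{i*−1} ≤ α < α' ≤ λ_{i*} for some i*, β ∈ ℬ, and ρ ∈ (0,1]. Then for every s ∈ ℕ, every k ∈ {1,...,s}, and every family of functions h : V_N^s → ℝ with sup_N ‖h‖_∞ < ∞, writing v = (v^1,...,v^s), one has lim_{N→∞} |E𝒢_{β,N,ρ}^{×s}[ψ_{v^k}(α,α') h(v)] − E𝒢_{β,N,ρ}[ψ_{v^k}(α,α')] · E𝒢_{β,N,ρ}^{×s}[h(v)]| / (β (𝒥_{σ²}(1) log N + C_0)) = 0. -/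

import Mathlib

open Filter
open scoped Classical

noncomputable section GFFCommon

/-- Vertices of `ℤ²`. -/
abbrev Vtx : Type := ℤ × ℤ

/-- Sample space: a real-valued field indexed by the vertices of `ℤ²`. -/
abbrev FieldSp : Type := Vtx → ℝ

/-- The box `V_N = {0,1,…,N}²`. -/
def VN (N : ℕ) : Finset Vtx := Finset.Icc (0, 0) ((N : ℤ), (N : ℤ))

/-- The boundary `∂B` of a finite box `B ⊆ ℤ²`:
vertices of `B` having a (Euclidean distance 1) neighbour outside `B`. -/
def bdry (B : Finset Vtx) : Finset Vtx :=
  B.filter fun v =>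
    ¬((v.1 + 1, v.2) ∈ B ∧ (v.1 - 1, v.2) ∈ B ∧ (v.1, v.2 + 1) ∈ B ∧ (v.1, v.2 - 1) ∈ B)

/-- The interior `B° = B ∖ ∂B`. -/
def intr (B : Finset Vtx) : Finset Vtx := B \ bdry B

/-- The neighbourhood `[v]_λ` of `v` in `V_N`. -/
def nbhd (N : ℕ) (lam : ℝ) (v : Vtx) : Finset Vtx :=
  if lam = 0 then VN N
  else if lam = 1 then {v}
  else (VN N).filter fun w =>
    |(w.1 : ℝ) - (v.1 : ℝ)| ≤ (N : ℝ) ^ ((1 : ℝ) - lam) / 2 ∧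
    |(w.2 : ℝ) - (v.2 : ℝ)| ≤ (N : ℝ) ^ ((1 : ℝ) - lam) / 2

/-- The σ-algebra `F_{∂[v]_λ ∪ [v]_λ^c}`, generated by the field variables on the
boundary of `[v]_λ` and those outside of it. -/
def scaleAlg (N : ℕ) (lam : ℝ) (v : Vtx) : MeasurableSpace FieldSp :=
  ⨆ w ∈ {w : Vtx | w ∈ VN N ∧ w ∉ intr (nbhd N lam v)},
    MeasurableSpace.comap (fun ω : FieldSp => ω w) inferInstance

/-- `G` is the Green function of simple random walk killed on `∂B`, normalized by `π/2`:
it vanishes unless both arguments are in `B°`, and in `B°` it satisfies the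
first-step (discrete Poisson equation) characterization
`G(x,y) = (1/4)·Σ_{x'∼x} G(x',y) + (π/2)·1_{x=y}`. -/
def IsGreenFn (B : Finset Vtx) (G : Vtx → Vtx → ℝ) : Prop :=
  (∀ x y : Vtx, x ∉ intr B ∨ y ∉ intr B → G x y = 0) ∧
  ∀ y ∈ intr B, ∀ x ∈ intr B,
    G x y = (G (x.1 + 1, x.2) y + G (x.1 - 1, x.2) y
        + G (x.1, x.2 + 1) y + G (x.1, x.2 - 1) y) / 4
      + (Real.pi / 2) * (if x = y then 1 else 0)

/-- `P` is the law (on the canonical space `FieldSp`) of the Gaussian free field on `V_N`: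
a centered Gaussian field with covariance the Green function `G_{V_N}`. -/
def IsGFF (N : ℕ) (P : MeasureTheory.Measure FieldSp) : Prop :=
  MeasureTheory.IsProbabilityMeasure P ∧
  ∃ G : Vtx → Vtx → ℝ, IsGreenFn (VN N) G ∧
    ∀ c : Vtx → ℝ,
      P.map (fun ω => ∑ v ∈ VN N, c v * ω v) =
        ProbabilityTheory.gaussianReal 0 (Real.toNNReal (∑ v ∈ VN N, ∑ w ∈ VN N, c v * c w * G v w))

open MeasureTheory in
/-- `φ_v(λ) = E[φ_v | F_{∂[v]_λ ∪ [v]_λ^c}]`. -/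
def phiScale (N : ℕ) (P : MeasureTheory.Measure FieldSp) (v : Vtx) (lam : ℝ) : FieldSp → ℝ :=
  P[fun ω : FieldSp => ω v | scaleAlg N lam v]

/-- Admissible parameters `(σ,λ)`: `σ_1,…,σ_M > 0` and `0 = λ_0 < λ_1 < … < λ_M = 1`. -/
def ScaleParams (M : ℕ) (sigv lamv : ℕ → ℝ) : Prop :=
  1 ≤ M ∧ (∀ i ∈ Finset.Icc 1 M, 0 < sigv i) ∧
  lamv 0 = 0 ∧ lamv M = 1 ∧ ∀ i, i < M → lamv i < lamv (i + 1)

/-- The `(σ,λ)`-GFF: `ψ_v = Σ_{i=1}^M σ_i (φ_v(λ_i) − φ_v(λ_{i−1}))`. -/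
def psiFld (N M : ℕ) (sigv lamv : ℕ → ℝ) (P : MeasureTheory.Measure FieldSp) (v : Vtx) : FieldSp → ℝ :=
  fun ω => ∑ i ∈ Finset.Icc 1 M, sigv i * (phiScale N P v (lamv i) ω - phiScale N P v (lamv (i - 1)) ω)

open MeasureTheory in
/-- `ψ_v(λ) = E[ψ_v | F_{∂[v]_λ ∪ [v]_λ^c}]`. -/
def psiScale (N M : ℕ) (sigv lamv : ℕ → ℝ) (P : MeasureTheory.Measure FieldSp) (v : Vtx) (lam : ℝ) :
    FieldSp → ℝ :=
  P[psiFld N M sigv lamv P v | scaleAlg N lam v]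

/-- The increment `ψ_v(λ,λ') = ψ_v(λ') − ψ_v(λ)`. -/
def psiInc (N M : ℕ) (sigv lamv : ℕ → ℝ) (P : MeasureTheory.Measure FieldSp) (v : Vtx) (lam lam' : ℝ) :
    FieldSp → ℝ :=
  fun ω => psiScale N M sigv lamv P v lam' ω - psiScale N M sigv lamv P v lam ω

/-- The step function `σ(s) = σ_1 1_{{0}}(s) + Σ_{i=1}^M σ_i 1_{(λ_{i−1},λ_i]}(s)`. -/
def stepFn (M : ℕ) (sigv lamv : ℕ → ℝ) (s : ℝ) : ℝ :=
  (if s = 0 then sigv 1 else 0) +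
  ∑ i ∈ Finset.Icc 1 M, if lamv (i - 1) < s ∧ s ≤ lamv i then sigv i else 0

/-- `𝒥_f(s) = ∫_0^s f(r) dr`. -/
def Jint (f : ℝ → ℝ) (s : ℝ) : ℝ := ∫ r in (0:ℝ)..s, f r

/-- `𝒥_f(s₁,s₂) = ∫_{s₁}^{s₂} f(r) dr`. -/
def Jint2 (f : ℝ → ℝ) (s₁ s₂ : ℝ) : ℝ := ∫ r in s₁..s₂, f r

/-- The speed function `𝒥_{σ²}`. -/
def Jsig2 (M : ℕ) (sigv lamv : ℕ → ℝ) (s : ℝ) : ℝ := Jint (fun r => (stepFn M sigv lamv r) ^ 2) s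

/-- The normalized speed function `𝒥̄_{σ²} = 𝒥_{σ²}/𝒥_{σ²}(1)`. -/
def JsigBar (M : ℕ) (sigv lamv : ℕ → ℝ) (s : ℝ) : ℝ := Jsig2 M sigv lamv s / Jsig2 M sigv lamv 1

/-- The concave hull on `[0,1]` of a function `f`, i.e. the pointwise infimum over all
concave functions dominating `f` on `[0,1]`. -/
def concaveHull (f : ℝ → ℝ) (s : ℝ) : ℝ :=
  sInf {y | ∃ g : ℝ → ℝ, ConcaveOn ℝ (Set.Icc (0:ℝ) 1) g ∧
    (∀ t ∈ Set.Icc (0:ℝ) 1, f t ≤ g t) ∧ y = g s}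

/-- The effective parameters: jump scales `0 = λ⁰ < … < λ^m = 1`, values
`σ̄_1 > … > σ̄_m > 0`, and the left-continuous non-increasing step function `σ̄`
such that `∫_0^s σ̄²` is the concavification of `𝒥_{σ²}`. -/
def EffParams (M : ℕ) (sigv lamv : ℕ → ℝ) (m : ℕ) (sigb lamb : ℕ → ℝ) (sigbar : ℝ → ℝ) : Prop :=
  1 ≤ m ∧ m ≤ M ∧ lamb 0 = 0 ∧ lamb m = 1 ∧ (∀ j, j < m → lamb j < lamb (j + 1)) ∧
  (∀ l, 1 ≤ l → l < m → sigb (l + 1) < sigb l) ∧ (∀ l ∈ Finset.Icc 1 m, 0 < sigb l) ∧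
  sigbar 0 = sigb 1 ∧
  (∀ l ∈ Finset.Icc 1 m, ∀ s : ℝ, lamb (l - 1) < s → s ≤ lamb l → sigbar s = sigb l) ∧
  (∀ s : ℝ, 0 < s → s ≤ 1 →
    concaveHull (Jsig2 M sigv lamv) s = ∫ r in (0:ℝ)..s, (sigbar r) ^ 2)

/-- `γ* = 𝒥_{σ²/σ̄}(1)`. -/
def gammaStar (M : ℕ) (sigv lamv : ℕ → ℝ) (sigbar : ℝ → ℝ) : ℝ :=
  ∫ s in (0:ℝ)..1, (stepFn M sigv lamv s) ^ 2 / sigbar s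

/-- The critical levels `γ^l = ∫_0^1 σ²(s)/σ̄(s ∧ λ^l) ds`, `γ⁰ = 0`. -/
def gammaL (M : ℕ) (sigv lamv : ℕ → ℝ) (lamb : ℕ → ℝ) (sigbar : ℝ → ℝ) (l : ℕ) : ℝ :=
  if l = 0 then 0 else ∫ s in (0:ℝ)..1, (stepFn M sigv lamv s) ^ 2 / sigbar (min s (lamb l))

/-- `EntE` is the entropy function `𝓔` of the model. -/
def IsEntropy (M : ℕ) (sigv lamv : ℕ → ℝ) (m : ℕ) (lamb : ℕ → ℝ) (sigbar : ℝ → ℝ)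
    (EntE : ℝ → ℝ) : Prop :=
  EntE 0 = 1 ∧
  ∀ l ∈ Finset.Icc 1 m, ∀ γ : ℝ,
    gammaL M sigv lamv lamb sigbar (l - 1) < γ → γ ≤ gammaL M sigv lamv lamb sigbar l →
      EntE γ = (1 - lamb (l - 1)) -
        (γ - ∫ s in (0:ℝ)..(lamb (l - 1)), (stepFn M sigv lamv s) ^ 2 / sigbar s) ^ 2 /
          Jint2 (fun r => (stepFn M sigv lamv r) ^ 2) (lamb (l - 1)) 1

/-- The limiting free energy of the `REM(σ)` model. -/
def fREM (σ β : ℝ) : ℝ :=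
  if (2 / σ) < β then 2 * (β / (2 / σ)) else 1 + (β / (2 / σ)) ^ 2

/-- The index `l_β`. -/
def lbeta (m : ℕ) (sigb : ℕ → ℝ) (β : ℝ) : ℕ :=
  if β ≤ 2 / sigb m then sInf {l : ℕ | 1 ≤ l ∧ β ≤ 2 / sigb l} else m + 1

/-- The limiting free energy `f^ψ(β)`, written with the `l_β` split. -/
def fpsiLim (m : ℕ) (sigb lamb : ℕ → ℝ) (β : ℝ) : ℝ :=
  (∑ j ∈ Finset.Icc 1 (lbeta m sigb β - 1), (2 * β / (2 / sigb j)) * (lamb j - lamb (j - 1))) +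
  ∑ j ∈ Finset.Icc (lbeta m sigb β) m, (1 + β ^ 2 / (2 / sigb j) ^ 2) * (lamb j - lamb (j - 1))

/-- The set `ℬ` of non-critical inverse temperatures. -/
def critSet (m : ℕ) (sigb : ℕ → ℝ) : Set ℝ :=
  {β | 0 < β ∧ ∀ j ∈ Finset.Icc 1 m, β ≠ 2 / sigb j}

/-- The partition function `Z_N^ψ(β)`. -/
def ZN (N M : ℕ) (sigv lamv : ℕ → ℝ) (P : MeasureTheory.Measure FieldSp) (β : ℝ) (ω : FieldSp) : ℝ :=
  ∑ v ∈ VN N, Real.exp (β * psiFld N M sigv lamv P v ω)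

/-- The free energy `f_N^ψ(β)` on `V_N`. -/
def freeEnergy (N M : ℕ) (sigv lamv : ℕ → ℝ) (P : MeasureTheory.Measure FieldSp) (β : ℝ) (ω : FieldSp) : ℝ :=
  (Real.log ((N : ℝ) ^ 2))⁻¹ * Real.log (ZN N M sigv lamv P β ω)

/-- The set `A_{N,ρ}` of points at distance at least `N^{1−ρ}` from `ℤ² ∖ V_N`. -/
def AN (N : ℕ) (ρ : ℝ) : Finset Vtx :=
  (VN N).filter fun v => ∀ z : Vtx, z ∉ VN N →
    (N : ℝ) ^ ((1 : ℝ) - ρ) ≤ Real.sqrt (((v.1 : ℝ) - (z.1 : ℝ)) ^ 2 + ((v.2 : ℝ) - (z.2 : ℝ)) ^ 2)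

/-- The restricted partition function `Z_{N,ρ}^ψ(β)`. -/
def ZNres (N M : ℕ) (sigv lamv : ℕ → ℝ) (P : MeasureTheory.Measure FieldSp) (β ρ : ℝ) (ω : FieldSp) : ℝ :=
  ∑ v ∈ AN N ρ, Real.exp (β * psiFld N M sigv lamv P v ω)

/-- The free energy `f_{N,ρ}^ψ(β)` on `A_{N,ρ}`. -/
def freeEnergyRes (N M : ℕ) (sigv lamv : ℕ → ℝ) (P : MeasureTheory.Measure FieldSp) (β ρ : ℝ)
    (ω : FieldSp) : ℝ :=
  (Real.log ((N : ℝ) ^ 2))⁻¹ * Real.log (ZNres N M sigv lamv P β ρ ω)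

/-- The Gibbs weight `𝒢_{β,N}({v})`. -/
def gibbsW (N M : ℕ) (sigv lamv : ℕ → ℝ) (P : MeasureTheory.Measure FieldSp) (β : ℝ) (v : Vtx)
    (ω : FieldSp) : ℝ :=
  Real.exp (β * psiFld N M sigv lamv P v ω) / ZN N M sigv lamv P β ω

/-- The restricted Gibbs weight `𝒢_{β,N,ρ}({v})`. -/
def gibbsWres (N M : ℕ) (sigv lamv : ℕ → ℝ) (P : MeasureTheory.Measure FieldSp) (β ρ : ℝ) (v : Vtx)
    (ω : FieldSp) : ℝ :=
  Real.exp (β * psiFld N M sigv lamv P v ω) / ZNres N M sigv lamv P β ρ ω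

/-- `E𝒢_{β,N}^{×s}[F]`: the mean over the disorder of the `s`-fold Gibbs average of `F`. -/
def gibbsExp (N M : ℕ) (sigv lamv : ℕ → ℝ) (P : MeasureTheory.Measure FieldSp) (β : ℝ) (s : ℕ)
    (F : (Fin s → Vtx) → ℝ) : ℝ :=
  ∫ ω, (∑ vv ∈ Fintype.piFinset (fun _ : Fin s => VN N),
    (∏ i, gibbsW N M sigv lamv P β (vv i) ω) * F vv) ∂P

/-- `E𝒢_{β,N,ρ}^{×s}[F]`, with an `ω`-dependent integrand allowed. -/
def gibbsExpRes (N M : ℕ) (sigv lamv : ℕ → ℝ) (P : MeasureTheory.Measure FieldSp) (β ρ : ℝ) (s : ℕ)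
    (F : (Fin s → Vtx) → FieldSp → ℝ) : ℝ :=
  ∫ ω, (∑ vv ∈ Fintype.piFinset (fun _ : Fin s => AN N ρ),
    (∏ i, gibbsWres N M sigv lamv P β ρ (vv i) ω) * F vv ω) ∂P

/-- `E𝒢_{β,N}^{×s}[F]`, with an `ω`-dependent integrand allowed. -/
def gibbsExpW (N M : ℕ) (sigv lamv : ℕ → ℝ) (P : MeasureTheory.Measure FieldSp) (β : ℝ) (s : ℕ)
    (F : (Fin s → Vtx) → FieldSp → ℝ) : ℝ :=
  ∫ ω, (∑ vv ∈ Fintype.piFinset (fun _ : Fin s => VN N),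
    (∏ i, gibbsW N M sigv lamv P β (vv i) ω) * F vv ω) ∂P

/-- The covariance `E[ψ_v ψ_{v'}]`. -/
def psiCov (N M : ℕ) (sigv lamv : ℕ → ℝ) (P : MeasureTheory.Measure FieldSp) (v v' : Vtx) : ℝ :=
  ∫ ω, psiFld N M sigv lamv P v ω * psiFld N M sigv lamv P v' ω ∂P

/-- `C₀` is a constant witnessing the uniform variance upper bound
`max_{v∈V_N} E[ψ_v²] ≤ 𝒥_{σ²}(1) log N + C₀` for `N` large. -/
def IsVarBound (M : ℕ) (sigv lamv : ℕ → ℝ) (P : ℕ → MeasureTheory.Measure FieldSp) (C₀ : ℝ) : Prop :=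
  0 < C₀ ∧ ∃ N₀ : ℕ, ∀ N ≥ N₀, ∀ v ∈ VN N,
    psiCov N M sigv lamv (P N) v v ≤ Jsig2 M sigv lamv 1 * Real.log N + C₀

/-- The overlap `q^N(v,v')`. -/
def overlapQ (N M : ℕ) (sigv lamv : ℕ → ℝ) (P : MeasureTheory.Measure FieldSp) (C₀ : ℝ) (v v' : Vtx) : ℝ :=
  psiCov N M sigv lamv P v v' / (Jsig2 M sigv lamv 1 * Real.log N + C₀)

/-- Convergence in probability to a constant, for a sequence of random variables on a
sequence of probability spaces. -/
def TendstoInProb (P : ℕ → MeasureTheory.Measure FieldSp) (X : ℕ → FieldSp → ℝ) (c : ℝ) : Prop :=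
  ∀ ε : ℝ, 0 < ε → Tendsto (fun N => P N {ω | ε < |X N ω - c|}) atTop (nhds 0)

/-- Convergence in `L^p` to a constant. -/
def TendstoLp (P : ℕ → MeasureTheory.Measure FieldSp) (X : ℕ → FieldSp → ℝ) (p c : ℝ) : Prop :=
  Tendsto (fun N => ∫ ω, |X N ω - c| ^ p ∂(P N)) atTop (nhds 0)

/-- The branching scale `b_N(v,v')`. -/
def bScale (N : ℕ) (v v' : Vtx) : ℝ :=
  sSup {lam : ℝ | lam ∈ Set.Icc (0:ℝ) 1 ∧ ((nbhd N lam v) ∩ (nbhd N lam v')).Nonempty}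

end GFFCommon

noncomputable section GP
open Finset (range mem_range sum_congr sum_add_distrib mul_sum sum_le_sum sum_range_succ sum_sub_distrib sum_nonneg Ico mem_Ico single_le_sum)
open Real (exp log exp_pos exp_add log_le_log add_one_le_exp exp_le_exp exp_log exp_zero exp_sub log_mul measurable_exp)
def avg (u : Vtx → ℝ) (x : Vtx) : ℝ :=
  (u (x.1 + 1, x.2) + u (x.1 - 1, x.2) + u (x.1, x.2 + 1) + u (x.1, x.2 - 1)) / 4
def Lp (u : Vtx → ℝ) (x : Vtx) : ℝ := u x - avg u x
theorem mp (I : Finset Vtx) (u : Vtx → ℝ) (h1 : ∀ x ∈ I, Lp u x ≤ 0) (h2 : ∀ x ∉ I, u x ≤ 0) :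
    ∀ x, u x ≤ 0 := by
  by_contra! hx
  obtain ⟨x₀, hx₀⟩ := hx
  have hI : I.Nonempty := ⟨x₀, by by_contra h; linarith [h2 x₀ h]⟩
  obtain ⟨a, ha, hmax⟩ := I.exists_max_image u hI
  have hx₀I : x₀ ∈ I := by by_contra h; linarith [h2 x₀ h]
  have hpos : 0 < u a := lt_of_lt_of_le hx₀ (hmax x₀ hx₀I)
  have hall : ∀ z, u z ≤ u a := fun z => by
    by_cases hz : z ∈ I
    · exact hmax z hz
    · linarith [h2 z hz]
  obtain ⟨b, hb, hbm⟩ := (I.filter fun z => u z = u a).exists_max_image (fun z => z.1)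
    ⟨a, by simp [ha]⟩
  simp only [Finset.mem_filter] at hb hbm
  have h := h1 b hb.1
  simp only [Lp, avg] at h
  have e1 := hall (b.1 + 1, b.2)
  have e2 := hall (b.1 - 1, b.2)
  have e3 := hall (b.1, b.2 + 1)
  have e4 := hall (b.1, b.2 - 1)
  have e : u (b.1 + 1, b.2) = u a := by linarith [hb.2]
  have hin : (b.1 + 1, b.2) ∈ I := by by_contra hc; linarith [h2 _ hc]
  have := hbm _ ⟨hin, e⟩
  simp at this
theorem Lp_add (u v : Vtx → ℝ) (x) : Lp (fun z => u z + v z) x = Lp u x + Lp v x := by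
  simp only [Lp, avg]; ring
theorem Lp_sub (u v : Vtx → ℝ) (x) : Lp (fun z => u z - v z) x = Lp u x - Lp v x := by
  simp only [Lp, avg]; ring
theorem Lp_smul (c : ℝ) (u : Vtx → ℝ) (x) : Lp (fun z => c * u z) x = c * Lp u x := by
  simp only [Lp, avg]; ring
theorem Lp_const (c : ℝ) (x) : Lp (fun _ => c) x = 0 := by
  simp only [Lp, avg]; ring
theorem Lp_sum {ι : Type*} (s : Finset ι) (u : ι → Vtx → ℝ) (x) :
    Lp (fun z => ∑ i ∈ s, u i z) x = ∑ i ∈ s, Lp (u i) x := by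
  induction s using Finset.induction_on with
  | empty => simpa using Lp_const 0 x
  | insert a s ha ih => simp only [Finset.sum_insert ha]; rw [Lp_add, ih]
theorem mp_le (I : Finset Vtx) (u w : Vtx → ℝ) (h1 : ∀ x ∈ I, Lp u x ≤ Lp w x)
    (h2 : ∀ x ∉ I, u x ≤ w x) : ∀ x, u x ≤ w x := by
  intro x
  have := mp I (fun z => u z - w z) (fun z hz => by rw [Lp_sub]; linarith [h1 z hz])
    (fun z hz => by linarith [h2 z hz]) x
  linarith
theorem ex_gr (I : Finset Vtx) (y : Vtx) : ∃ g : Vtx → ℝ, (∀ x ∉ I, g x = 0) ∧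
    ∀ x ∈ I, Lp g x = Real.pi / 2 * (if x = y then 1 else 0) := by
  let ext : (I → ℝ) → Vtx → ℝ := fun g x => if h : x ∈ I then g ⟨x, h⟩ else 0
  let A : (I → ℝ) →ₗ[ℝ] (I → ℝ) :=
    { toFun := fun g x => Lp (ext g) x
      map_add' := by
        intro g g'; ext x
        have : ext (g + g') = fun z => ext g z + ext g' z := by
          funext z; simp only [ext]; split_ifs <;> simp
        simp only [this, Lp_add, Pi.add_apply]
      map_smul' := by
        intro c g; ext x
        have : ext (c • g) = fun z => c * ext g z := by
          funext z; simp only [ext]; split_ifs <;> simp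
        simp only [this, Lp_smul, Pi.smul_apply, smul_eq_mul, RingHom.id_apply] }
  have hinj : Function.Injective A := by
    rw [← LinearMap.ker_eq_bot, LinearMap.ker_eq_bot']
    intro g hg
    have hz : ∀ x ∈ I, Lp (ext g) x = Lp (fun _ => (0:ℝ)) x := fun x hx => by
      rw [Lp_const]; exact congrFun hg ⟨x, hx⟩
    have ho : ∀ x ∉ I, ext g x = 0 := fun x hx => by simp [ext, hx]
    have h1 := mp_le I (ext g) (fun _ => 0) (fun x hx => (hz x hx).le) (fun x hx => (ho x hx).le)
    have h2 := mp_le I (fun _ => 0) (ext g) (fun x hx => (hz x hx).ge) (fun x hx => (ho x hx).ge)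
    ext x
    have := le_antisymm (h1 x) (h2 x)
    simpa [ext] using this
  obtain ⟨g, hg⟩ := (LinearMap.injective_iff_surjective.mp hinj)
    (fun x => Real.pi / 2 * (if (x:Vtx) = y then 1 else 0))
  exact ⟨ext g, fun x hx => by simp [ext, hx], fun x hx => congrFun hg ⟨x, hx⟩⟩
def gr (I : Finset Vtx) (y : Vtx) : Vtx → ℝ := (ex_gr I y).choose
theorem gr_off {I : Finset Vtx} {y x : Vtx} (hx : x ∉ I) : gr I y x = 0 := (ex_gr I y).choose_spec.1 x hx
theorem gr_Lp {I : Finset Vtx} (y : Vtx) {x : Vtx} (hx : x ∈ I) :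
    Lp (gr I y) x = Real.pi / 2 * (if x = y then 1 else 0) := (ex_gr I y).choose_spec.2 x hx
theorem gr_nonneg (I : Finset Vtx) (y x : Vtx) : 0 ≤ gr I y x := by
  refine mp_le I (fun _ => 0) (gr I y) (fun x hx => ?_) (fun x hx => (gr_off hx).ge) x
  rw [Lp_const, gr_Lp y hx]; positivity
theorem gr_mono {I J : Finset Vtx} (h : I ⊆ J) (y x : Vtx) : gr I y x ≤ gr J y x :=
  mp_le I _ _ (fun x hx => by rw [gr_Lp y hx, gr_Lp y (h hx)])
    (fun x hx => by rw [gr_off hx]; exact gr_nonneg J y x) x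
theorem gr_src {I : Finset Vtx} {y : Vtx} (hy : y ∉ I) (x : Vtx) : gr I y x = 0 := by
  refine le_antisymm (mp_le I (gr I y) (fun _ => 0) (fun x hx => ?_) (fun x hx => (gr_off hx).le) x)
    (gr_nonneg I y x)
  rw [Lp_const, gr_Lp y hx, if_neg (show x ≠ y from fun h => hy (h ▸ hx))]; simp
theorem gr_uniq (I : Finset Vtx) (y : Vtx) (g : Vtx → ℝ) (h0 : ∀ x ∉ I, g x = 0)
    (h1 : ∀ x ∈ I, Lp g x = Real.pi / 2 * (if x = y then 1 else 0)) : g = gr I y := by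
  funext x
  exact le_antisymm
    (mp_le I g (gr I y) (fun x hx => by rw [h1 x hx, gr_Lp y hx]) (fun x hx => by rw [h0 x hx, gr_off hx]) x)
    (mp_le I (gr I y) g (fun x hx => by rw [h1 x hx, gr_Lp y hx]) (fun x hx => by rw [h0 x hx, gr_off hx]) x)
theorem gr_le_diag (I : Finset Vtx) (y x : Vtx) : gr I y x ≤ gr I y y := by
  refine mp_le (I.erase y) (gr I y) (fun _ => gr I y y) (fun x hx => ?_) (fun x hx => ?_) x
  · rw [Finset.mem_erase] at hx
    rw [Lp_const, gr_Lp y hx.2, if_neg hx.1]; simp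
  · by_cases h : x = y
    · rw [h]
    · rw [gr_off (fun h' => hx (Finset.mem_erase.2 ⟨h, h'⟩))]; exact gr_nonneg I y y
theorem green_id {I : Finset Vtx} {g g' : Vtx → ℝ} (h : ∀ x ∉ I, g x = 0) (h' : ∀ x ∉ I, g' x = 0) :
    ∑ z ∈ I, Lp g z * g' z = ∑ z ∈ I, g z * Lp g' z := by
  have sw : ∀ (a b : ℤ), ∀ g g' : Vtx → ℝ, (∀ x ∉ I, g x = 0) → (∀ x ∉ I, g' x = 0) →
      ∑ z ∈ I, g (z.1 + a, z.2 + b) * g' z = ∑ z ∈ I, g z * g' (z.1 - a, z.2 - b) := by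
    intro a b g g' h h'
    have e1 : ∑ z ∈ I, g (z.1 + a, z.2 + b) * g' z = ∑ᶠ z : Vtx, g (z.1 + a, z.2 + b) * g' z := by
      rw [finsum_eq_sum_of_support_subset]
      intro z hz; by_contra hc
      exact hz (by simp [h' z hc])
    have e2 : ∑ z ∈ I, g z * g' (z.1 - a, z.2 - b) = ∑ᶠ z : Vtx, g z * g' (z.1 - a, z.2 - b) := by
      rw [finsum_eq_sum_of_support_subset]
      intro z hz; by_contra hc
      exact hz (by simp [h z hc])
    rw [e1, e2, ← finsum_comp_equiv (Equiv.addRight ((a, b) : Vtx)) (f := fun z : Vtx => g z * g' (z.1 - a, z.2 - b))]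
    refine finsum_congr fun z => ?_
    rcases z with ⟨z1, z2⟩
    simp
  have s1 := sw 1 0 g g' h h'
  have s2 := sw (-1) 0 g g' h h'
  have s3 := sw 0 1 g g' h h'
  have s4 := sw 0 (-1) g g' h h'
  simp only [add_zero, sub_zero, sub_neg_eq_add, ← sub_eq_add_neg] at s1 s2 s3 s4
  simp only [Lp, avg, sub_mul, mul_sub, div_mul_eq_mul_div, mul_div_assoc', add_mul, mul_add,
    sum_sub_distrib, ← Finset.sum_div, sum_add_distrib, s1, s2, s3, s4]
  ring
theorem gr_rep {I : Finset Vtx} {g : Vtx → ℝ} (h : ∀ x ∉ I, g x = 0) (y : Vtx) :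
    ∑ w ∈ I, gr I y w * Lp g w = Real.pi / 2 * g y := by
  rw [← green_id (fun x hx => gr_off hx) h]
  rw [sum_congr rfl (fun z hz => by rw [gr_Lp y hz])]
  by_cases hy : y ∈ I
  · rw [Finset.sum_eq_single y]
    · simp
    · intro b _ hb; simp [hb]
    · intro hc; exact absurd hy hc
  · rw [h y hy, Finset.sum_eq_zero]; simp
    intro z hz; rw [if_neg (show z ≠ y from fun e => hy (e ▸ hz))]; simp
theorem gr_symm (I : Finset Vtx) (x y : Vtx) : gr I x y = gr I y x := by
  have h := gr_rep (I := I) (g := gr I x) (fun z hz => gr_off hz) y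
  have h' := gr_rep (I := I) (g := gr I y) (fun z hz => gr_off hz) x
  have := green_id (I := I) (g := gr I x) (g' := gr I y) (fun z hz => gr_off hz) (fun z hz => gr_off hz)
  have e : ∑ w ∈ I, gr I y w * Lp (gr I x) w = ∑ w ∈ I, Lp (gr I x) w * gr I y w :=
    sum_congr rfl fun _ _ => mul_comm _ _
  have hp := Real.pi_pos
  have : Real.pi / 2 * gr I x y = Real.pi / 2 * gr I y x := by
    rw [← h, ← h', e, this]
  exact mul_left_cancel₀ (by positivity) this
def nbr (x y : Vtx) : Prop := y = (x.1 + 1, x.2) ∨ y = (x.1 - 1, x.2) ∨ y = (x.1, x.2 + 1) ∨ y = (x.1, x.2 - 1)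
theorem gr_lip1 (I : Finset Vtx) {x y : Vtx} (h : nbr x y) (z : Vtx) :
    gr I x z - gr I y z ≤ 2 * Real.pi := by
  have hp := Real.pi_pos
  have key : gr I x x - gr I x y ≤ 2 * Real.pi := by
    by_cases hx : x ∈ I
    · have := gr_Lp x hx
      simp only [Lp, avg, if_true, mul_one] at this
      have e1 := gr_le_diag I x (x.1 + 1, x.2)
      have e2 := gr_le_diag I x (x.1 - 1, x.2)
      have e3 := gr_le_diag I x (x.1, x.2 + 1)
      have e4 := gr_le_diag I x (x.1, x.2 - 1)
      rcases h with rfl | rfl | rfl | rfl <;> linarith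
    · rw [gr_src hx, gr_src hx]; linarith
  refine mp_le (I.erase x) (fun z => gr I x z - gr I y z) (fun _ => 2 * Real.pi) (fun z hz => ?_)
    (fun z hz => ?_) z
  · rw [Finset.mem_erase] at hz
    rw [Lp_const, Lp_sub, gr_Lp x hz.2, gr_Lp y hz.2, if_neg hz.1]
    have : 0 ≤ Real.pi / 2 * (if z = y then 1 else 0 : ℝ) := by positivity
    linarith
  · by_cases hzx : z = x
    · simp only [hzx]; rw [gr_symm I y x]; exact key
    · have hz' : z ∉ I := fun h' => hz (Finset.mem_erase.2 ⟨hzx, h'⟩)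
      simp only [gr_off hz']; linarith
theorem nbr_symm {x y : Vtx} (h : nbr x y) : nbr y x := by
  obtain ⟨a, b⟩ := x
  rcases h with rfl | rfl | rfl | rfl <;> simp [nbr]
def l1 (x : Vtx) : ℕ := x.1.natAbs + x.2.natAbs
theorem gr_lip (I : Finset Vtx) (z : Vtx) : ∀ (n : ℕ) (x y : Vtx), l1 (y - x) = n →
    |gr I x z - gr I y z| ≤ 2 * Real.pi * n := by
  intro n
  induction n with
  | zero =>
    intro x y h
    have : y = x := by
      obtain ⟨a, b⟩ := x; obtain ⟨c, d⟩ := y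
      simp only [l1, Prod.mk_sub_mk] at h; ext <;> simp <;> omega
    simp [this]
  | succ n ih =>
    intro x y h
    obtain ⟨x', hx', hn⟩ : ∃ x', nbr x x' ∧ l1 (y - x') = n := by
      obtain ⟨a, b⟩ := x; obtain ⟨c, d⟩ := y
      simp only [l1, Prod.mk_sub_mk] at h
      rcases lt_trichotomy a c with hac | hac | hac
      · exact ⟨(a + 1, b), by simp [nbr], by simp only [l1, Prod.mk_sub_mk]; omega⟩
      · rcases lt_trichotomy b d with hbd | hbd | hbd
        · exact ⟨(a, b + 1), by simp [nbr], by simp only [l1, Prod.mk_sub_mk]; omega⟩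
        · omega
        · exact ⟨(a, b - 1), by simp [nbr], by simp only [l1, Prod.mk_sub_mk]; omega⟩
      · exact ⟨(a - 1, b), by simp [nbr], by simp only [l1, Prod.mk_sub_mk]; omega⟩
    have h1 := ih x' y hn
    have h2 := gr_lip1 I hx' z
    have h3 := gr_lip1 I (nbr_symm hx') z
    rw [abs_le] at h1 ⊢
    push_cast
    constructor <;> nlinarith
theorem gr_shift (I : Finset Vtx) (v y x : Vtx) :
    gr (I.map (Equiv.addRight v).toEmbedding) (y + v) (x + v) = gr I y x := by
  have := gr_uniq I y (fun x => gr (I.map (Equiv.addRight v).toEmbedding) (y + v) (x + v))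
    (fun x hx => gr_off (by simpa using hx)) (fun x hx => by
      have hm : x + v ∈ I.map (Equiv.addRight v).toEmbedding := by simpa using hx
      have := gr_Lp (y + v) hm
      simp only [add_left_inj] at this
      rw [← this]
      simp only [Lp, avg, Prod.add_def]
      ring_nf)
  exact congrFun this x
theorem mp_loc (I : Finset Vtx) (u w : Vtx → ℝ) (h1 : ∀ x ∈ I, Lp u x ≤ Lp w x)
    (h2 : ∀ x ∉ I, (∃ z ∈ I, nbr z x) → u x ≤ w x) : ∀ x ∈ I, u x ≤ w x := by
  intro x hx
  have := mp I (fun x => if x ∈ I ∨ ∃ z ∈ I, nbr z x then u x - w x else 0) (fun x hx => by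
      have e1 := h1 x hx
      have n1 : ∀ y, nbr x y → (y ∈ I ∨ ∃ z ∈ I, nbr z y) := fun y hy => Or.inr ⟨x, hx, hy⟩
      simp only [Lp, avg] at e1 ⊢
      rw [if_pos (Or.inl hx), if_pos (n1 _ (by simp [nbr])), if_pos (n1 _ (by simp [nbr])),
        if_pos (n1 _ (by simp [nbr])), if_pos (n1 _ (by simp [nbr]))]
      linarith) (fun x hx => by
      simp only [hx, false_or]
      split_ifs with h
      · linarith [h2 x hx h]
      · exact le_rfl) x
  simp only [hx, true_or, if_true] at this
  linarith
def qf (x : Vtx) : ℝ := (x.1:ℝ)^2 + (x.2:ℝ)^2 + 1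
def ff (x : Vtx) : ℝ := log (qf x) / 2
def mu (x : Vtx) : ℝ := - Lp ff x
theorem qf_ge (x : Vtx) : 1 ≤ qf x := by unfold qf; nlinarith [sq_nonneg (x.1:ℝ), sq_nonneg (x.2:ℝ)]
theorem qf_pos (x : Vtx) : 0 < qf x := lt_of_lt_of_le one_pos (qf_ge x)
theorem mu_bd (x : Vtx) : 0 ≤ mu x ∧ mu x ≤ 3 / (qf x)^2 := by
  have hq := qf_pos x
  have hq1 := qf_ge x
  set T := (2 * (qf x)^2 + 8 * qf x + 5 + 16 * (x.1:ℝ)^2 * (x.2:ℝ)^2) / (qf x)^4 with hT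
  have e : mu x = log (1 + T) / 8 := by
    have e1 : 1 + T = (qf (x.1+1,x.2) * qf (x.1-1,x.2) * qf (x.1,x.2+1) * qf (x.1,x.2-1)) / (qf x)^4 := by
      rw [hT, eq_div_iff (by positivity), add_mul, div_mul_cancel₀ _ (by positivity)]
      simp only [qf]; push_cast; ring
    have h1 := (qf_pos (x.1+1,x.2)).ne'
    have h2 := (qf_pos (x.1-1,x.2)).ne'
    have h3 := (qf_pos (x.1,x.2+1)).ne'
    have h4 := (qf_pos (x.1,x.2-1)).ne'
    rw [e1, Real.log_div (by positivity) (by positivity), log_mul (by positivity) h4,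
      log_mul (by positivity) h3, log_mul h1 h2, Real.log_pow]
    simp only [mu, Lp, avg, ff]; push_cast; ring
  have hT0 : 0 ≤ T := by positivity
  have hT1 : T ≤ 19 / (qf x)^2 := by
    rw [hT, div_le_div_iff₀ (by positivity) (by positivity)]
    have : 16 * (x.1:ℝ)^2 * (x.2:ℝ)^2 ≤ 4 * (qf x)^2 := by
      unfold qf
      nlinarith [sq_nonneg ((x.1:ℝ)^2 - (x.2:ℝ)^2), sq_nonneg (x.1:ℝ), sq_nonneg (x.2:ℝ)]
    have h2 : (2 * (qf x)^2 + 8 * qf x + 5 + 16 * (x.1:ℝ)^2 * (x.2:ℝ)^2) ≤ 19 * (qf x)^2 := by nlinarith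
    calc _ ≤ 19 * (qf x)^2 * (qf x)^2 := by gcongr
      _ = _ := by ring
  rw [e]
  refine ⟨div_nonneg (Real.log_nonneg (by linarith)) (by norm_num), ?_⟩
  have h3 := Real.log_le_sub_one_of_pos (show 0 < 1 + T by linarith)
  have : 19 / (qf x)^2 / 8 ≤ 3 / (qf x)^2 := by rw [div_div, div_le_div_iff₀ (by positivity) (by positivity)]; nlinarith [sq_nonneg (qf x)]
  linarith
def Q (v : Vtx) (R : ℕ) : Finset Vtx := Finset.Ioo (v.1 - R) (v.1 + R) ×ˢ Finset.Ioo (v.2 - R) (v.2 + R)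
theorem mem_Q {v : Vtx} {R : ℕ} {x : Vtx} : x ∈ Q v R ↔
    (v.1 - R < x.1 ∧ x.1 < v.1 + R) ∧ (v.2 - R < x.2 ∧ x.2 < v.2 + R) := by
  simp [Q]
theorem Ioo_sum (F : ℤ → ℝ) (R : ℕ) : ∑ a ∈ Finset.Ioo (-(R+1:ℕ):ℤ) ((R+1:ℕ):ℤ), F a =
    ∑ i ∈ range (2*R+1), F (i - R) := by
  symm
  apply Finset.sum_bij (fun (i:ℕ) _ => ((i:ℤ) - R))
  · intro a ha; simp at ha ⊢; omega
  · intro a _ b _ h; simpa using h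
  · intro b hb; simp at hb
    exact ⟨(b + R).toNat, by simp; omega, by simp; omega⟩
  · intros; rfl
theorem tele (F : ℤ → ℝ) (hF : ∀ a, F (-a) = F a) (R : ℕ) :
    ∑ a ∈ Finset.Ioo (-(R+1:ℕ):ℤ) ((R+1:ℕ):ℤ), (F (a+1) + F (a-1) - 2 * F a) = 2 * (F (R+1) - F R) := by
  rw [Ioo_sum]
  have h1 : ∀ i ∈ range (2*R+1), (F ((i:ℤ) - R+1) + F ((i:ℤ)-R-1) - 2 * F ((i:ℤ)-R)) =
    (fun i : ℕ => F ((i:ℤ) - R) - F ((i:ℤ) - R - 1)) (i+1) - (fun i : ℕ => F ((i:ℤ) - R) - F ((i:ℤ) - R - 1)) i := by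
    intro i _
    simp only
    push_cast
    rw [show (i:ℤ) + 1 - R = i - R + 1 by ring, show (i:ℤ) - R + 1 - 1 = i - R by ring]; ring
  rw [sum_congr rfl h1, Finset.sum_range_sub (fun i : ℕ => F ((i:ℤ) - R) - F ((i:ℤ) - R - 1))]
  push_cast
  rw [show (2 * (R:ℤ) + 1 - R) = R + 1 by ring, show (R:ℤ) + 1 - 1 = R by ring,
    show (0:ℤ) - R - 1 = -(R+1) by ring, show (0:ℤ) - R = -R by ring, hF, hF]; ring
theorem flux (R : ℕ) : ∑ x ∈ Q 0 (R+1), mu x =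
    ∑ i ∈ range (2*R+1), (ff ((R:ℤ)+1, (i:ℤ) - R) - ff ((R:ℤ), (i:ℤ) - R)) := by
  have hs : ∀ a b, ff (a, b) = ff (b, a) := fun a b => by simp only [ff, qf]; ring_nf
  have hn : ∀ a b, ff (-a, b) = ff (a, b) := fun a b => by simp [ff, qf]
  have e : ∀ x : Vtx, mu x = ((ff (x.1+1,x.2) + ff (x.1-1,x.2) - 2 * ff (x.1, x.2)) +
    (ff (x.2+1,x.1) + ff (x.2-1,x.1) - 2 * ff (x.2,x.1)))/4 := fun x => by
    simp only [mu, Lp, avg, hs x.2, hs (x.2+1), hs (x.2-1)]; ring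
  rw [sum_congr rfl (fun x _ => e x), ← Finset.sum_div, sum_add_distrib]
  have h1 : ∀ b, ∑ a ∈ Finset.Ioo (-(R+1:ℕ):ℤ) ((R+1:ℕ):ℤ), (ff (a+1,b) + ff (a-1,b) - 2 * ff (a,b)) =
    2 * (ff ((R:ℤ)+1,b) - ff ((R:ℤ), b)) := fun b => tele (fun a => ff (a, b)) (fun a => hn a b) R
  simp only [Q, Prod.fst_zero, Prod.snd_zero, zero_sub, zero_add]
  rw [Finset.sum_product_right, Finset.sum_product]
  simp only [h1]
  rw [Ioo_sum, ← mul_sum]; ring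
theorem arctan_step {x y : ℝ} (h : x < y) :
    |Real.arctan y - Real.arctan x - (y - x) / (1 + x^2)| ≤ (y - x)^2 := by
  obtain ⟨c, hc, e⟩ := exists_hasDerivAt_eq_slope Real.arctan (fun t => 1 / (1 + t^2)) h
    Real.continuous_arctan.continuousOn (fun t _ => by simpa using Real.hasDerivAt_arctan t)
  rw [eq_div_iff (by linarith)] at e
  rw [← e]
  have : 1 / (1 + c^2) * (y - x) - (y - x) / (1 + x^2) = (y - x) * ((x - c) * (x / ((1+c^2)*(1+x^2)) + c/((1+c^2)*(1+x^2)))) := by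
    field_simp; ring
  rw [this, abs_mul, abs_mul, abs_of_pos (sub_pos.2 h), pow_two (y - x)]
  have b1 : |x - c| ≤ y - x := by rw [abs_le]; constructor <;> linarith [hc.1, hc.2]
  have b2 : ∀ s t : ℝ, |s / ((1+t^2)*(1+s^2))| ≤ 1/2 := fun s t => by
    rw [abs_div, abs_of_pos (show 0 < (1+t^2)*(1+s^2) by positivity), div_le_iff₀ (by positivity)]
    nlinarith [sq_nonneg (|s| - 1), sq_abs s, sq_nonneg t, mul_nonneg (sq_nonneg t) (sq_nonneg s), abs_nonneg s]
  have b3 := b2 x c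
  have b4 := b2 c x
  rw [mul_comm (1+x^2)] at b4
  have b5 := abs_add_le (x / ((1+c^2)*(1+x^2))) (c/((1+c^2)*(1+x^2)))
  have hyx : 0 < y - x := sub_pos.2 h
  refine mul_le_mul_of_nonneg_left ?_ hyx.le
  calc _ ≤ (y - x) * 1 := mul_le_mul b1 (by linarith) (abs_nonneg _) hyx.le
    _ = _ := mul_one _
theorem flux_term (R : ℕ) (k : ℝ) (hk : |k| ≤ R) :
    |log (((R:ℝ)+1)^2 + k^2 + 1) / 2 - log ((R:ℝ)^2 + k^2 + 1)/2 -
      (Real.arctan ((k+1)/(R+1)) - Real.arctan (k/(R+1)))| ≤ 13 / ((R:ℝ)+1)^2 := by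
  set m := (R:ℝ)
  have hm : 0 ≤ m := Nat.cast_nonneg R
  have hk2 : k^2 ≤ m^2 := by rw [← sq_abs]; gcongr
  have hk0 := sq_nonneg k
  have hD : 0 < m^2 + k^2 + 1 := by positivity
  set X := (2*m+1)/(m^2+k^2+1) with hX
  have hX0 : 0 ≤ X := by positivity
  have e1 : log ((m+1)^2 + k^2 + 1) / 2 - log (m^2 + k^2 + 1)/2 = log (1 + X) / 2 := by
    have : 1 + X = ((m+1)^2 + k^2 + 1) / (m^2 + k^2 + 1) := by
      rw [hX, eq_div_iff hD.ne', add_mul, div_mul_cancel₀ _ hD.ne']; ring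
    rw [this, Real.log_div (by positivity) hD.ne']; ring
  have hX4 : X ≤ 4 / (m+1) := by
    rw [hX, div_le_div_iff₀ hD (by positivity)]; nlinarith [sq_nonneg (m - 1)]
  have hX2 : X^2 ≤ 16 / (m+1)^2 := by
    calc X^2 ≤ (4/(m+1))^2 := by gcongr
      _ = _ := by rw [div_pow]; norm_num
  have u1 := Real.log_le_sub_one_of_pos (show 0 < 1 + X by linarith)
  have u2 := Real.one_sub_inv_le_log_of_pos (show 0 < 1 + X by linarith)
  have u3 : X - X^2 ≤ 1 - (1+X)⁻¹ := by
    rw [← sub_nonneg]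
    have : 1 - (1+X)⁻¹ - (X - X^2) = X^3/(1+X) := by field_simp; ring
    rw [this]; positivity
  have a1 := arctan_step (show k/(m+1) < (k+1)/(m+1) by gcongr; linarith)
  have e2 : ((k+1)/(m+1) - k/(m+1)) = 1/(m+1) := by ring
  have e3 : 1/(m+1) / (1 + (k/(m+1))^2) = (m+1)/((m+1)^2 + k^2) := by field_simp
  rw [e2, e3, div_pow, one_pow] at a1
  have d1 : |X/2 - (m+1)/((m+1)^2+k^2)| ≤ 4 / (m+1)^2 := by
    have : X/2 - (m+1)/((m+1)^2+k^2) = (3/2*m^2+m-1/2-k^2/2)/((m^2+k^2+1)*((m+1)^2+k^2)) := by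
      rw [hX]; field_simp; ring
    rw [this, abs_div, abs_of_pos (show 0 < (m^2+k^2+1)*((m+1)^2+k^2) by positivity), div_le_div_iff₀ (by positivity) (by positivity)]
    have n1 : |3/2*m^2+m-1/2-k^2/2| ≤ 2*(m+1)^2 := by rw [abs_le]; constructor <;> nlinarith
    have n2 : (m+1)^2 ≤ 2 * (m^2+k^2+1) := by nlinarith [sq_nonneg (m-1)]
    calc _ ≤ 2*(m+1)^2 * (m+1)^2 := by gcongr
      _ ≤ 2*(2 * (m^2+k^2+1)) * ((m+1)^2+k^2) := by gcongr; linarith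
      _ = _ := by ring
  have s1 : (13:ℝ)/(m+1)^2 = 8/(m+1)^2 + 4/(m+1)^2 + 1/(m+1)^2 := by ring
  have s2 : (16:ℝ)/(m+1)^2 = 2 * (8/(m+1)^2) := by ring
  rw [e1, s1]
  rw [abs_le] at a1 d1 ⊢
  have h13 : 0 ≤ 8/(m+1)^2 := by positivity
  constructor <;> linarith [a1.1, a1.2, d1.1, d1.2]
theorem flux_lim (R : ℕ) : |∑ x ∈ Q 0 (R+1), mu x - Real.pi/2| ≤ 27 / ((R:ℝ)+1) := by
  have hR : (0:ℝ) ≤ R := Nat.cast_nonneg R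
  rw [flux]
  have e : ∑ i ∈ range (2*R+1), (Real.arctan ((((i:ℝ)-R)+1)/(R+1)) - Real.arctan (((i:ℝ)-R)/(R+1))) =
      Real.pi/4 + Real.arctan (R/(R+1)) := by
    have h1 := Finset.sum_range_sub (fun i : ℕ => Real.arctan (((i:ℝ)-R)/(R+1))) (2*R+1)
    push_cast at h1
    rw [show (2 * (R:ℝ) + 1 - R) = R + 1 by ring, div_self (by positivity), Real.arctan_one,
      zero_sub, neg_div, Real.arctan_neg, sub_neg_eq_add] at h1
    rw [← h1]
    refine sum_congr rfl fun i _ => ?_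
    rw [show (i:ℝ) - R + 1 = i + 1 - R by ring]
  have a : |Real.arctan (R/(R+1)) - Real.pi/4| ≤ 1 / ((R:ℝ)+1) := by
    have hlt : (R:ℝ)/(R+1) < 1 := by rw [div_lt_one (by positivity)]; linarith
    obtain ⟨c, hc, e⟩ := exists_hasDerivAt_eq_slope Real.arctan (fun t => 1 / (1 + t^2)) hlt
      Real.continuous_arctan.continuousOn (fun t _ => by simpa using Real.hasDerivAt_arctan t)
    rw [eq_div_iff (by linarith), Real.arctan_one, show 1 - (R:ℝ)/(R+1) = 1/(R+1) by field_simp; ring] at e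
    rw [abs_sub_comm, ← e, abs_of_nonneg (by positivity)]
    have : 1/(1+c^2) ≤ 1 := by rw [div_le_one (by positivity)]; nlinarith [sq_nonneg c]
    calc _ ≤ 1 * (1/((R:ℝ)+1)) := by gcongr
      _ = _ := one_mul _
  have b : |∑ i ∈ range (2*R+1), (ff ((R:ℤ)+1, (i:ℤ) - R) - ff ((R:ℤ), (i:ℤ) - R)) -
    (Real.pi/4 + Real.arctan (R/(R+1)))| ≤ (2*R+1) * (13 / ((R:ℝ)+1)^2) := by
    rw [← e, ← sum_sub_distrib]
    refine (Finset.abs_sum_le_sum_abs _ _).trans ?_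
    have := Finset.sum_le_card_nsmul (range (2*R+1)) (fun i : ℕ => |ff ((R:ℤ)+1, (i:ℤ) - R) - ff ((R:ℤ), (i:ℤ) - R) -
      (Real.arctan ((((i:ℝ)-R)+1)/(R+1)) - Real.arctan (((i:ℝ)-R)/(R+1)))|) (13 / ((R:ℝ)+1)^2) (fun i hi => by
        have hi' : (i:ℝ) ≤ 2 * R := by have := mem_range.1 hi; exact_mod_cast (by omega : i ≤ 2*R)
        have := flux_term R ((i:ℝ) - R) (by rw [abs_le]; constructor <;> linarith [Nat.cast_nonneg (α := ℝ) i])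
        simpa [ff, qf] using this)
    simpa using this
  have c : (2*(R:ℝ)+1) * (13 / ((R:ℝ)+1)^2) ≤ 26/((R:ℝ)+1) := by
    rw [mul_div_assoc', div_le_div_iff₀ (by positivity) (by positivity)]; nlinarith
  have d : (27:ℝ)/(R+1) = 26/(R+1) + 1/(R+1) := by ring
  rw [d]
  rw [abs_le] at a b ⊢
  constructor <;> linarith [a.1, a.2, b.1, b.2]
theorem mu_moment : ∃ C : ℝ, 0 < C ∧ ∀ R : ℕ, ∑ y ∈ Q 0 R, mu y * l1 y ≤ C := by
  set w : ℤ → ℝ := fun a => (1 + (a:ℝ)^2) ^ (-(3/4):ℝ) with hw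
  have hs : Summable w := by
    have h := (Real.summable_one_div_int_add_rpow 0 (3/2)).2 (by norm_num)
    refine Summable.of_norm_bounded_eventually h ?_
    rw [Filter.eventually_cofinite]
    refine (Set.finite_singleton (0:ℤ)).subset fun a ha => ?_
    by_contra hne
    apply ha
    have ha0 : (a:ℝ) ≠ 0 := by exact_mod_cast hne
    have hpos : 0 < |(a:ℝ)| := abs_pos.2 ha0
    rw [hw, Real.norm_of_nonneg (by positivity), add_zero, one_div, ← Real.rpow_neg hpos.le]
    have e : |(a:ℝ)| ^ (-(3/2):ℝ) = ((a:ℝ)^2) ^ (-(3/4):ℝ) := by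
      rw [← sq_abs, ← Real.rpow_natCast, ← Real.rpow_mul hpos.le]; norm_num
    rw [e]
    exact Real.rpow_le_rpow_of_nonpos (by positivity) (by linarith) (by norm_num)
  have hw0 : ∀ a, 0 ≤ w a := fun a => by simp only [hw]; positivity
  set A := ∑' a, w a
  have hA : 0 ≤ A := tsum_nonneg hw0
  refine ⟨6 * (A * A) + 1, by positivity, fun R => ?_⟩
  have h1 : ∀ y ∈ Q 0 R, mu y * l1 y ≤ 6 * (w y.1 * w y.2) := fun y _ => by
    have hq := qf_pos y
    have hl : (l1 y : ℝ) ≤ 2 * Real.sqrt (qf y) := by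
      have : (l1 y : ℝ) = |(y.1:ℝ)| + |(y.2:ℝ)| := by simp [l1, Nat.cast_natAbs]
      rw [this]
      have a1 : |(y.1:ℝ)| ≤ Real.sqrt (qf y) := Real.abs_le_sqrt (by unfold qf; nlinarith [sq_nonneg (y.2:ℝ)])
      have a2 : |(y.2:ℝ)| ≤ Real.sqrt (qf y) := Real.abs_le_sqrt (by unfold qf; nlinarith [sq_nonneg (y.1:ℝ)])
      linarith
    have h2 : (qf y)^(-(3/2):ℝ) ≤ w y.1 * w y.2 := by
      simp only [hw]
      rw [← Real.mul_rpow (by positivity) (by positivity)]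
      have : (qf y)^(-(3/2):ℝ) = ((qf y)^2)^(-(3/4):ℝ) := by
        rw [← Real.rpow_natCast, ← Real.rpow_mul hq.le]; norm_num
      rw [this]
      refine Real.rpow_le_rpow_of_nonpos (by positivity) ?_ (by norm_num)
      unfold qf; nlinarith [sq_nonneg (y.1:ℝ), sq_nonneg (y.2:ℝ), mul_nonneg (sq_nonneg (y.1:ℝ)) (sq_nonneg (y.2:ℝ)), sq_nonneg ((y.1:ℝ)^2), sq_nonneg ((y.2:ℝ)^2)]
    calc mu y * l1 y ≤ 3 / (qf y)^2 * (2 * Real.sqrt (qf y)) := by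
          gcongr
          · exact (mu_bd y).2
      _ = 6 * (qf y)^(-(3/2):ℝ) := by
          rw [Real.sqrt_eq_rpow, show (-(3/2):ℝ) = 1/2 - (2:ℕ) by norm_num, Real.rpow_sub hq, Real.rpow_natCast]; ring
      _ ≤ _ := by gcongr
  calc _ ≤ ∑ y ∈ Q 0 R, 6 * (w y.1 * w y.2) := sum_le_sum h1
    _ = 6 * ((∑ a ∈ Finset.Ioo (-(R:ℤ)) R, w a) * (∑ a ∈ Finset.Ioo (-(R:ℤ)) R, w a)) := by
        rw [← mul_sum, Finset.sum_mul_sum, ← Finset.sum_product']; simp [Q]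
    _ ≤ 6 * (A * A) := by
        have := hs.sum_le_tsum (Finset.Ioo (-(R:ℤ)) R) (fun a _ => hw0 a)
        have h0 : 0 ≤ ∑ a ∈ Finset.Ioo (-(R:ℤ)) R, w a := sum_nonneg fun a _ => hw0 a
        gcongr
    _ ≤ _ := by linarith
theorem Q_shift (v : Vtx) (R : ℕ) : Q v R = (Q 0 R).map (Equiv.addRight v).toEmbedding := by
  ext x
  simp only [Finset.mem_map_equiv, mem_Q, Equiv.addRight_symm, Equiv.coe_addRight, Prod.fst_add, Prod.snd_add,
    Prod.fst_neg, Prod.snd_neg, Prod.fst_zero, Prod.snd_zero]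
  omega
def near (v x : Vtx) (R : ℕ) : Prop := |x.1 - v.1| ≤ R ∧ |x.2 - v.2| ≤ R
theorem base0 : ∃ C : ℝ, 0 < C ∧ ∀ R : ℕ, 1 ≤ R → ∀ x : Vtx, near 0 x R →
    |gr (Q 0 R) 0 x - (log R - ff x)| ≤ C := by
  obtain ⟨C1, hC1, hm⟩ := mu_moment
  have hp := Real.pi_pos
  refine ⟨4 * C1 + 109, by positivity, fun R hR x hx => ?_⟩
  obtain ⟨n, rfl⟩ : ∃ n, R = n + 1 := ⟨R - 1, by omega⟩
  set I := Q 0 (n+1)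
  have hRp : (0:ℝ) < ((n+1:ℕ):ℝ) := by positivity
  have bd : ∀ x : Vtx, near 0 x (n+1) → x ∉ I → log (n+1:ℕ) ≤ ff x ∧ ff x ≤ log (n+1:ℕ) + 1 := by
    intro x hx hxI
    have hx1 : |(x.1:ℝ)| ≤ (n+1:ℕ) := by have := hx.1; simp at this; exact_mod_cast this
    have hx2 : |(x.2:ℝ)| ≤ (n+1:ℕ) := by have := hx.2; simp at this; exact_mod_cast this
    have h1 := sq_le_sq' (by linarith [abs_nonneg (x.1:ℝ)]) hx1
    have h2 := sq_le_sq' (by linarith [abs_nonneg (x.2:ℝ)]) hx2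
    rw [sq_abs] at h1 h2
    have h3 : ((n+1:ℕ):ℝ)^2 ≤ qf x := by
      have h4 : ((n+1:ℕ):ℤ) ≤ |x.1| ∨ ((n+1:ℕ):ℤ) ≤ |x.2| := by
        by_contra! hc
        apply hxI; rw [mem_Q]; simp only [Prod.fst_zero, Prod.snd_zero]
        rw [abs_lt, abs_lt] at hc; omega
      unfold qf
      rcases h4 with h4 | h4
      · have h5 : ((n+1:ℕ):ℝ) ≤ |(x.1:ℝ)| := by exact_mod_cast h4
        nlinarith [sq_abs (x.1:ℝ), sq_nonneg (x.2:ℝ)]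
      · have h5 : ((n+1:ℕ):ℝ) ≤ |(x.2:ℝ)| := by exact_mod_cast h4
        nlinarith [sq_abs (x.2:ℝ), sq_nonneg (x.1:ℝ)]
    have h5 : qf x ≤ 3 * ((n+1:ℕ):ℝ)^2 := by
      have : (1:ℝ) ≤ (n+1:ℕ) := by push_cast; linarith [Nat.cast_nonneg (α := ℝ) n]
      unfold qf; nlinarith
    have e1 := log_le_log (by positivity) h3
    have e2 := log_le_log (qf_pos x) h5
    rw [log_mul (by norm_num) (by positivity), Real.log_pow] at e2
    rw [Real.log_pow] at e1
    push_cast at e1 e2 ⊢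
    have := Real.log_le_sub_one_of_pos (show (0:ℝ) < 3 by norm_num)
    unfold ff; constructor <;> linarith
  by_cases hxI : x ∈ I
  swap
  · have := bd x hx hxI
    rw [gr_off hxI, abs_le]; constructor <;> linarith
  set u : Vtx → ℝ := fun z => ff z + 2/Real.pi * ∑ y ∈ I, mu y * gr I y z with hu
  have hLu : ∀ z ∈ I, Lp u z = 0 := fun z hz => by
    rw [hu, Lp_add, Lp_smul, Lp_sum]
    rw [sum_congr rfl (fun y _ => by rw [Lp_smul, gr_Lp y hz])]
    rw [Finset.sum_eq_single z (fun b _ hb => by rw [if_neg (Ne.symm hb)]; ring) (fun h => absurd hz h)]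
    simp only [mu, if_true]; field_simp; ring
  have hoff : ∀ z ∉ I, u z = ff z := fun z hz => by
    simp [hu, gr_off hz]
  have hnb : ∀ z, (∃ w ∈ I, nbr w z) → near 0 z (n+1) := by
    rintro z ⟨w, hw, hwz⟩
    rw [mem_Q] at hw; simp only [Prod.fst_zero, Prod.snd_zero] at hw
    simp only [near, Prod.fst_zero, Prod.snd_zero, abs_le]
    rcases hwz with rfl | rfl | rfl | rfl <;> simp only <;> omega
  have u1 := mp_loc I (fun _ => log (n+1:ℕ)) u (fun z hz => by rw [Lp_const, hLu z hz])
    (fun z hz hw => by rw [hoff z hz]; exact (bd z (hnb z hw) hz).1) x hxI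
  have u2 := mp_loc I u (fun _ => log (n+1:ℕ) + 1) (fun z hz => by rw [Lp_const, hLu z hz])
    (fun z hz hw => by rw [hoff z hz]; exact (bd z (hnb z hw) hz).2) x hxI
  set S := ∑ y ∈ I, mu y
  have d1 : |∑ y ∈ I, mu y * gr I y x - S * gr I 0 x| ≤ 2 * Real.pi * C1 := by
    rw [Finset.sum_mul, ← sum_sub_distrib]
    refine (Finset.abs_sum_le_sum_abs _ _).trans ?_
    calc _ ≤ ∑ y ∈ I, 2 * Real.pi * (mu y * l1 y) := by
          refine sum_le_sum fun y _ => ?_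
          rw [← mul_sub, abs_mul, abs_of_nonneg (mu_bd y).1]
          have := gr_lip I x _ 0 y rfl
          rw [sub_zero, abs_sub_comm] at this
          calc _ ≤ mu y * (2 * Real.pi * l1 y) := mul_le_mul_of_nonneg_left this (mu_bd y).1
            _ = _ := by ring
      _ = 2 * Real.pi * ∑ y ∈ I, mu y * l1 y := by rw [mul_sum]
      _ ≤ _ := by gcongr; exact hm _
  have d2 : gr I 0 x ≤ 2 * Real.pi * (n+1:ℕ) := by
    have := gr_lip I x _ 0 (((n+1:ℕ):ℤ), 0) rfl
    rw [gr_src (y := (((n+1:ℕ):ℤ), 0)) (by rw [mem_Q]; simp)] at this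
    have e : l1 ((((n+1:ℕ):ℤ), 0) - 0) = n+1 := by simp [l1]; omega
    rw [e, sub_zero] at this
    exact (le_abs_self _).trans this
  have d3 : |S * gr I 0 x - Real.pi/2 * gr I 0 x| ≤ 54 * Real.pi := by
    rw [← sub_mul, abs_mul, abs_of_nonneg (gr_nonneg I 0 x)]
    have := flux_lim n
    calc _ ≤ 27/((n:ℝ)+1) * (2 * Real.pi * (n+1:ℕ)) := by
          apply mul_le_mul this d2 (gr_nonneg I 0 x) (by positivity)
      _ = _ := by push_cast; field_simp; ring
  simp only [hu] at u1 u2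
  set A := ∑ y ∈ I, mu y * gr I y x
  have hA : |A - Real.pi/2 * gr I 0 x| ≤ 2 * Real.pi * C1 + 54 * Real.pi := by
    have := abs_add_le (A - S * gr I 0 x) (S * gr I 0 x - Real.pi/2 * gr I 0 x)
    rw [sub_add_sub_cancel] at this; linarith
  have hA2 : |2/Real.pi * A - gr I 0 x| ≤ 4 * C1 + 108 := by
    have e : 2/Real.pi * A - gr I 0 x = 2/Real.pi * (A - Real.pi/2 * gr I 0 x) := by field_simp
    rw [e, abs_mul, abs_of_pos (by positivity)]
    calc _ ≤ 2/Real.pi * (2 * Real.pi * C1 + 54 * Real.pi) := by gcongr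
      _ = _ := by field_simp; ring
  rw [abs_le] at hA2 ⊢
  constructor <;> linarith [hA2.1, hA2.2]
theorem base : ∃ C : ℝ, 0 < C ∧ ∀ R : ℕ, 1 ≤ R → ∀ v x : Vtx, near v x R →
    |gr (Q v R) v x - (log R - ff (x - v))| ≤ C := by
  obtain ⟨C, hC, h⟩ := base0
  refine ⟨C, hC, fun R hR v x hx => ?_⟩
  have := h R hR (x - v) (by simpa [near] using hx)
  rw [← gr_shift (Q 0 R) v 0 (x - v), ← Q_shift, zero_add, sub_add_cancel] at this
  exact this
def Vi (N : ℕ) : Finset Vtx := Finset.Ioo 0 (N:ℤ) ×ˢ Finset.Ioo 0 (N:ℤ)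
theorem mem_Vi {N : ℕ} {x : Vtx} : x ∈ Vi N ↔ (0 < x.1 ∧ x.1 < N) ∧ (0 < x.2 ∧ x.2 < N) := by simp [Vi]
def dd (N : ℕ) (v : Vtx) : ℕ := (min (min v.1 (N - v.1)) (min v.2 (N - v.2))).toNat
theorem ff_zero : ff 0 = 0 := by simp [ff, qf]
theorem ff_ge {x : Vtx} {r : ℕ} (hr : 1 ≤ r) (h : (r:ℤ) ≤ |x.1| ∨ (r:ℤ) ≤ |x.2|) : log r ≤ ff x := by
  have hr' : (0:ℝ) < r := by exact_mod_cast hr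
  have h3 : (r:ℝ)^2 ≤ qf x := by
    unfold qf
    rcases h with h4 | h4
    · have h5 : (r:ℝ) ≤ |(x.1:ℝ)| := by exact_mod_cast h4
      nlinarith [sq_abs (x.1:ℝ), sq_nonneg (x.2:ℝ)]
    · have h5 : (r:ℝ) ≤ |(x.2:ℝ)| := by exact_mod_cast h4
      nlinarith [sq_abs (x.2:ℝ), sq_nonneg (x.1:ℝ)]
  have := log_le_log (by positivity) h3
  rw [Real.log_pow] at this; push_cast at this
  unfold ff; linarith
theorem greenE : ∃ C : ℝ, 0 < C ∧
    (∀ (I : Finset Vtx) (R : ℕ) (y x : Vtx), 1 ≤ R → I ⊆ Q y R → near y x R → gr I y x ≤ log R - ff (x - y) + C) ∧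
    (∀ (I : Finset Vtx) (R : ℕ) (y x : Vtx), 1 ≤ R → Q y R ⊆ I → near y x R → log R - ff (x - y) - C ≤ gr I y x) ∧
    (∀ (N : ℕ) (v : Vtx), v ∈ Vi N → gr (Vi N) v v ≤ log (dd N v) + C) := by
  obtain ⟨C, hC, h⟩ := base
  refine ⟨4 * C + 1, by positivity, fun I R y x hR hI hx => ?_, fun I R y x hR hI hx => ?_, fun N v hv => ?_⟩
  · have h1 := gr_mono hI y x
    have h2 := (abs_le.1 (h R hR y x hx)).2
    linarith
  · have h1 := gr_mono hI y x
    have h2 := (abs_le.1 (h R hR y x hx)).1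
    linarith
  · have key : ∀ w : Vtx, w ∉ Vi N → (-(N:ℤ) ≤ w.1 ∧ w.1 ≤ 2 * N) → (-(N:ℤ) ≤ w.2 ∧ w.2 ≤ 2 * N) →
        (∀ x : Vtx, (0 ≤ x.1 ∧ x.1 ≤ N) → (0 ≤ x.2 ∧ x.2 ≤ N) → qf (x - v) ≤ qf (x - w)) →
        gr (Vi N) v v ≤ ff (v - w) + 4 * C := by
      intro w hw hw1 hw2 hq
      rw [mem_Vi] at hv
      have hR : 1 ≤ 4 * N := by omega
      have := mp_loc (Vi N) (gr (Vi N) v) (fun z => (gr (Q v (4*N)) v z - gr (Q w (4*N)) w z) + 2 * C)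
        (fun z hz => by
          rw [Lp_add, Lp_sub, Lp_const, gr_Lp v hz]
          have hz' := mem_Vi.1 hz
          rw [gr_Lp v (by rw [mem_Q]; push_cast; omega), gr_Lp w (by rw [mem_Q]; push_cast; omega),
            if_neg (show z ≠ w from fun e => hw (e ▸ hz))]; linarith)
        (fun z hz hnz => by
          obtain ⟨y, hy, hyz⟩ := hnz
          rw [mem_Vi] at hy
          have hz' : (0 ≤ z.1 ∧ z.1 ≤ N) ∧ (0 ≤ z.2 ∧ z.2 ≤ N) := by
            rcases hyz with rfl | rfl | rfl | rfl <;> simp only <;> omega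
          rw [gr_off hz]
          have e1 := (abs_le.1 (h (4*N) hR v z (by simp only [near, abs_le]; push_cast; omega))).1
          have e2 := (abs_le.1 (h (4*N) hR w z (by simp only [near, abs_le]; push_cast; omega))).2
          have e3 : ff (z - v) ≤ ff (z - w) := by
            have := log_le_log (qf_pos _) (hq z hz'.1 hz'.2)
            unfold ff; linarith
          linarith) v (mem_Vi.2 hv)
      have e1 := (abs_le.1 (h (4*N) hR v v (by simp [near]))).2
      have e2 := (abs_le.1 (h (4*N) hR w v (by simp only [near, abs_le]; push_cast; omega))).1
      rw [sub_self, ff_zero] at e1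
      linarith
    have key2 : ∃ w : Vtx, gr (Vi N) v v ≤ ff (v - w) + 4 * C ∧ qf (v - w) ≤ 4 * (dd N v:ℝ)^2 + 1 := by
      have hv' := mem_Vi.1 hv
      obtain ⟨a, b⟩ := v
      simp only at hv'
      have hd : dd N (a,b) = (min (min a (N - a)) (min b (N - b))).toNat := rfl
      have cs : ((dd N (a,b):ℤ) = a) ∨ ((dd N (a,b):ℤ) = N - a) ∨ ((dd N (a,b):ℤ) = b) ∨ ((dd N (a,b):ℤ) = N - b) := by
        omega
      have r1 : ((0:ℝ) < a ∧ (a:ℝ) < N) ∧ ((0:ℝ) < b ∧ (b:ℝ) < N) := by exact_mod_cast hv'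
      rcases cs with e | e | e | e
      on_goal 1 => refine ⟨(-a, b), key _ ?_ ?_ ?_ ?_, ?_⟩
      on_goal 6 => refine ⟨(2*N-a, b), key _ ?_ ?_ ?_ ?_, ?_⟩
      on_goal 11 => refine ⟨(a, -b), key _ ?_ ?_ ?_ ?_, ?_⟩
      on_goal 16 => refine ⟨(a, 2*N-b), key _ ?_ ?_ ?_ ?_, ?_⟩
      all_goals try (rw [mem_Vi]; simp only; omega)
      all_goals try (simp only; omega)
      all_goals have e' := congrArg (Int.cast : ℤ → ℝ) e
      all_goals push_cast at e'
      all_goals try (rw [e']; simp only [qf, Prod.mk_sub_mk]; push_cast; apply le_of_eq; ring)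
      all_goals
        rintro ⟨x, y⟩ hx hy
        simp only at hx hy
        have hx' : (0:ℝ) ≤ x ∧ (x:ℝ) ≤ N := by exact_mod_cast hx
        have hy' : (0:ℝ) ≤ y ∧ (y:ℝ) ≤ N := by exact_mod_cast hy
        simp only [qf, Prod.mk_sub_mk]; push_cast
        nlinarith
    obtain ⟨w, hw1, hw2⟩ := key2
    have hd1 : (1:ℝ) ≤ dd N v := by
      have hv' := mem_Vi.1 hv
      exact_mod_cast (show 1 ≤ dd N v by unfold dd; omega)
    have h5 : qf (v - w) ≤ 5 * (dd N v:ℝ)^2 := by nlinarith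
    have h6 := log_le_log (qf_pos _) h5
    rw [log_mul (by norm_num) (by positivity), Real.log_pow] at h6
    have h7 : log 5 ≤ 2 := by
      rw [Real.log_le_iff_le_exp (by norm_num)]
      have := add_one_le_exp (1:ℝ)
      have e : exp 2 = exp 1 * exp 1 := by rw [← exp_add]; norm_num
      have := Real.exp_one_gt_d9
      rw [e]; nlinarith
    unfold ff at hw1
    push_cast at h6
    linarith
theorem Q_dd {N : ℕ} {v : Vtx} : Q v (dd N v) ⊆ Vi N := by
  intro z hz
  rw [mem_Q] at hz; rw [mem_Vi]
  unfold dd at hz; omega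
theorem incr_bd : ∃ C : ℝ, 0 < C ∧ ∀ (N : ℕ) (I : Finset Vtx) (y : Vtx) (r R : ℕ), 1 ≤ R → r ≤ R →
    I ⊆ Vi N → I ⊆ Q y R → Q y r ∩ Vi N ⊆ I →
    gr I y y - gr (Q y r ∩ Vi N) y y ≤ log R - log r + C := by
  obtain ⟨C, hC, h3, h2, h1⟩ := greenE
  refine ⟨C, hC, fun N I y r R hR hrR hIV hIQ hJ => ?_⟩
  rcases Nat.eq_zero_or_pos r with rfl | hr
  · have := h3 I R y y hR hIQ (by simp [near])
    rw [sub_self, ff_zero] at this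
    have := gr_nonneg (Q y 0 ∩ Vi N) y y
    simp; linarith
  have hl : log r ≤ log R := log_le_log (by exact_mod_cast hr) (by exact_mod_cast hrR)
  refine mp_le (Q y r ∩ Vi N) (fun z => gr I y z - gr (Q y r ∩ Vi N) y z) (fun _ => log R - log r + C)
    (fun z hz => ?_) (fun z hz => ?_) y
  · rw [Lp_const, Lp_sub, gr_Lp y hz, gr_Lp y (hJ hz)]; simp
  · simp only [gr_off hz, sub_zero]
    by_cases hzI : z ∈ I
    · have hzQ := mem_Q.1 (hIQ hzI)
      have := h3 I R y z hR hIQ (by simp only [near, abs_le]; omega)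
      have hnQ : z ∉ Q y r := fun h => hz (Finset.mem_inter.2 ⟨h, hIV hzI⟩)
      have := ff_ge (x := z - y) hr (by
        rw [mem_Q] at hnQ; simp only [Prod.fst_sub, Prod.snd_sub, le_abs]; omega)
      linarith
    · rw [gr_off hzI]; linarith
def En (V : Finset Vtx) : (Vtx → ℝ) →ₗ[ℝ] (Vtx → ℝ) →ₗ[ℝ] ℝ :=
  LinearMap.mk₂ ℝ (fun g g' => 2/Real.pi * ∑ z ∈ V, Lp g z * g' z)
    (fun a b c => by
      rw [← mul_add, ← sum_add_distrib]
      exact congrArg _ (sum_congr rfl fun z _ => by rw [show Lp (a+b) z = _ from Lp_add a b z]; ring))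
    (fun a b c => by
      simp only [mul_sum, smul_eq_mul]
      exact sum_congr rfl fun z _ => by rw [show Lp (a•b) z = a * Lp b z from Lp_smul a b z]; ring)
    (fun a b c => by
      rw [← mul_add, ← sum_add_distrib]
      exact congrArg _ (sum_congr rfl fun z _ => by simp only [Pi.add_apply]; ring))
    (fun a b c => by
      simp only [mul_sum, smul_eq_mul, Pi.smul_apply]
      exact sum_congr rfl fun z _ => by ring)
theorem En_def (V : Finset Vtx) (g g' : Vtx → ℝ) : En V g g' = 2/Real.pi * ∑ z ∈ V, Lp g z * g' z := rfl
def Sp (I : Finset Vtx) : Submodule ℝ (Vtx → ℝ) where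
  carrier := {g | ∀ x ∉ I, g x = 0}
  add_mem' := fun ha hb x hx => by simp [ha x hx, hb x hx]
  zero_mem' := fun _ _ => rfl
  smul_mem' := fun c a ha x hx => by simp [ha x hx]
def Ha (I : Finset Vtx) : Submodule ℝ (Vtx → ℝ) where
  carrier := {g | ∀ x ∈ I, Lp g x = 0}
  add_mem' := fun {a b} ha hb x hx => by rw [show Lp (a+b) x = _ from Lp_add a b x, ha x hx, hb x hx, add_zero]
  zero_mem' := fun x _ => Lp_const 0 x
  smul_mem' := fun c a ha x hx => by rw [show Lp (c•a) x = _ from Lp_smul c a x, ha x hx, mul_zero]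
theorem Sp_mono {I J : Finset Vtx} (h : I ⊆ J) : Sp I ≤ Sp J := fun _ hg x hx => hg x fun hx' => hx (h hx')
theorem Ha_anti {I J : Finset Vtx} (h : I ⊆ J) : Ha J ≤ Ha I := fun _ hg x hx => hg x (h hx)
theorem gr_Sp (I : Finset Vtx) (y : Vtx) : gr I y ∈ Sp I := fun _ hx => gr_off hx
theorem gr_sub_Ha {I J : Finset Vtx} (h : I ⊆ J) (y : Vtx) : gr J y - gr I y ∈ Ha I := fun x hx => by
  rw [show Lp (gr J y - gr I y) x = _ from Lp_sub _ _ x, gr_Lp y hx, gr_Lp y (h hx), sub_self]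
theorem Sp_Ha {I J : Finset Vtx} (h : ∀ x ∈ J, x ∉ I ∧ ∀ y, nbr x y → y ∉ I) : Sp I ≤ Ha J := fun g hg x hx => by
  obtain ⟨h0, h1⟩ := h x hx
  simp only [Lp, avg]
  rw [hg x h0, hg _ (h1 _ (by simp [nbr])), hg _ (h1 _ (by simp [nbr])), hg _ (h1 _ (by simp [nbr])), hg _ (h1 _ (by simp [nbr]))]
  simp
theorem En_symm {V : Finset Vtx} {g g' : Vtx → ℝ} (h : g ∈ Sp V) (h' : g' ∈ Sp V) : En V g g' = En V g' g := by
  rw [En_def, En_def, green_id h h']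
  exact congrArg _ (sum_congr rfl fun z _ => mul_comm _ _)
theorem En_orth {V I : Finset Vtx} {g g' : Vtx → ℝ} (h : g ∈ Ha I) (h' : g' ∈ Sp I) : En V g g' = 0 := by
  rw [En_def, Finset.sum_eq_zero, mul_zero]
  intro z _
  by_cases hz : z ∈ I
  · rw [h z hz, zero_mul]
  · rw [h' z hz, mul_zero]
theorem En_gr {V I J : Finset Vtx} (hIJ : I ⊆ J) (hIV : I ⊆ V) (x : Vtx) {g : Vtx → ℝ} (hg : g ∈ Sp I) :
    En V (gr J x) g = g x := by
  have hp := Real.pi_pos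
  rw [En_def]
  have : ∑ z ∈ V, Lp (gr J x) z * g z = Real.pi/2 * g x := by
    by_cases hx : x ∈ I
    · rw [Finset.sum_eq_single x]
      · rw [gr_Lp x (hIJ hx)]; simp
      · intro z _ hzx
        by_cases hz : z ∈ I
        · rw [gr_Lp x (hIJ hz), if_neg hzx]; simp
        · rw [hg z hz, mul_zero]
      · intro h; exact absurd (hIV hx) h
    · rw [hg x hx, Finset.sum_eq_zero, mul_zero]
      intro z _
      by_cases hz : z ∈ I
      · rw [gr_Lp x (hIJ hz), if_neg (show z ≠ x from fun e => hx (e ▸ hz))]; simp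
      · rw [hg z hz, mul_zero]
  rw [this]; field_simp
theorem shift_sq_le {V : Finset Vtx} {g : Vtx → ℝ} (h : g ∈ Sp V) (e : Vtx) :
    ∑ z ∈ V, g (z + e) ^ 2 ≤ ∑ z ∈ V, g z ^ 2 := by
  have h1 : ∑ z ∈ V, g (z + e) ^ 2 = ∑ z ∈ V.map (Equiv.addRight e).toEmbedding, g z ^ 2 := by simp
  have h2 : ∑ z ∈ V, g z ^ 2 = ∑ z ∈ V ∪ V.map (Equiv.addRight e).toEmbedding, g z ^ 2 :=
    Finset.sum_subset Finset.subset_union_left fun z _ hz => by rw [h z hz]; simp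
  rw [h1, h2]
  exact Finset.sum_le_sum_of_subset_of_nonneg Finset.subset_union_right fun _ _ _ => sq_nonneg _
theorem En_nonneg {V : Finset Vtx} {g : Vtx → ℝ} (h : g ∈ Sp V) : 0 ≤ En V g g := by
  rw [En_def]
  refine mul_nonneg (by positivity) ?_
  have k : ∀ e : Vtx, ∑ z ∈ V, g (z + e) * g z ≤ ∑ z ∈ V, g z ^ 2 := fun e => by
    have h1 := shift_sq_le h e
    have h2 : ∑ z ∈ V, 2 * (g (z + e) * g z) ≤ ∑ z ∈ V, (g (z + e) ^ 2 + g z ^ 2) :=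
      sum_le_sum fun z _ => by nlinarith [sq_nonneg (g (z+e) - g z)]
    rw [← mul_sum, sum_add_distrib] at h2
    linarith
  have k1 := k (1, 0)
  have k2 := k (-1, 0)
  have k3 := k (0, 1)
  have k4 := k (0, -1)
  simp only [Prod.add_def, add_zero, ← sub_eq_add_neg] at k1 k2 k3 k4
  simp only [Lp, avg, sub_mul, div_mul_eq_mul_div, add_mul,
    sum_sub_distrib, ← Finset.sum_div, sum_add_distrib]
  have : ∑ z ∈ V, g z * g z = ∑ z ∈ V, g z ^ 2 := sum_congr rfl fun z _ => (sq _).symm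
  linarith
theorem En_cs {V : Finset Vtx} {g g' : Vtx → ℝ} (h : g ∈ Sp V) (h' : g' ∈ Sp V) {s : ℝ} (hs : 0 < s) :
    2 * En V g g' ≤ s * En V g g + s⁻¹ * En V g' g' := by
  have := En_nonneg ((Sp V).sub_mem ((Sp V).smul_mem s h) h')
  simp only [map_sub, map_smul, LinearMap.sub_apply, LinearMap.smul_apply, smul_eq_mul, En_symm h' h] at this
  have h2 : 0 ≤ s⁻¹ * (s * (s * En V g g) - s * En V g g' - (s * En V g g' - En V g' g')) := by
    refine mul_nonneg (by positivity) ?_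
    linarith
  have e : s⁻¹ * (s * (s * En V g g) - s * En V g g' - (s * En V g g' - En V g' g')) =
    s * En V g g - 2 * En V g g' + s⁻¹ * En V g' g' := by field_simp; ring
  linarith
theorem En_add_le {V : Finset Vtx} {g g' : Vtx → ℝ} (h : g ∈ Sp V) (h' : g' ∈ Sp V) :
    En V (g + g') (g + g') ≤ 2 * En V g g + 2 * En V g' g' := by
  have := En_cs h h' one_pos
  simp only [map_add, LinearMap.add_apply, En_symm h' h]; linarith
theorem En_sub_le {V : Finset Vtx} {g g' : Vtx → ℝ} (h : g ∈ Sp V) (h' : g' ∈ Sp V) :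
    En V (g - g') (g - g') ≤ 2 * En V g g + 2 * En V g' g' := by
  have := En_add_le h ((Sp V).neg_mem h')
  rw [← sub_eq_add_neg] at this
  simpa using this
theorem En_gr_sub {V I J : Finset Vtx} (hIJ : I ⊆ J) (hJV : J ⊆ V) (x y : Vtx) :
    En V (gr J x - gr I x) (gr J y - gr I y) = gr J x y - gr I x y := by
  have hI := hIJ.trans hJV
  simp only [map_sub, LinearMap.sub_apply]
  rw [En_gr subset_rfl hJV x (gr_Sp J y), En_gr hIJ hI x (gr_Sp I y), En_gr subset_rfl hI x (gr_Sp I y),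
    En_symm (Sp_mono hI (gr_Sp I x)) (Sp_mono hJV (gr_Sp J y)), En_gr hIJ hI y (gr_Sp I x), gr_symm J y x]
  rw [gr_symm I y x]; ring
theorem regR : ∃ C : ℝ, 0 < C ∧ ∀ (N r : ℕ) (c x c' x' : Vtx), 1 ≤ r →
    (∀ a ∈ [c, c', x'], 4 * |a.1 - x.1| ≤ r ∧ 4 * |a.2 - x.2| ≤ r) →
    let g := (gr (Vi N) x - gr (Q c r ∩ Vi N) x) - (gr (Vi N) x' - gr (Q c' r ∩ Vi N) x')
    En (Vi N) g g ≤ C := by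
  obtain ⟨C, hC, h3, h2, h1⟩ := greenE
  obtain ⟨D, hD, hi⟩ := incr_bd
  refine ⟨64 * (C + D + 20), by positivity, ?_⟩
  intro N r c x c' x' hr hn
  simp only [List.mem_cons, List.not_mem_nil, or_false, forall_eq_or_imp, forall_eq] at hn
  obtain ⟨n1, n2, n3⟩ := hn
  have a1 := n1.1; have a2 := n1.2; have b1 := n2.1; have b2 := n2.2; have d1 := n3.1; have d2 := n3.2
  have ab : ∀ t : ℤ, 4 * |t| ≤ r → -(r:ℤ) ≤ 4 * t ∧ 4 * t ≤ r := fun t ht => by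
    have := neg_abs_le t; have := le_abs_self t; omega
  have a1 := ab _ a1; have a2 := ab _ a2; have b1 := ab _ b1; have b2 := ab _ b2
  have d1 := ab _ d1; have d2 := ab _ d2
  set V := Vi N
  set U := Q x (4*r) ∩ V with hU
  have hUV : U ⊆ V := Finset.inter_subset_right
  have hrp : (0:ℝ) < r := by exact_mod_cast hr
  have l2 : log 2 ≤ 1 := by have := Real.log_le_sub_one_of_pos (show (0:ℝ) < 2 by norm_num); linarith
  have l2' : 0 ≤ log 2 := Real.log_nonneg (by norm_num)
  -- pieces 2
  have p2 : ∀ c x₁ : Vtx, (-(r:ℤ) ≤ 2 * (c.1 - x₁.1) ∧ 2 * (c.1 - x₁.1) ≤ r) → (-(r:ℤ) ≤ 2 * (c.2 - x₁.2) ∧ 2 * (c.2 - x₁.2) ≤ r) →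
      Q c r ∩ V ⊆ U → U ⊆ Q x₁ (8 * r) →
      En V (gr U x₁ - gr (Q c r ∩ V) x₁) (gr U x₁ - gr (Q c r ∩ V) x₁) ≤ D + 4 := by
    intro c x₁ hc1 hc2 hs hs'
    rw [En_gr_sub hs hUV]
    have hsub : Q x₁ ((r+1)/2) ∩ V ⊆ Q c r ∩ V := by
      refine Finset.inter_subset_inter_right ?_
      intro z hz; rw [mem_Q] at hz ⊢; push_cast at hz; omega
    have e1 := gr_mono hsub x₁ x₁
    have e2 := hi N U x₁ ((r+1)/2) (8*r) (by omega) (by omega) hUV hs' (hsub.trans hs)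
    have e3 : log r - log 2 ≤ log ((r+1)/2:ℕ) := by
      rw [← Real.log_div hrp.ne' (by norm_num)]
      refine log_le_log (by positivity) ?_
      rw [div_le_iff₀ (by norm_num)]
      exact_mod_cast (by omega : r ≤ (r+1)/2 * 2)
    have e4 : log (8*r:ℕ) = 3 * log 2 + log r := by
      push_cast
      rw [log_mul (by norm_num) hrp.ne', show (8:ℝ) = 2^3 by norm_num, Real.log_pow]; push_cast; ring
    rw [e4] at e2
    linarith
  -- diagonal of V - U
  have dg : ∀ (x₁ : Vtx) (s : ℕ), x₁ ∈ V → 1 ≤ s → Q x₁ s ⊆ U →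
      gr V x₁ x₁ - gr U x₁ x₁ ≤ log (dd N x₁) - log s + 2 * C := by
    intro x₁ s hx hs hQ
    have e1 := h1 N x₁ hx
    have e2 := h2 U s x₁ x₁ hs hQ (by simp [near])
    rw [sub_self, ff_zero] at e2
    linarith
  have dgz : ∀ x₁ : Vtx, x₁ ∉ V → ∀ z, gr V x₁ z - gr U x₁ z = 0 := fun x₁ h z => by
    rw [gr_src h, gr_src (fun h' => h (hUV h'))]; ring
  have lip : (dd N x : ℤ) ≤ dd N x' + r ∧ (dd N x' : ℤ) ≤ dd N x + r := by
    unfold dd; omega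
  have E12 : 0 ≤ gr V x x' - gr U x x' := sub_nonneg.2 (gr_mono hUV x x')
  have logle : ∀ (a b : ℕ) (k : ℕ), 1 ≤ a → a ≤ 2^k * b → log a ≤ k * log 2 + log b := by
    intro a b k ha hab
    have hb : 1 ≤ b := by rcases Nat.eq_zero_or_pos b with rfl | h <;> omega
    rw [← Real.log_pow, ← log_mul (by positivity) (by positivity)]
    exact log_le_log (by exact_mod_cast ha) (by exact_mod_cast hab)
  have ddpos : ∀ x₁ ∈ V, 1 ≤ dd N x₁ := fun x₁ h => by
    have := mem_Vi.1 h; unfold dd; omega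
  have p1 : (gr V x x - gr U x x) + (gr V x' x' - gr U x' x') - 2 * (gr V x x' - gr U x x') ≤ 8 * C + 12 := by
    by_cases hd : dd N x ≤ 8 * r
    · have q1 : gr V x x - gr U x x ≤ 2 * C + 1 := by
        by_cases hx : x ∈ V
        · have hp := ddpos x hx
          have := dg x (min (dd N x) (4*r)) hx (by omega) (fun z hz => by
            have hz' : z ∈ Q x (dd N x) := by rw [mem_Q] at hz ⊢; omega
            refine Finset.mem_inter.2 ⟨?_, Q_dd hz'⟩
            rw [mem_Q] at hz ⊢; push_cast at hz ⊢; omega)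
          have e := logle (dd N x) (min (dd N x) (4*r)) 1 hp (by omega)
          push_cast at e this; linarith
        · rw [dgz x hx]; linarith
      have q2 : gr V x' x' - gr U x' x' ≤ 2 * C + 2 := by
        by_cases hx : x' ∈ V
        · have hp := ddpos x' hx
          have := dg x' (min (dd N x') (3*r)) hx (by omega) (fun z hz => by
            have hz' : z ∈ Q x' (dd N x') := by rw [mem_Q] at hz ⊢; omega
            refine Finset.mem_inter.2 ⟨?_, Q_dd hz'⟩
            rw [mem_Q] at hz ⊢; push_cast at hz ⊢; omega)
          have e := logle (dd N x') (min (dd N x') (3*r)) 2 hp (by omega)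
          push_cast at e this; linarith
        · rw [dgz x' hx]; linarith
      linarith
    · push Not at hd
      have hx : x ∈ V := Q_dd (v := x) (mem_Q.2 (by omega))
      have hx' : x' ∈ V := Q_dd (v := x) (mem_Q.2 (by omega))
      have q1 := dg x (4*r) hx (by omega) (fun z hz => by
            refine Finset.mem_inter.2 ⟨hz, Q_dd (v := x) ?_⟩
            rw [mem_Q] at hz ⊢; push_cast at hz ⊢; omega)
      have q2 := dg x' (3*r) hx' (by omega) (fun z hz => by
            refine Finset.mem_inter.2 ⟨?_, Q_dd (v := x) ?_⟩ <;>
            (rw [mem_Q] at hz ⊢; push_cast at hz ⊢; omega))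
      have q3 := h2 V (dd N x) x x' (by omega) Q_dd (by simp only [near, abs_le]; omega)
      have q4 := h3 U (4*r) x x' (by omega) Finset.inter_subset_left (by simp only [near, abs_le]; push_cast; omega)
      have e1 := logle (dd N x') (dd N x) 1 (ddpos x' hx') (by omega)
      have e2 := logle (4*r) (3*r) 1 (by omega) (by omega)
      push_cast at e1 e2 q1 q2 q3 q4
      linarith
  have s1 : (gr V x - gr (Q c r ∩ V) x) - (gr V x' - gr (Q c' r ∩ V) x') =
      ((gr V x - gr U x) - (gr V x' - gr U x')) +
      ((gr U x - gr (Q c r ∩ V) x) - (gr U x' - gr (Q c' r ∩ V) x')) := by abel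
  have hc1 : Q c r ∩ V ⊆ U := Finset.inter_subset_inter_right (fun z hz => by
    rw [mem_Q] at hz ⊢; push_cast; omega)
  have hc2 : Q c' r ∩ V ⊆ U := Finset.inter_subset_inter_right (fun z hz => by
    rw [mem_Q] at hz ⊢; push_cast; omega)
  have m1 : ∀ x, gr V x - gr U x ∈ Sp V := fun x => (Sp V).sub_mem (gr_Sp V x) (Sp_mono hUV (gr_Sp U x))
  have m2 : ∀ x c, gr U x - gr (Q c r ∩ V) x ∈ Sp V := fun x c =>
    (Sp V).sub_mem (Sp_mono hUV (gr_Sp U x)) (Sp_mono Finset.inter_subset_right (gr_Sp _ x))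
  have t1 := En_add_le ((Sp V).sub_mem (m1 x) (m1 x')) ((Sp V).sub_mem (m2 x c) (m2 x' c'))
  have t2 := En_sub_le (m2 x c) (m2 x' c')
  have t3 := p2 c x (by omega) (by omega) hc1 (fun z hz => by
    have := mem_Q.1 (Finset.mem_inter.1 hz).1; rw [mem_Q]; push_cast at this ⊢; omega)
  have t4 := p2 c' x' (by omega) (by omega) hc2 (fun z hz => by
    have := mem_Q.1 (Finset.mem_inter.1 hz).1; rw [mem_Q]; push_cast at this ⊢; omega)
  have t5 : En V ((gr V x - gr U x) - (gr V x' - gr U x')) ((gr V x - gr U x) - (gr V x' - gr U x')) =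
    (gr V x x - gr U x x) + (gr V x' x' - gr U x' x') - 2 * (gr V x x' - gr U x x') := by
    rw [map_sub (En V) (gr V x - gr U x), LinearMap.sub_apply, map_sub (En V (gr V x - gr U x)) (gr V x - gr U x),
      map_sub (En V (gr V x' - gr U x')) (gr V x - gr U x), En_symm (m1 x') (m1 x)]
    simp only [En_gr_sub hUV subset_rfl]; ring
  simp only [s1]
  linarith
end GP

noncomputable section HZ
open Finset (range mem_range sum_congr sum_add_distrib mul_sum sum_le_sum sum_range_succ sum_sub_distrib sum_nonneg Ico mem_Ico single_le_sum)
open Real (exp log exp_pos exp_add log_le_log add_one_le_exp exp_le_exp exp_log exp_zero exp_sub log_mul measurable_exp)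
open MeasureTheory hiding Lp
open ProbabilityTheory
theorem mem_VN {N : ℕ} {x : Vtx} : x ∈ VN N ↔ (0 ≤ x.1 ∧ x.1 ≤ N) ∧ (0 ≤ x.2 ∧ x.2 ≤ N) := by
  simp only [VN, Finset.mem_Icc, Prod.le_def]; tauto
theorem intr_iff {B : Finset Vtx} {v : Vtx} : v ∈ intr B ↔ v ∈ B ∧
    ((v.1 + 1, v.2) ∈ B ∧ (v.1 - 1, v.2) ∈ B ∧ (v.1, v.2 + 1) ∈ B ∧ (v.1, v.2 - 1) ∈ B) := by
  simp only [intr, bdry, Finset.mem_sdiff, Finset.mem_filter]; tauto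
theorem intr_VN (N : ℕ) : intr (VN N) = Vi N := by
  ext x; simp only [intr_iff, mem_VN, mem_Vi]; omega
theorem Vi_VN (N : ℕ) : Vi N ⊆ VN N := fun x => by rw [mem_Vi, mem_VN]; omega
def rad (N : ℕ) (t : ℝ) : ℕ := if t = 0 then N else if t = 1 then 0 else ⌊(N:ℝ) ^ (1 - t) / 2⌋₊
def Dn (N : ℕ) (t : ℝ) (v : Vtx) : Finset Vtx := Q v (rad N t) ∩ Vi N
theorem Dn_Vi {N : ℕ} {t : ℝ} {v : Vtx} : Dn N t v ⊆ Vi N := Finset.inter_subset_right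
theorem intr_nbhd {N : ℕ} {t : ℝ} {v : Vtx} (hv : v ∈ VN N) : intr (nbhd N t v) = Dn N t v := by
  unfold nbhd Dn rad
  split_ifs with h0 h1
  · rw [intr_VN]; ext x; rw [Finset.mem_inter, mem_Q]; rw [mem_VN] at hv
    constructor
    · intro h; refine ⟨?_, h⟩; rw [mem_Vi] at h; omega
    · exact fun h => h.2
  · ext x; simp [intr_iff, mem_Q, Prod.ext_iff]; omega
  · have key : ∀ a b : ℤ, |(a:ℝ) - b| ≤ (N:ℝ) ^ (1 - t) / 2 ↔ -(⌊(N:ℝ) ^ (1 - t) / 2⌋₊ : ℤ) ≤ a - b ∧ a - b ≤ ⌊(N:ℝ) ^ (1 - t) / 2⌋₊ := by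
      intro a b
      rw [← abs_le, ← Int.cast_sub, ← Int.cast_abs, ← Int.natCast_natAbs, Int.cast_natCast, ← Nat.le_floor_iff (by positivity)]
      omega
    ext x
    simp only [intr_iff, Finset.mem_filter, key, mem_VN, Finset.mem_inter, mem_Q, mem_Vi]
    omega
theorem rad_anti {N : ℕ} (hN : 1 ≤ N) {s t : ℝ} (hs : 0 ≤ s) (hst : s ≤ t) (ht : t ≤ 1) : rad N t ≤ rad N s := by
  have hN' : (1:ℝ) ≤ N := by exact_mod_cast hN
  unfold rad
  split_ifs with h1 h2 h3 h4 h5 h6 h7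
  · exact le_rfl
  · linarith
  · exact absurd (by linarith) h2
  · omega
  · omega
  · omega
  · refine Nat.floor_le_of_le ?_
    have : (N:ℝ) ^ (1 - t) ≤ N ^ (1:ℝ) := Real.rpow_le_rpow_of_exponent_le hN' (by linarith)
    rw [Real.rpow_one] at this
    linarith
  · exact absurd (by linarith) h4
  · refine Nat.floor_le_floor ?_
    have : (N:ℝ) ^ (1 - t) ≤ N ^ (1 - s:ℝ) := Real.rpow_le_rpow_of_exponent_le hN' (by linarith)
    linarith
theorem Q_mono {v : Vtx} {r s : ℕ} (h : r ≤ s) : Q v r ⊆ Q v s := fun z => by rw [mem_Q, mem_Q]; omega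
theorem Dn_anti {N : ℕ} (hN : 1 ≤ N) {s t : ℝ} (hs : 0 ≤ s) (hst : s ≤ t) (ht : t ≤ 1) (v : Vtx) : Dn N t v ⊆ Dn N s v :=
  Finset.inter_subset_inter_right (Q_mono (rad_anti hN hs hst ht))
abbrev X (N : ℕ) (g : Vtx → ℝ) (ω : FieldSp) : ℝ := En (Vi N) g ω
theorem X_meas (N : ℕ) (g : Vtx → ℝ) : Measurable (X N g) := by
  unfold X; simp only [En_def]; fun_prop
abbrev EV (N : ℕ) (g g' : Vtx → ℝ) : ℝ := En (Vi N) g g'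
theorem X_law {N : ℕ} {P : Measure FieldSp} (h : IsGFF N P) {g : Vtx → ℝ} (hg : g ∈ Sp (Vi N)) :
    P.map (X N g) = gaussianReal 0 (Real.toNNReal (EV N g g)) := by
  obtain ⟨_, G, ⟨G0, G1⟩, hG⟩ := h
  have hGgr : ∀ x y, G x y = gr (Vi N) y x := by
    intro x y
    rw [intr_VN] at G0 G1
    by_cases hy : y ∈ Vi N
    · refine congrFun (gr_uniq (Vi N) y (fun x => G x y) (fun x hx => G0 x y (.inl hx)) fun x hx => ?_) x
      have := G1 y hy x hx
      simp only [Lp, avg]; rw [this]; ring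
    · rw [G0 x y (.inr hy), gr_src hy]
  have := hG (fun v => if v ∈ Vi N then 2/Real.pi * Lp g v else 0)
  have e1 : (fun ω : FieldSp => ∑ v ∈ VN N, (if v ∈ Vi N then 2/Real.pi * Lp g v else 0) * ω v) = X N g := by
    funext ω
    simp only [X, En_def, ite_mul, zero_mul]
    rw [← Finset.sum_filter, Finset.filter_mem_eq_inter, Finset.inter_eq_right.2 (Vi_VN N), mul_sum]
    exact sum_congr rfl fun _ _ => by ring
  rw [e1] at this
  rw [this]
  congr 2
  have e2 : ∀ F : Vtx → ℝ, ∑ v ∈ VN N, (if v ∈ Vi N then F v else 0) = ∑ v ∈ Vi N, F v := fun F => by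
    rw [← Finset.sum_filter, Finset.filter_mem_eq_inter, Finset.inter_eq_right.2 (Vi_VN N)]
  simp only [mul_assoc, ← mul_sum]
  simp only [ite_mul, zero_mul, hGgr, e2]
  unfold EV
  rw [En_def, mul_sum]
  refine sum_congr rfl fun v _ => ?_
  have e3 := gr_rep hg v
  have e4 : ∑ w ∈ Vi N, 2 / Real.pi * Lp g w * gr (Vi N) w v = 2 / Real.pi * ∑ w ∈ Vi N, gr (Vi N) v w * Lp g w := by
    rw [mul_sum]; exact sum_congr rfl fun w _ => by rw [gr_symm]; ring
  rw [e4, e3]; have := Real.pi_pos; field_simp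
theorem X_int {N : ℕ} {P : Measure FieldSp} (h : IsGFF N P) {g : Vtx → ℝ} (hg : g ∈ Sp (Vi N)) (t : ℝ) :
    Integrable (fun ω => exp (t * X N g ω)) P ∧
    ∫ ω, exp (t * X N g ω) ∂P = exp (t^2 * EV N g g / 2) := by
  have hl := X_law h hg
  have hm := (X_meas N g).aemeasurable (μ := P)
  constructor
  · have := integrable_exp_mul_gaussianReal (μ := 0) (v := Real.toNNReal (EV N g g)) t
    rw [← hl] at this
    exact (integrable_map_measure (by fun_prop) hm).1 this
  · have := mgf_gaussianReal hl t
    rw [mgf] at this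
    rw [this, Real.coe_toNNReal _ (En_nonneg hg)]
    congr 1; ring
theorem X_proc {N : ℕ} {P : Measure FieldSp} (h : IsGFF N P) {T : Type*} (a : T → Vtx → ℝ) (ha : ∀ t, a t ∈ Sp (Vi N)) :
    IsGaussianProcess (fun t => X N (a t)) P := by
  have := h.1
  refine ⟨fun I => ⟨?_⟩⟩
  refine isGaussian_of_map_eq_gaussianReal fun L => ?_
  have hm : Measurable (fun ω => I.restrict fun x => X N (a x) ω) := measurable_pi_lambda _ fun i => X_meas N _
  rw [Measure.map_map (by fun_prop) hm]
  refine ⟨0, Real.toNNReal (EV N (∑ i : I, L (Pi.single i 1) • a i.1) (∑ i : I, L (Pi.single i 1) • a i.1)), ?_⟩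
  rw [← X_law h (Submodule.sum_mem _ fun i _ => Submodule.smul_mem _ _ (ha i.1))]
  congr 1
  funext ω
  simp only [Function.comp_apply, X, map_sum, map_smul, LinearMap.coe_sum, Finset.sum_apply, LinearMap.smul_apply, smul_eq_mul]
  conv_lhs => rw [← Finset.univ_sum_single (Finset.restrict I fun t => _), map_sum]
  refine sum_congr rfl fun i _ => ?_
  rw [← mul_one (Finset.restrict I _ i), ← smul_eq_mul, Pi.single_smul, map_smul, smul_eq_mul, mul_comm]
  rfl
theorem X_mem {N : ℕ} {P : Measure FieldSp} (h : IsGFF N P) {g : Vtx → ℝ} (hg : g ∈ Sp (Vi N)) : MemLp (X N g) 2 P := by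
  have := (memLp_id_gaussianReal (μ := 0) (v := Real.toNNReal (EV N g g)) 2)
  rw [← X_law h hg] at this
  exact (memLp_map_measure_iff (by fun_prop) (X_meas N g).aemeasurable).1 this
theorem X_mean {N : ℕ} {P : Measure FieldSp} (h : IsGFF N P) {g : Vtx → ℝ} (hg : g ∈ Sp (Vi N)) : ∫ ω, X N g ω ∂P = 0 := by
  have := integral_id_gaussianReal (μ := 0) (v := Real.toNNReal (EV N g g))
  rw [← X_law h hg, integral_map (X_meas N g).aemeasurable (by fun_prop)] at this
  exact this
theorem X_var {N : ℕ} {P : Measure FieldSp} (h : IsGFF N P) {g : Vtx → ℝ} (hg : g ∈ Sp (Vi N)) : Var[X N g; P] = EV N g g := by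
  have := variance_id_gaussianReal (μ := 0) (v := Real.toNNReal (EV N g g))
  rw [← X_law h hg, variance_map (by fun_prop) (X_meas N g).aemeasurable, Real.coe_toNNReal _ (En_nonneg hg)] at this
  exact this
theorem X_cov {N : ℕ} {P : Measure FieldSp} (h : IsGFF N P) {g g' : Vtx → ℝ} (hg : g ∈ Sp (Vi N)) (hg' : g' ∈ Sp (Vi N)) :
    cov[X N g, X N g'; P] = EV N g g' := by
  have := h.1
  have h1 := variance_add (X_mem h hg) (X_mem h hg')
  have e : X N g + X N g' = X N (g + g') := by funext ω; simp [X]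
  rw [e, X_var h hg, X_var h hg', X_var h ((Sp _).add_mem hg hg')] at h1
  have : EV N (g + g') (g + g') = EV N g g + 2 * EV N g g' + EV N g' g' := by
    simp only [EV, map_add, LinearMap.add_apply, En_symm hg' hg]; ring
  linarith
theorem X_om {N : ℕ} {v : Vtx} (hv : v ∈ Vi N) (ω : FieldSp) : X N (gr (Vi N) v) ω = ω v := by
  have hp := Real.pi_pos
  simp only [X, En_def]
  rw [Finset.sum_eq_single v]
  · rw [gr_Lp v hv]; simp; field_simp
  · intro z hz hzv; rw [gr_Lp v hz, if_neg hzv]; simp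
  · exact fun h => absurd hv h
theorem om_ae {N : ℕ} {P : Measure FieldSp} (h : IsGFF N P) {v : Vtx} (hv : v ∈ VN N) :
    X N (gr (Vi N) v) =ᵐ[P] fun ω => ω v := by
  by_cases hvi : v ∈ Vi N
  · exact .of_forall fun ω => X_om hvi ω
  · have h0 : gr (Vi N) v = 0 := funext fun x => gr_src hvi x
    obtain ⟨_, G, ⟨G0, -⟩, hG⟩ := h
    have := hG (fun w => if w = v then 1 else 0)
    simp only [ite_mul, one_mul, zero_mul, mul_ite, mul_zero, Finset.sum_ite_eq', hv, if_true,
      G0 v v (.inl (by rwa [intr_VN])), Real.toNNReal_zero, gaussianReal_zero_var] at this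
    have h2 : ∀ᵐ x ∂(P.map fun ω : FieldSp => ω v), x = 0 := by
      rw [this]; exact (ae_dirac_iff (measurableSet_eq_fun measurable_id measurable_const)).2 rfl
    filter_upwards [ae_of_ae_map (measurable_pi_apply v).aemeasurable h2] with ω hω
    rw [h0, X, map_zero, hω]; rfl
theorem X_cond {N : ℕ} {P : Measure FieldSp} (h : IsGFF N P) {v : Vtx} (hv : v ∈ VN N) {t : ℝ} {f a b : Vtx → ℝ}
    (hf : f = a + b) (ha : a ∈ Sp (Vi N)) (ha' : a ∈ Ha (Dn N t v)) (hb : b ∈ Sp (Dn N t v)) :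
    P[X N f | scaleAlg N t v] =ᵐ[P] X N a := by
  have := h.1
  have hb' := Sp_mono Dn_Vi hb
  have hle : scaleAlg N t v ≤ (inferInstance : MeasurableSpace FieldSp) :=
    iSup₂_le fun w _ => (measurable_pi_apply w).comap_le
  have e : X N f = X N a + X N b := by funext ω; simp [X, hf]
  have ia : Integrable (X N a) P := (X_mem h ha).integrable (by norm_num)
  have ib : Integrable (X N b) P := (X_mem h hb').integrable (by norm_num)
  have sa : StronglyMeasurable[scaleAlg N t v] (X N a) := by
    refine Measurable.stronglyMeasurable ?_
    unfold X; simp only [En_def]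
    refine Measurable.const_mul (Finset.measurable_fun_sum _ fun z hz => ?_) _
    by_cases hzD : z ∈ Dn N t v
    · simp only [ha' z hzD, zero_mul]; exact measurable_const
    · refine Measurable.const_mul ?_ _
      have h1 : MeasurableSpace.comap (fun ω : FieldSp => ω z) inferInstance ≤ scaleAlg N t v :=
        le_iSup₂_of_le z ⟨Vi_VN N hz, by rwa [intr_nbhd hv]⟩ le_rfl
      exact (measurable_iff_comap_le.2 h1)
  let T := {w : Vtx // w ∈ VN N ∧ w ∉ Dn N t v}
  have hind : Indep (MeasurableSpace.comap (X N b) inferInstance) (scaleAlg N t v) P := by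
    have h1 : IndepFun (fun ω (_ : Unit) => X N b ω) (fun ω (w : T) => ω w.1) P := by
      refine IsGaussianProcess.indepFun_of_covariance_eq_zero (X := fun _ : Unit => X N b) (Y := fun (w : T) ω => ω w.1) ?_
        (fun _ => (X_meas N _).aemeasurable) (fun w => (measurable_pi_apply w.1).aemeasurable) ?_
      · refine (X_proc h (Sum.elim (fun _ : Unit => b) fun w : T => gr (Vi N) w.1)
          (by rintro (s|s); exacts [hb', gr_Sp _ _])).congr ?_
        rintro (s|s)
        · rfl
        · exact om_ae h s.2.1
      · intro _ w
        have hc : cov[X N b, fun ω => ω w.1; P] = cov[X N b, X N (gr (Vi N) w.1); P] := by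
          have hw := om_ae h w.2.1
          unfold covariance
          rw [integral_congr_ae hw]
          refine integral_congr_ae ?_
          filter_upwards [hw] with ω hω
          rw [hω]
        rw [hc, X_cov h hb' (gr_Sp _ _), EV, En_symm hb' (gr_Sp _ _),
          En_gr Dn_Vi Dn_Vi w.1 hb, hb _ w.2.2]
    have h2 := (IndepFun_iff_Indep _ _ _).1 h1
    refine indep_of_indep_of_le_left (indep_of_indep_of_le_right h2 ?_) ?_
    · refine iSup₂_le fun w hw => ?_
      rw [Set.mem_ofPred_eq, intr_nbhd hv] at hw
      exact (((measurable_pi_apply (⟨w, hw⟩ : T))).comp (comap_measurable (fun (ω : FieldSp) (w : T) => ω w.1))).comap_le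
    · exact ((measurable_pi_apply ()).comp (comap_measurable (fun (ω : FieldSp) (_ : Unit) => X N b ω))).comap_le
  have c2 : P[X N b | scaleAlg N t v] =ᵐ[P] fun _ => 0 := by
    have := condExp_indep_eq (X_meas N b).comap_le hle (comap_measurable (X N b)).stronglyMeasurable hind
    rwa [X_mean h hb'] at this
  rw [e]
  filter_upwards [condExp_add ia ib (scaleAlg N t v), c2] with ω h1 h2
  rw [h1, Pi.add_apply, h2, condExp_of_stronglyMeasurable hle sa ia, add_zero]
def xi (N : ℕ) (v : Vtx) (t : ℝ) : Vtx → ℝ := gr (Vi N) v - gr (Dn N t v) v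
theorem xi_Sp (N : ℕ) (v : Vtx) (t : ℝ) : xi N v t ∈ Sp (Vi N) := (Sp _).sub_mem (gr_Sp _ _) (Sp_mono Dn_Vi (gr_Sp _ _))
theorem phi_ae {N : ℕ} {P : Measure FieldSp} (h : IsGFF N P) {v : Vtx} (hv : v ∈ VN N) (t : ℝ) :
    phiScale N P v t =ᵐ[P] X N (xi N v t) :=
  (condExp_congr_ae (om_ae h hv).symm).trans
    (X_cond h hv (b := gr (Dn N t v) v) (by rw [xi, sub_add_cancel]) (xi_Sp _ _ _) (gr_sub_Ha Dn_Vi v) (gr_Sp _ _))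
theorem lam_mono {M : ℕ} {lamv : ℕ → ℝ} (h : ∀ i, i < M → lamv i < lamv (i + 1)) {i j : ℕ} (hij : i ≤ j) (hj : j ≤ M) :
    lamv i ≤ lamv j := by
  induction j, hij using Nat.le_induction with
  | base => exact le_rfl
  | succ k hk ih => exact (ih (by omega)).trans (h k (by omega)).le
def xs (N M : ℕ) (sigv lamv : ℕ → ℝ) (v : Vtx) (α : ℝ) : Vtx → ℝ :=
  ∑ j ∈ Finset.Icc 1 M, sigv j • (xi N v (min α (lamv j)) - xi N v (min α (lamv (j-1))))
theorem psi_ae {N M : ℕ} {sigv lamv : ℕ → ℝ} (hp : ScaleParams M sigv lamv) {P : Measure FieldSp} (h : IsGFF N P) {v : Vtx}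
    (hv : v ∈ VN N) : psiFld N M sigv lamv P v =ᵐ[P] X N (xs N M sigv lamv v 1) := by
  have : ∀ᵐ ω ∂P, ∀ j : ℕ, phiScale N P v (lamv j) ω = X N (xi N v (lamv j)) ω := ae_all_iff.2 fun j => phi_ae h hv (lamv j)
  filter_upwards [this] with ω hω
  simp only [psiFld, hω, xs, X, map_sum, map_smul, map_sub, LinearMap.coe_sum, Finset.sum_apply, LinearMap.smul_apply,
    LinearMap.sub_apply, smul_eq_mul]
  refine sum_congr rfl fun j hj => ?_
  rw [Finset.mem_Icc] at hj
  rw [min_eq_right (hp.2.2.2.1 ▸ lam_mono hp.2.2.2.2 hj.2 le_rfl),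
    min_eq_right (hp.2.2.2.1 ▸ lam_mono hp.2.2.2.2 (by omega : j - 1 ≤ M) le_rfl)]
theorem psiInc_ae {N M : ℕ} (hN : 1 ≤ N) {sigv lamv : ℕ → ℝ} (hp : ScaleParams M sigv lamv) {P : Measure FieldSp} (h : IsGFF N P) {v : Vtx}
    (hv : v ∈ VN N) {i : ℕ} (hi : i ∈ Finset.Icc 1 M) {α α' : ℝ} (h1 : lamv (i - 1) ≤ α) (h2 : α ≤ α') (h3 : α' ≤ lamv i) :
    psiInc N M sigv lamv P v α α' =ᵐ[P] X N (sigv i • (xi N v α' - xi N v α)) := by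
  obtain ⟨hM, hs, hl0, hl1, hl⟩ := hp
  rw [Finset.mem_Icc] at hi
  have l0 : ∀ j ≤ M, 0 ≤ lamv j := fun j hj => hl0 ▸ lam_mono hl (Nat.zero_le j) hj
  have l1 : ∀ j ≤ M, lamv j ≤ 1 := fun j hj => hl1 ▸ lam_mono hl hj le_rfl
  have key : ∀ γ, 0 ≤ γ → γ ≤ 1 → psiScale N M sigv lamv P v γ =ᵐ[P] X N (xs N M sigv lamv v γ) := by
    intro γ g0 g1
    refine (condExp_congr_ae (psi_ae ⟨hM, hs, hl0, hl1, hl⟩ h hv)).trans (X_cond h hv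
      (b := xs N M sigv lamv v 1 - xs N M sigv lamv v γ) (by abel) ?_ ?_ ?_)
    · exact Submodule.sum_mem _ fun j _ => Submodule.smul_mem _ _ (Submodule.sub_mem _ (xi_Sp _ _ _) (xi_Sp _ _ _))
    · have : ∀ j ≤ M, xi N v (min γ (lamv j)) ∈ Ha (Dn N γ v) := fun j hj =>
        Ha_anti (Dn_anti hN (le_min g0 (l0 j hj)) (min_le_left _ _) g1 v) (gr_sub_Ha Dn_Vi v)
      refine Submodule.sum_mem _ fun j hj => Submodule.smul_mem _ _ ?_
      rw [Finset.mem_Icc] at hj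
      exact (Submodule.sub_mem _ (this j hj.2) (this _ (by omega)))
    · have : ∀ j ≤ M, xi N v (min 1 (lamv j)) - xi N v (min γ (lamv j)) ∈ Sp (Dn N γ v) := fun j hj => by
        rw [min_eq_right (l1 j hj)]
        rcases le_total γ (lamv j) with hg | hg
        · rw [min_eq_left hg, xi, xi, sub_sub_sub_cancel_left]
          exact Submodule.sub_mem _ (gr_Sp _ _) (Sp_mono (Dn_anti hN g0 hg (l1 j hj) v) (gr_Sp _ _))
        · rw [min_eq_right hg, sub_self]; exact Submodule.zero_mem _
      rw [xs, xs, ← sum_sub_distrib]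
      refine Submodule.sum_mem _ fun j hj => ?_
      rw [Finset.mem_Icc] at hj
      rw [← smul_sub, sub_sub_sub_comm]
      exact Submodule.smul_mem _ _ (Submodule.sub_mem _ (this j hj.2) (this _ (by omega)))
  have hα0 := (l0 (i-1) (by omega)).trans h1
  have hα1 := h3.trans (l1 i hi.2)
  have e : sigv i • (xi N v α' - xi N v α) = xs N M sigv lamv v α' - xs N M sigv lamv v α := by
    rw [xs, xs, ← sum_sub_distrib, Finset.sum_eq_single i]
    · rw [min_eq_left h3, min_eq_left (h2.trans h3), min_eq_right h1, min_eq_right (h1.trans h2), ← smul_sub]; congr 1; abel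
    · intro j hj hji
      rw [Finset.mem_Icc] at hj
      rcases lt_or_gt_of_ne hji with hlt | hlt
      · have a1 := (lam_mono hl (by omega : j ≤ i - 1) (by omega)).trans h1
        have a2 := (lam_mono hl (by omega : j - 1 ≤ i - 1) (by omega)).trans h1
        rw [min_eq_right a1, min_eq_right a2, min_eq_right (a1.trans h2), min_eq_right (a2.trans h2), sub_self]
      · have a1 := h3.trans (lam_mono hl (by omega : i ≤ j) (by omega))
        have a2 := h3.trans (lam_mono hl (by omega : i ≤ j - 1) (by omega))
        rw [min_eq_left a1, min_eq_left a2, min_eq_left (h2.trans a1), min_eq_left (h2.trans a2)]; simp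
    · intro h'; exact absurd (Finset.mem_Icc.2 hi) h'
  filter_upwards [key α hα0 (h2.trans hα1), key α' (hα0.trans h2) hα1] with ω k1 k2
  rw [psiInc, k1, k2, e]; simp [X]
def lse {ι : Type*} (A : Finset ι) (x : ι → ℝ) : ℝ := log (∑ v ∈ A, exp (x v))
theorem se_pos {ι : Type*} {A : Finset ι} (hA : A.Nonempty) (x : ι → ℝ) : 0 < ∑ v ∈ A, exp (x v) :=
  Finset.sum_pos (fun _ _ => exp_pos _) hA
theorem jen {ι : Type*} (A : Finset ι) (w d : ι → ℝ) (hw : ∀ v ∈ A, 0 ≤ w v) (h1 : ∑ v ∈ A, w v = 1) :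
    exp (∑ v ∈ A, w v * d v) ≤ ∑ v ∈ A, w v * exp (d v) := by
  have := convexOn_exp.map_sum_le hw h1 (p := d) (fun _ _ => Set.mem_univ _)
  simpa using this
theorem lse_sub {ι : Type*} {A : Finset ι} (hA : A.Nonempty) (a b : ι → ℝ) :
    lse A a - lse A b ≤ ∑ v ∈ A, exp (a v) / (∑ u ∈ A, exp (a u)) * (a v - b v) := by
  have hp := se_pos hA a
  have := jen A (fun v => exp (a v) / ∑ u ∈ A, exp (a u)) (fun v => b v - a v) (fun _ _ => by positivity)
    (by rw [← Finset.sum_div, div_self hp.ne'])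
  have e : ∑ v ∈ A, exp (a v) / (∑ u ∈ A, exp (a u)) * exp (b v - a v) =
      (∑ v ∈ A, exp (b v)) / ∑ u ∈ A, exp (a u) := by
    rw [Finset.sum_div]
    refine sum_congr rfl fun v _ => ?_
    rw [div_mul_eq_mul_div, ← exp_add, add_sub_cancel]
  rw [e] at this
  have := log_le_log (exp_pos _) this
  rw [Real.log_exp, Real.log_div (se_pos hA b).ne' hp.ne'] at this
  simp only [lse]
  have e2 : ∑ v ∈ A, exp (a v) / (∑ u ∈ A, exp (a u)) * (b v - a v) =
    - ∑ v ∈ A, exp (a v) / (∑ u ∈ A, exp (a u)) * (a v - b v) := by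
    rw [← Finset.sum_neg_distrib]; exact sum_congr rfl fun _ _ => by ring
  linarith
theorem mp_abs {ι : Type*} [Fintype ι] [Nonempty ι] (μ : Measure (ι → ℝ)) [IsProbabilityMeasure μ]
    (hrot : ∀ θ, (μ.prod μ).map (ContinuousLinearMap.rotation θ) = μ.prod μ) (W : ℝ)
    (hexp : ∀ v s, Integrable (fun x : ι → ℝ => exp (s * x v)) μ ∧ ∫ x, exp (s * x v) ∂μ ≤ exp (s^2*W/2))
    {t : ℝ} (ht : 0 < t) :
    ∫ z, exp (t * (lse Finset.univ z.1 - lse Finset.univ z.2)) ∂(μ.prod μ) ≤ exp (2 * t^2 * W) := by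
  have hne : (Finset.univ : Finset ι).Nonempty := Finset.univ_nonempty
  have hW : 0 ≤ W := by
    obtain ⟨v⟩ := ‹Nonempty ι›
    have h1 := (hexp v 1).2
    have h2 := (hexp v (-1)).2
    have h3 : ∫ x, (2:ℝ) ∂μ ≤ ∫ x : ι → ℝ, (exp (1 * x v) + exp (-1 * x v)) ∂μ := by
      refine integral_mono (integrable_const _) ((hexp v 1).1.add (hexp v (-1)).1) fun x => ?_
      have := add_one_le_exp (1 * x v); have := add_one_le_exp (-1 * x v)
      show (2:ℝ) ≤ _
      linarith
    rw [integral_add (hexp v 1).1 (hexp v (-1)).1] at h3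
    simp at h3 h1 h2
    by_contra hW
    have := Real.exp_lt_exp.2 (show W/2 < 0 by linarith)
    rw [exp_zero] at this
    linarith
  set F : (ι → ℝ) → ℝ := lse Finset.univ with hF
  have Fm : Measurable F := by unfold F lse; fun_prop
  set w : (ι → ℝ) → ι → ℝ := fun x v => exp (x v) / ∑ u, exp (x u) with hw
  have w0 : ∀ x v, 0 ≤ w x v := fun x v => div_nonneg (exp_pos _).le (se_pos hne x).le
  have w1 : ∀ x, ∑ v, w x v = 1 := fun x => by rw [hw, ← Finset.sum_div, div_self (se_pos hne x).ne']
  have wm : ∀ v, Measurable fun x => w x v := fun v => by unfold w; fun_prop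
  have wle : ∀ x v, w x v ≤ 1 := fun x v => (w1 x) ▸ single_le_sum (fun u _ => w0 x u) (Finset.mem_univ v)
  set K : ℝ := Fintype.card ι * exp (W/2) with hK
  set τ : ℕ → ℝ := fun n => Real.pi / 2 / n with hτ
  set a : ℕ → ℝ := fun n => n * t * (1 - Real.cos (τ n)) with ha
  -- the main bound for fixed n
  have key : ∀ n : ℕ, 1 ≤ n → a n ≤ 1 →
      ∫ z, exp (t * (F z.1 - F z.2)) ∂(μ.prod μ) ≤ (1 + a n * K) * exp (2 * t^2 * W) := by
    intro n hn han
    have hn' : (0:ℝ) < n := by exact_mod_cast hn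
    have ha0 : 0 ≤ a n := mul_nonneg (by positivity) (by linarith [Real.cos_le_one (τ n)])
    set b : ℝ := -(n * t * Real.sin (τ n)) with hb
    set G : (ι → ℝ) × (ι → ℝ) → ℝ := fun z => ∑ v, w z.1 v * ((1 - Real.cos (τ n)) * z.1 v - Real.sin (τ n) * z.2 v) with hG
    have Gm : Measurable G := by
      refine Finset.measurable_fun_sum _ fun v _ => ?_
      exact ((wm v).comp measurable_fst).mul (by fun_prop)
    set T : (ι → ℝ) × (ι → ℝ) → ℝ := fun z => exp (n * t * G z) with hT
    have Tm : Measurable T := by unfold T; fun_prop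
    have Tle : ∀ z, T z ≤ ∑ v, (w z.1 v * exp (a n * z.1 v)) * exp (b * z.2 v) := fun z => by
      have := jen Finset.univ (w z.1) (fun v => n * t * ((1 - Real.cos (τ n)) * z.1 v - Real.sin (τ n) * z.2 v)) (fun v _ => w0 _ _) (w1 _)
      simp only [hT, hG, mul_sum]
      refine le_trans (le_of_eq ?_) (this.trans (le_of_eq ?_))
      · congr 1; exact sum_congr rfl fun _ _ => by ring
      · refine sum_congr rfl fun v _ => ?_
        rw [mul_assoc (w z.1 v), ← exp_add]; congr 2; simp only [ha, hb]; ring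
    have i1 : ∀ v, Integrable (fun x => w x v * exp (a n * x v)) μ := fun v =>
      (hexp v (a n)).1.mono ((wm v).mul (by fun_prop)).aestronglyMeasurable (.of_forall fun x => by
        rw [Real.norm_of_nonneg (mul_nonneg (w0 _ _) (exp_pos _).le), Real.norm_of_nonneg (exp_pos _).le]
        exact mul_le_of_le_one_left (exp_pos _).le (wle _ _))
    have i2 : ∀ v, Integrable (fun z : (ι → ℝ) × (ι → ℝ) => (w z.1 v * exp (a n * z.1 v)) * exp (b * z.2 v)) (μ.prod μ) :=
      fun v => (i1 v).mul_prod (hexp v b).1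
    have Ti : Integrable T (μ.prod μ) := (integrable_finsetSum _ fun v _ => i2 v).mono' Tm.aestronglyMeasurable
      (.of_forall fun z => by rw [Real.norm_of_nonneg (exp_pos _).le]; exact Tle z)
    have hbb : b^2 * W / 2 ≤ 2 * t^2 * W := by
      have h1 : |Real.sin (τ n)| ≤ |τ n| := Real.abs_sin_le_abs
      have h2 : |b| ≤ 2 * t := by
        rw [hb, abs_neg, abs_mul, abs_of_nonneg (by positivity : 0 ≤ n * t)]
        have h3 : |τ n| = Real.pi/2/n := abs_of_nonneg (by positivity)
        calc n * t * |Real.sin (τ n)| ≤ n * t * (Real.pi/2/n) := by rw [← h3]; gcongr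
          _ = t * (Real.pi/2) := by field_simp
          _ ≤ _ := by nlinarith [Real.pi_le_four]
      have h4 : b^2 ≤ (2*t)^2 := sq_le_sq' (by linarith [abs_le.1 h2]) (abs_le.1 h2).2
      nlinarith
    have hTint : ∫ z, T z ∂(μ.prod μ) ≤ (1 + a n * K) * exp (2 * t^2 * W) := by
      calc ∫ z, T z ∂(μ.prod μ) ≤ ∫ z, ∑ v, (w z.1 v * exp (a n * z.1 v)) * exp (b * z.2 v) ∂(μ.prod μ) :=
            integral_mono Ti (integrable_finsetSum _ fun v _ => i2 v) Tle
        _ = ∑ v, (∫ x, w x v * exp (a n * x v) ∂μ) * ∫ x, exp (b * x v) ∂μ := by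
            rw [integral_finsetSum _ fun v _ => i2 v]
            exact sum_congr rfl fun v _ => integral_prod_mul (fun x => w x v * exp (a n * x v)) (fun x : ι → ℝ => exp (b * x v))
        _ ≤ ∑ v, (∫ x, w x v * exp (a n * x v) ∂μ) * exp (2 * t^2 * W) := by
            refine sum_le_sum fun v _ => mul_le_mul_of_nonneg_left ((hexp v b).2.trans (exp_le_exp.2 hbb))
              (integral_nonneg fun x => mul_nonneg (w0 _ _) (exp_pos _).le)
        _ = (∫ x, ∑ v, w x v * exp (a n * x v) ∂μ) * exp (2 * t^2 * W) := by
            rw [← Finset.sum_mul, integral_finsetSum _ fun v _ => i1 v]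
        _ ≤ _ := by
            refine mul_le_mul_of_nonneg_right ?_ (exp_pos _).le
            have e1 : ∀ v, Integrable (fun x : ι → ℝ => exp (x v)) μ := fun v => by simpa using (hexp v 1).1
            have e2 : ∀ v, ∫ x : ι → ℝ, exp (x v) ∂μ ≤ exp (W/2) := fun v => by simpa using (hexp v 1).2
            calc ∫ x, ∑ v, w x v * exp (a n * x v) ∂μ ≤ ∫ x, (1 + a n * ∑ v, exp (x v)) ∂μ := by
                  refine integral_mono (integrable_finsetSum _ fun v _ => i1 v)
                    ((integrable_const _).add ((integrable_finsetSum _ fun v _ => e1 v).const_mul _)) fun x => ?_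
                  have hc : ∀ v, exp (a n * x v) ≤ 1 + a n * exp (x v) := fun v => by
                    have := convexOn_exp.2 (Set.mem_univ 0) (Set.mem_univ (x v)) (sub_nonneg.2 han) ha0 (by ring)
                    simp at this
                    linarith
                  calc ∑ v, w x v * exp (a n * x v) ≤ ∑ v, (w x v + a n * exp (x v)) := by
                        refine sum_le_sum fun v _ => ?_
                        have h1 := mul_le_mul_of_nonneg_left (hc v) (w0 x v)
                        have h2 : w x v * (a n * exp (x v)) ≤ a n * exp (x v) :=
                          mul_le_of_le_one_left (by positivity) (wle x v)
                        linarith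
                    _ = _ := by rw [sum_add_distrib, w1, ← mul_sum]
              _ = 1 + a n * ∑ v, ∫ x : ι → ℝ, exp (x v) ∂μ := by
                  rw [integral_add (integrable_const _) ((integrable_finsetSum _ fun v _ => e1 v).const_mul _),
                    integral_const_mul, integral_finsetSum _ fun v _ => e1 v]; simp
              _ ≤ _ := by
                  have : ∑ v, ∫ x : ι → ℝ, exp (x v) ∂μ ≤ K := by
                    rw [hK]; refine (sum_le_sum fun v _ => e2 v).trans ?_; simp
                  nlinarith
    -- telescoping
    set R : ℕ → (ι → ℝ) × (ι → ℝ) →L[ℝ] (ι → ℝ) × (ι → ℝ) := fun j => ContinuousLinearMap.rotation (j * τ n) with hR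
    have pw : ∀ z, exp (t * (F z.1 - F z.2)) ≤ ∑ j ∈ range n, (n:ℝ)⁻¹ * T (R j z) := by
      intro z
      have step : ∀ j, F (R j z).1 - F (R (j+1) z).1 ≤ G (R j z) := fun j => by
        refine (lse_sub hne (R j z).1 (R (j+1) z).1).trans (le_of_eq ?_)
        refine sum_congr rfl fun v _ => ?_
        simp only [hw, hR, ContinuousLinearMap.rotation_apply, Pi.add_apply, Pi.smul_apply, smul_eq_mul]
        push_cast
        rw [show ((j:ℝ)+1) * τ n = j * τ n + τ n by ring, Real.cos_add, Real.sin_add]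
        ring
      have e1 : F z.1 - F z.2 ≤ ∑ j ∈ range n, G (R j z) := by
        refine le_trans (le_of_eq ?_) (sum_le_sum fun j _ => step j)
        rw [Finset.sum_range_sub']
        have : (n:ℝ) * τ n = Real.pi/2 := by simp only [hτ]; field_simp
        simp [hR, ContinuousLinearMap.rotation_apply, this]
      have e2 := jen (range n) (fun _ => (n:ℝ)⁻¹) (fun j => n * t * G (R j z)) (fun _ _ => by positivity) (by simp; field_simp)
      refine le_trans (exp_le_exp.2 ?_) e2
      rw [← mul_sum, ← mul_sum]
      refine (mul_le_mul_of_nonneg_left e1 ht.le).trans (le_of_eq (by field_simp))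
    have iR : ∀ j, Integrable (fun z => T (R j z)) (μ.prod μ) ∧ ∫ z, T (R j z) ∂(μ.prod μ) = ∫ z, T z ∂(μ.prod μ) := fun j => by
      have hm : AEMeasurable (R j) (μ.prod μ) := (R j).continuous.measurable.aemeasurable
      have h1 := hrot (j * τ n)
      constructor
      · refine (integrable_map_measure (g := T) ?_ hm).1 ?_
        · exact Tm.aestronglyMeasurable
        · rw [h1]; exact Ti
      · rw [← integral_map hm Tm.aestronglyMeasurable, h1]
    have hSi : Integrable (fun z => ∑ j ∈ range n, (n:ℝ)⁻¹ * T (R j z)) (μ.prod μ) :=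
      integrable_finsetSum _ fun j _ => (iR j).1.const_mul _
    refine (integral_mono_of_nonneg (.of_forall fun z => (exp_pos _).le) hSi (.of_forall pw)).trans ?_
    rw [integral_finsetSum _ fun j _ => (iR j).1.const_mul _]
    simp only [integral_const_mul, (iR _).2, Finset.sum_const, Finset.card_range, nsmul_eq_mul]
    rw [mul_inv_cancel_left₀ hn'.ne']
    exact hTint
  -- limit
  have ale : ∀ n : ℕ, 1 ≤ n → a n ≤ 4 * t / n := fun n hn => by
    have hn' : (0:ℝ) < n := by exact_mod_cast hn
    have h1 := Real.one_sub_sq_div_two_le_cos (x := τ n)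
    have h2 : τ n ^ 2 ≤ 4 / n^2 := by
      simp only [hτ]; rw [div_pow]; gcongr; nlinarith [Real.pi_le_four, Real.pi_pos]
    calc a n ≤ n * t * (4 / n^2) := by
          simp only [ha]; gcongr; linarith [sq_nonneg (τ n)]
      _ = _ := by field_simp
  have lim : Tendsto (fun n : ℕ => (1 + 4 * t / n * K) * exp (2 * t^2 * W)) atTop (nhds ((1 + 0 * K) * exp (2 * t^2 * W))) := by
    refine Tendsto.mul_const _ (Tendsto.const_add _ (Tendsto.mul_const _ ?_))
    exact tendsto_const_div_atTop_nhds_zero_nat (4*t)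
  have := ge_of_tendsto lim (b := ∫ z, exp (t * (F z.1 - F z.2)) ∂(μ.prod μ)) (by
    filter_upwards [eventually_ge_atTop (max 1 ⌈4*t⌉₊)] with n hn
    have hn1 : 1 ≤ n := (le_max_left _ _).trans hn
    have hn' : (0:ℝ) < n := by exact_mod_cast hn1
    have hn2 : 4 * t ≤ n := (Nat.le_ceil _).trans (by exact_mod_cast (le_max_right _ _).trans hn)
    refine (key n hn1 ((ale n hn1).trans ((div_le_one hn').2 hn2))).trans ?_
    have := ale n hn1
    have hK0 : 0 ≤ K := by positivity
    gcongr)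
  simpa using this
theorem exp_lse {ι : Type*} {A : Finset ι} (hA : A.Nonempty) (x : ι → ℝ) : exp (lse A x) = ∑ v ∈ A, exp (x v) :=
  exp_log (se_pos hA x)
theorem le_lse {ι : Type*} {A : Finset ι} {v : ι} (hv : v ∈ A) (x : ι → ℝ) : x v ≤ lse A x := by
  rw [← exp_le_exp, exp_lse ⟨v, hv⟩]
  exact single_le_sum (f := fun u => exp (x u)) (fun _ _ => (exp_pos _).le) hv
theorem lse_le {ι : Type*} {A : Finset ι} (hA : A.Nonempty) {t : ℝ} (ht : 0 < t) (x : ι → ℝ) :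
    exp (t * lse A x) ≤ (A.card : ℝ) ^ t * ∑ v ∈ A, exp (t * x v) := by
  obtain ⟨m, hm, hmax⟩ := Finset.exists_max_image A x hA
  have h1 : ∑ v ∈ A, exp (x v) ≤ A.card * exp (x m) := by
    rw [← nsmul_eq_mul]; exact Finset.sum_le_card_nsmul _ _ _ fun v hv => exp_le_exp.2 (hmax v hv)
  calc exp (t * lse A x) = (∑ v ∈ A, exp (x v)) ^ t := by rw [← exp_lse hA, ← Real.exp_mul, mul_comm]
    _ ≤ (A.card * exp (x m)) ^ t := Real.rpow_le_rpow (se_pos hA x).le h1 ht.le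
    _ = (A.card : ℝ) ^ t * exp (t * x m) := by
        rw [Real.mul_rpow (by positivity) (exp_pos _).le, ← Real.exp_mul, mul_comm t]
    _ ≤ _ := by
        gcongr
        exact single_le_sum (f := fun u => exp (t * x u)) (fun _ _ => (exp_pos _).le) hm
theorem lse_X {N : ℕ} {P : Measure FieldSp} (h : IsGFF N P) {A : Finset Vtx} (hA : A.Nonempty) (g : Vtx → Vtx → ℝ)
    (hg : ∀ v, g v ∈ Sp (Vi N)) : Integrable (fun ω => lse A fun v => X N (g v) ω) P ∧
    (∀ t : ℝ, Integrable (fun ω => exp (t * lse A fun v => X N (g v) ω)) P) := by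
  have := h.1
  have Fm : Measurable fun ω => lse A fun v => X N (g v) ω :=
    Real.measurable_log.comp (Finset.measurable_fun_sum _ fun v _ => measurable_exp.comp (X_meas N (g v)))
  have hint : ∀ t : ℝ, Integrable (fun ω => exp (t * lse A fun v => X N (g v) ω)) P := fun t => by
    have tm : AEStronglyMeasurable (fun ω => exp (t * lse A fun v => X N (g v) ω)) P :=
      (measurable_exp.comp (Fm.const_mul t)).aestronglyMeasurable
    rcases le_or_gt t 0 with ht | ht
    · obtain ⟨v, hv⟩ := hA
      refine (X_int h (hg v) t).1.mono' tm (.of_forall fun ω => ?_)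
      rw [Real.norm_of_nonneg (exp_pos _).le]
      exact exp_le_exp.2 (mul_le_mul_of_nonpos_left (le_lse hv fun v => X N (g v) ω) ht)
    · refine ((integrable_finsetSum A fun v _ => (X_int h (hg v) t).1).const_mul ((A.card:ℝ)^t)).mono' tm (.of_forall fun ω => ?_)
      rw [Real.norm_of_nonneg (exp_pos _).le]
      exact lse_le hA ht _
  refine ⟨((hint 1).add (hint (-1))).mono' Fm.aestronglyMeasurable (.of_forall fun ω => ?_), hint⟩
  set y := lse A fun v => X N (g v) ω
  have h1 := add_one_le_exp (1 * y); have h2 := add_one_le_exp (-1 * y)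
  have h3 := exp_pos (1 * y); have h4 := exp_pos (-1 * y)
  exact abs_le.2 ⟨by simp only [Pi.add_apply]; linarith, by simp only [Pi.add_apply]; linarith⟩
theorem jensen_exp {Ω : Type*} [MeasurableSpace Ω] {P : Measure Ω} [IsProbabilityMeasure P] {f : Ω → ℝ} (hf : Integrable f P)
    (he : Integrable (fun ω => exp (f ω)) P) : exp (∫ ω, f ω ∂P) ≤ ∫ ω, exp (f ω) ∂P := by
  set m := ∫ ω, f ω ∂P with hm
  have : ∫ ω, exp m * (f ω - m + 1) ∂P ≤ ∫ ω, exp (f ω) ∂P := by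
    refine integral_mono (((hf.sub (integrable_const m)).add (integrable_const 1)).const_mul _) he fun ω => ?_
    have := add_one_le_exp (f ω - m)
    calc exp m * (f ω - m + 1) ≤ exp m * exp (f ω - m) := by gcongr
      _ = _ := by rw [← exp_add, add_sub_cancel]
  have e : ∫ ω, (f ω - m + 1) ∂P = 1 := by
    have h1 : Integrable (fun ω => f ω - m) P := hf.sub (integrable_const m)
    rw [integral_add h1 (integrable_const 1), integral_sub hf (integrable_const m)]
    simp [← hm]
  rwa [integral_const_mul, e, mul_one] at this
theorem mp_X {N : ℕ} {P : Measure FieldSp} (h : IsGFF N P) {A : Finset Vtx} (hA : A.Nonempty) (g : Vtx → Vtx → ℝ)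
    (hg : ∀ v, g v ∈ Sp (Vi N)) {W : ℝ} (hW : ∀ v ∈ A, EV N (g v) (g v) ≤ W) {t : ℝ} (ht : 0 < t) :
    ∫ ω, exp (t * lse A fun v => X N (g v) ω) ∂P ≤
      exp (t * ∫ ω, (lse A fun v => X N (g v) ω) ∂P + 2 * t^2 * W) := by
  have := h.1
  have : Nonempty A := hA.to_subtype
  set Y : FieldSp → A → ℝ := fun ω v => X N (g v) ω with hY
  have Ym : Measurable Y := measurable_pi_lambda _ fun v => X_meas N _
  set μ := P.map Y with hμ
  have : IsProbabilityMeasure μ := Measure.isProbabilityMeasure_map Ym.aemeasurable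
  have : HasGaussianLaw Y P := (X_proc h g hg).hasGaussianLaw A
  have : IsGaussian μ := this.isGaussian_map
  obtain ⟨iF, iE⟩ := lse_X h hA g hg
  have eF : ∀ ω, lse Finset.univ (Y ω) = lse A fun v => X N (g v) ω := fun ω => by
    simp only [lse, hY]; rw [Finset.sum_coe_sort A (fun v => exp (X N (g v) ω))]
  have lm : Measurable fun x : A → ℝ => lse Finset.univ x := by unfold lse; fun_prop
  have key := mp_abs μ (fun θ => ?_) W (fun v s => ?_) ht
  · have e : ∀ z : (A → ℝ) × (A → ℝ), exp (t * (lse Finset.univ z.1 - lse Finset.univ z.2)) =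
        exp (t * lse Finset.univ z.1) * exp (-t * lse Finset.univ z.2) := fun z => by
      rw [← exp_add]; ring_nf
    simp only [e] at key
    rw [integral_prod_mul (fun x : A → ℝ => exp (t * lse Finset.univ x)) (fun x : A → ℝ => exp (-t * lse Finset.univ x)),
      hμ, integral_map Ym.aemeasurable (by fun_prop), integral_map Ym.aemeasurable (by fun_prop)] at key
    simp only [eF] at key
    have j := jensen_exp (iF.const_mul (-t)) (iE (-t))
    rw [integral_const_mul] at j
    set E := ∫ ω, (lse A fun v => X N (g v) ω) ∂P
    have h0 : 0 ≤ ∫ ω, exp (t * lse A fun v => X N (g v) ω) ∂P := integral_nonneg fun _ => (exp_pos _).le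
    have := (mul_le_mul_of_nonneg_left j h0).trans key
    rw [← le_div_iff₀ (exp_pos _), ← exp_sub] at this
    refine this.trans (le_of_eq ?_)
    congr 1; ring
  · refine IsGaussian.map_rotation_eq_self ?_ θ
    rw [hμ, integral_map Ym.aemeasurable (by fun_prop)]
    funext v
    refine (eval_integral (f := Y) (fun v => (X_mem h (hg v)).integrable (by norm_num)) v).trans ?_
    exact X_mean h (hg v)
  · rw [hμ]
    have m1 : AEStronglyMeasurable (fun x : A → ℝ => exp (s * x v)) (P.map Y) :=
      (by fun_prop : Measurable fun x : A → ℝ => exp (s * x v)).aestronglyMeasurable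
    refine ⟨(integrable_map_measure m1 Ym.aemeasurable).2 (X_int h (hg v) s).1, ?_⟩
    rw [integral_map Ym.aemeasurable m1]
    refine (X_int h (hg v) s).2.le.trans (exp_le_exp.2 ?_)
    have := hW v v.2
    gcongr
def Ptn (K : ℕ) (t : ℕ → ℝ) : Prop := 1 ≤ K ∧ t 0 = 0 ∧ t K = 1 ∧ ∀ k < K, t k < t (k+1)
theorem Ptn.mono {K : ℕ} {t : ℕ → ℝ} (h : Ptn K t) {i j : ℕ} (hij : i ≤ j) (hj : j ≤ K) : t i ≤ t j := lam_mono h.2.2.2 hij hj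
theorem Ptn.nn {K : ℕ} {t : ℕ → ℝ} (h : Ptn K t) {j : ℕ} (hj : j ≤ K) : 0 ≤ t j := h.2.1 ▸ h.mono (Nat.zero_le j) hj
theorem Ptn.le1 {K : ℕ} {t : ℕ → ℝ} (h : Ptn K t) {j : ℕ} (hj : j ≤ K) : t j ≤ 1 := h.2.2.1 ▸ h.mono hj le_rfl
def Rf (K : ℕ) (t : ℕ → ℝ) (N : ℕ) : Prop := 1 ≤ N ∧ (∀ k < K, 64 * (rad N (t (k+1)) + 1) ≤ rad N (t k)) ∧
  ∀ k ≤ K, |log (rad N (t k)) - (1 - t k) * log N| ≤ 2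
theorem rad_bd {t : ℝ} (h0 : 0 ≤ t) (h1 : t < 1) : ∀ᶠ N : ℕ in atTop, (N:ℝ)^(1-t)/4 ≤ rad N t ∧ (rad N t : ℝ) ≤ (N:ℝ)^(1-t) := by
  have hl : Tendsto (fun N : ℕ => (N:ℝ)^(1-t)) atTop atTop := (tendsto_rpow_atTop (by linarith)).comp tendsto_natCast_atTop_atTop
  filter_upwards [hl.eventually_ge_atTop 4] with N hN
  unfold rad
  split_ifs with a b
  · subst a; simp at hN ⊢; linarith
  · exact absurd b h1.ne
  · have := Nat.sub_one_lt_floor ((N:ℝ)^(1-t)/2)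
    exact ⟨by linarith, (Nat.floor_le (by positivity)).trans (by linarith)⟩
theorem Rf_ev {K : ℕ} {t : ℕ → ℝ} (h : Ptn K t) : ∀ᶠ N in atTop, Rf K t N := by
  have lt1 : ∀ k < K, t k < 1 := fun k hk => (h.2.2.2 k hk).trans_le (h.le1 hk)
  have e1 : ∀ᶠ N : ℕ in atTop, ∀ k ∈ range K, (N:ℝ)^(1-t k)/4 ≤ rad N (t k) ∧ (rad N (t k) : ℝ) ≤ (N:ℝ)^(1-t k) :=
    (Finset.eventually_all _).2 fun k hk => rad_bd (h.nn (mem_range.1 hk).le) (lt1 k (mem_range.1 hk))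
  have e2 : ∀ᶠ N : ℕ in atTop, ∀ k ∈ range K, (512:ℝ) ≤ (N:ℝ)^(t (k+1) - t k) :=
    (Finset.eventually_all _).2 fun k hk => ((tendsto_rpow_atTop (by linarith [h.2.2.2 k (mem_range.1 hk)])).comp
      tendsto_natCast_atTop_atTop).eventually_ge_atTop 512
  filter_upwards [e1, e2, eventually_ge_atTop 1] with N e1 e2 hN
  have hN' : (1:ℝ) ≤ N := by exact_mod_cast hN
  have ub : ∀ k ≤ K, (rad N (t k) : ℝ) ≤ (N:ℝ)^(1-t k) := fun k hk => by
    rcases hk.lt_or_eq with hk | rfl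
    · exact (e1 k (mem_range.2 hk)).2
    · rw [h.2.2.1]; simp [rad]
  refine ⟨hN, fun k hk => ?_, fun k hk => ?_⟩
  · have a := e2 k (mem_range.2 hk)
    have b := (e1 k (mem_range.2 hk)).1
    have c := ub (k+1) hk
    have d : (1:ℝ) ≤ (N:ℝ)^(1-t (k+1)) := Real.one_le_rpow hN' (by linarith [h.le1 hk])
    have e : (N:ℝ)^(1-t k) = (N:ℝ)^(t (k+1) - t k) * (N:ℝ)^(1-t (k+1)) := by
      rw [← Real.rpow_add (by linarith)]; ring_nf
    have : (64 * (rad N (t (k+1)) + 1) : ℝ) ≤ rad N (t k) := by nlinarith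
    exact_mod_cast this
  · have hp : (0:ℝ) < (N:ℝ)^(1-t k) := by positivity
    have l4 : log 4 ≤ 2 := by
      rw [show (4:ℝ) = 2^2 by norm_num, Real.log_pow]; have := Real.log_two_lt_d9; push_cast; linarith
    have el : log ((N:ℝ)^(1-t k)) = (1 - t k) * log N := Real.log_rpow (by linarith) _
    rcases hk.lt_or_eq with hk | rfl
    · obtain ⟨b, c⟩ := e1 k (mem_range.2 hk)
      have x1 := log_le_log (by positivity) b
      have x2 := log_le_log (lt_of_lt_of_le (by positivity) b) c
      rw [Real.log_div hp.ne' (by norm_num)] at x1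
      rw [abs_le]; constructor <;> linarith
    · rw [h.2.2.1]; simp [rad]
def ic (N : ℕ) (t : ℕ → ℝ) (k : ℕ) (v : Vtx) : Vtx → ℝ := xi N v (t (k+1)) - xi N v (t k)
def hd (N : ℕ) (t : ℕ → ℝ) (c : ℕ → ℝ) (S : Finset ℕ) (v : Vtx) : Vtx → ℝ := ∑ k ∈ S, c k • ic N t k v
theorem ic_eq (N : ℕ) (t : ℕ → ℝ) (k : ℕ) (v : Vtx) : ic N t k v = gr (Dn N (t k) v) v - gr (Dn N (t (k+1)) v) v := by
  unfold ic xi; abel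
section
variable {K : ℕ} {t : ℕ → ℝ} {N : ℕ}
theorem D_anti (h : Ptn K t) (hN : 1 ≤ N) {i j : ℕ} (hij : i ≤ j) (hj : j ≤ K) (v : Vtx) : Dn N (t j) v ⊆ Dn N (t i) v :=
  Dn_anti hN (h.nn (hij.trans hj)) (h.mono hij hj) (h.le1 hj) v
theorem ic_Sp (h : Ptn K t) (hN : 1 ≤ N) {j k : ℕ} (hj : j ≤ k) (hk : k < K) (v : Vtx) : ic N t k v ∈ Sp (Dn N (t j) v) := by
  rw [ic_eq]
  exact (Sp _).sub_mem (Sp_mono (D_anti h hN hj hk.le v) (gr_Sp _ _)) (Sp_mono (D_anti h hN (hj.trans k.le_succ) hk v) (gr_Sp _ _))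
theorem ic_Ha (h : Ptn K t) (hN : 1 ≤ N) {j k : ℕ} (hj : k < j) (hk : j ≤ K) (v : Vtx) : ic N t k v ∈ Ha (Dn N (t j) v) := by
  rw [ic_eq]
  exact Ha_anti (D_anti h hN hj hk v) (gr_sub_Ha (D_anti h hN k.le_succ (hj.trans_le hk) v) v)
theorem ic_V (h : Ptn K t) (hN : 1 ≤ N) {k : ℕ} (hk : k < K) (v : Vtx) : ic N t k v ∈ Sp (Vi N) :=
  Sp_mono Dn_Vi (ic_Sp h hN le_rfl hk v)
theorem hd_V (h : Ptn K t) (hN : 1 ≤ N) (c : ℕ → ℝ) {S : Finset ℕ} (hS : S ⊆ range K) (v : Vtx) : hd N t c S v ∈ Sp (Vi N) :=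
  (Sp _).sum_mem fun k hk => (Sp _).smul_mem _ (ic_V h hN (mem_range.1 (hS hk)) v)
theorem ic_orth (h : Ptn K t) (hN : 1 ≤ N) {j k : ℕ} (hj : j < K) (hk : k < K) (hjk : j ≠ k) (v : Vtx) :
    EV N (ic N t j v) (ic N t k v) = 0 := by
  have : ∀ {j k : ℕ}, j < K → k < K → j < k → EV N (ic N t j v) (ic N t k v) = 0 := fun {j k} _ hk h1 =>
    En_orth (ic_Ha h hN h1 hk.le v) (ic_Sp h hN le_rfl hk v)
  rcases lt_or_gt_of_ne hjk with h1 | h1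
  · exact this hj hk h1
  · rw [EV, En_symm (ic_V h hN hj v) (ic_V h hN hk v)]; exact this hk hj h1
theorem hd_En (h : Ptn K t) (hN : 1 ≤ N) (c : ℕ → ℝ) {S : Finset ℕ} (hS : S ⊆ range K) (v : Vtx) :
    EV N (hd N t c S v) (hd N t c S v) = ∑ k ∈ S, c k ^ 2 * EV N (ic N t k v) (ic N t k v) := by
  simp only [EV, hd, map_sum, map_smul, LinearMap.coe_sum, Finset.sum_apply, LinearMap.smul_apply, smul_eq_mul]
  refine sum_congr rfl fun j hj => ?_
  rw [Finset.sum_eq_single j]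
  · ring
  · intro k hk hkj
    have := ic_orth h hN (mem_range.1 (hS hk)) (mem_range.1 (hS hj)) hkj v
    simp only [EV] at this; rw [this]; ring
  · exact fun h => absurd hj h
theorem ic_En (h : Ptn K t) (hN : 1 ≤ N) {k : ℕ} (hk : k < K) (v : Vtx) :
    EV N (ic N t k v) (ic N t k v) = gr (Dn N (t k) v) v v - gr (Dn N (t (k+1)) v) v v := by
  rw [ic_eq]; exact En_gr_sub (D_anti h hN k.le_succ hk v) Dn_Vi v v
end
theorem ic_bd : ∃ C : ℝ, 0 < C ∧ ∀ (K : ℕ) (t : ℕ → ℝ) (N : ℕ), Ptn K t → Rf K t N → ∀ k < K, ∀ v,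
    EV N (ic N t k v) (ic N t k v) ≤ (t (k+1) - t k) * log N + C ∧
    (N ≤ 4 * dd N v → (t (k+1) - t k) * log N - C ≤ EV N (ic N t k v) (ic N t k v)) := by
  obtain ⟨C, hC, hi⟩ := incr_bd
  obtain ⟨C', hC', e3, e2, -⟩ := greenE
  refine ⟨C + 2 * C' + 6, by linarith, fun K t N h hR k hk v => ?_⟩
  obtain ⟨hN, hr, hl⟩ := hR
  have a := abs_le.1 (hl k hk.le)
  have b := abs_le.1 (hl (k+1) hk)
  have r1 := hr k hk
  rw [ic_En h hN hk]
  constructor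
  · have := hi N (Dn N (t k) v) v (rad N (t (k+1))) (rad N (t k)) (by omega) (by omega) Dn_Vi Finset.inter_subset_left
      (D_anti h hN k.le_succ hk v)
    change _ - gr (Dn N (t (k+1)) v) v v ≤ _ at this
    linarith
  · intro hd
    have l4 : log 4 ≤ 2 := by
      rw [show (4:ℝ) = 2^2 by norm_num, Real.log_pow]; have := Real.log_two_lt_d9; push_cast; linarith
    have x1 := e2 (Dn N (t k) v) (min (rad N (t k)) (dd N v)) v v (by omega)
      (Finset.subset_inter (Q_mono (min_le_left _ _)) ((Q_mono (min_le_right _ _)).trans Q_dd)) (by simp [near])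
    have x2 : gr (Dn N (t (k+1)) v) v v ≤ log (rad N (t (k+1))) + C' := by
      rcases Nat.eq_zero_or_pos (rad N (t (k+1))) with h0 | h0
      · rw [gr_off]
        · rw [h0]; simp; exact hC'.le
        · simp [Dn, mem_Q, h0]
      · have := e3 (Dn N (t (k+1)) v) _ v v h0 Finset.inter_subset_left (by simp [near])
        simpa [ff_zero] using this
    have hrN : rad N (t k) ≤ N := by
      have := rad_anti hN le_rfl (h.nn hk.le) (h.le1 hk.le)
      simpa [rad] using this
    have x3 : log (rad N (t k)) ≤ log (min (rad N (t k)) (dd N v) : ℕ) + 2 := by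
      have : (rad N (t k) : ℝ) ≤ 4 * (min (rad N (t k)) (dd N v) : ℕ) := by
        have : rad N (t k) ≤ 4 * min (rad N (t k)) (dd N v) := by omega
        exact_mod_cast this
      have h5 : (0:ℝ) < (min (rad N (t k)) (dd N v) : ℕ) := by exact_mod_cast (show 0 < min (rad N (t k)) (dd N v) by omega)
      have := log_le_log (by exact_mod_cast (show 0 < rad N (t k) by omega)) this
      rw [log_mul (by norm_num) h5.ne'] at this
      linarith
    simp only [sub_self, ff_zero] at x1
    linarith
theorem En_ka {V : Finset Vtx} {g g' : Vtx → ℝ} (hg : g ∈ Sp V) (hg' : g' ∈ Sp V) {s : ℝ} (hs : 0 < s) :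
    En V (g + g') (g + g') ≤ (1 + s) * En V g g + (1 + s⁻¹) * En V g' g' := by
  have h1 := En_cs hg hg' hs
  have h2 := En_symm hg hg'
  simp only [map_add, LinearMap.add_apply]
  linarith
def Vs (t c : ℕ → ℝ) (S : Finset ℕ) : ℝ := ∑ k ∈ S, c k ^ 2 * (t (k+1) - t k)
theorem Vs_mono {K : ℕ} {t : ℕ → ℝ} (h : Ptn K t) (c : ℕ → ℝ) {S T : Finset ℕ} (hST : S ⊆ T) (hT : T ⊆ range K) :
    Vs t c S ≤ Vs t c T :=
  Finset.sum_le_sum_of_subset_of_nonneg hST fun k hk _ => mul_nonneg (sq_nonneg _)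
    (by linarith [h.2.2.2 k (mem_range.1 (hT hk))])
theorem hd_bd : ∃ C : ℝ, 0 < C ∧ ∀ (K : ℕ) (t c : ℕ → ℝ) (N : ℕ) (B : ℝ), Ptn K t → Rf K t N → (∀ k < K, c k ^ 2 ≤ B) →
    ∀ S ⊆ range K, ∀ v,
    EV N (hd N t c S v) (hd N t c S v) ≤ Vs t c S * log N + C * B * S.card ∧
    (N ≤ 4 * dd N v → Vs t c S * log N - C * B * S.card ≤ EV N (hd N t c S v) (hd N t c S v)) := by
  obtain ⟨C, hC, hb⟩ := ic_bd
  refine ⟨C, hC, fun K t c N B h hR hB S hS v => ?_⟩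
  have e : Vs t c S * log N = ∑ k ∈ S, c k ^ 2 * ((t (k+1) - t k) * log N) := by
    rw [Vs, Finset.sum_mul]; exact sum_congr rfl fun _ _ => by ring
  have e2 : C * B * S.card = ∑ k ∈ S, B * C := by rw [Finset.sum_const, nsmul_eq_mul]; ring
  rw [hd_En h hR.1 c hS, e, e2, ← sum_add_distrib, ← sum_sub_distrib]
  constructor
  · refine sum_le_sum fun k hk => ?_
    have hk' := mem_range.1 (hS hk)
    have := mul_le_mul_of_nonneg_left (hb K t N h hR k hk' v).1 (sq_nonneg (c k))
    have := mul_le_mul_of_nonneg_right (hB k hk') hC.le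
    linarith
  · intro hd
    refine sum_le_sum fun k hk => ?_
    have hk' := mem_range.1 (hS hk)
    have := mul_le_mul_of_nonneg_left ((hb K t N h hR k hk' v).2 hd) (sq_nonneg (c k))
    have := mul_le_mul_of_nonneg_right (hB k hk') hC.le
    linarith
def nr (r : ℕ) (v w : Vtx) : Prop := 4 * |v.1 - w.1| ≤ r ∧ 4 * |v.2 - w.2| ≤ r
theorem hd_Sp {K : ℕ} {t : ℕ → ℝ} {N : ℕ} (h : Ptn K t) (hN : 1 ≤ N) (c : ℕ → ℝ) (q : ℕ) (v : Vtx) :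
    hd N t c (Ico q K) v ∈ Sp (Dn N (t q) v) :=
  (Sp _).sum_mem fun k hk => (Sp _).smul_mem _ (ic_Sp h hN (mem_Ico.1 hk).1 (mem_Ico.1 hk).2 v)
theorem hd_Ha {K : ℕ} {t : ℕ → ℝ} {N : ℕ} (h : Ptn K t) (hN : 1 ≤ N) (c : ℕ → ℝ) {q : ℕ} (hq : q ≤ K) (v : Vtx) :
    hd N t c (range q) v ∈ Ha (Dn N (t q) v) :=
  (Ha _).sum_mem fun k hk => (Ha _).smul_mem _ (ic_Ha h hN (mem_range.1 hk) hq v)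
theorem rK {K : ℕ} {t : ℕ → ℝ} (N : ℕ) (h : Ptn K t) : rad N (t K) = 0 := by rw [h.2.2.1]; simp [rad]
theorem D_in {K : ℕ} {t : ℕ → ℝ} {N : ℕ} (h : Ptn K t) (hR : Rf K t N) {n q : ℕ} (hnq : n ≤ q) (hq : q ≤ K) (hn : n < q ∨ n = K)
    {v w : Vtx} (hvw : nr (rad N (t n)) v w) : Dn N (t q) v ⊆ Dn N (t n) w := by
  intro x hx
  simp only [Dn, Finset.mem_inter, mem_Q] at hx ⊢
  refine ⟨?_, hx.2⟩
  have hx := hx.1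
  have a : rad N (t q) = 0 ∨ 64 * (rad N (t q) + 1) ≤ rad N (t n) := by
    rcases hn with hn | rfl
    · right
      exact (by have := rad_anti hR.1 (h.nn (j := n+1) (Nat.succ_le_of_lt hn |>.trans hq)) (h.mono (i := n+1) hn hq) (h.le1 hq); omega : 64 * (rad N (t q) + 1) ≤ 64 * (rad N (t (n+1)) + 1)).trans
        (hR.2.1 n (hn.trans_le hq))
    · left; rw [show q = n by omega]; exact rK N h
  obtain ⟨h1, h2⟩ := hvw
  have := abs_le.1 (show |v.1 - w.1| ≤ (rad N (t n) : ℤ) / 4 by omega)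
  have := abs_le.1 (show |v.2 - w.2| ≤ (rad N (t n) : ℤ) / 4 by omega)
  omega
theorem D_sep {K : ℕ} {t : ℕ → ℝ} {N : ℕ} (h : Ptn K t) (hR : Rf K t N) {n q : ℕ} (hq : q = K ∨ n + 2 = q ∧ q ≤ K)
    {v w : Vtx} (hvw : n < K → ¬ nr (rad N (t (n+1))) v w) : Sp (Dn N (t q) w) ≤ Ha (Dn N (t q) v) := by
  refine Sp_Ha fun x hx => ?_
  simp only [Dn, Finset.mem_inter, mem_Q] at hx ⊢
  have hx := hx.1
  rcases hq with rfl | ⟨rfl, hq⟩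
  · rw [rK N h] at hx; omega
  · have a := hR.2.1 (n+1) (by omega)
    have b := hvw (by omega)
    have key : ∀ y : Vtx, |y.1 - x.1| ≤ 1 → |y.2 - x.2| ≤ 1 → ¬ ((w.1 - rad N (t (n+2)) < y.1 ∧ y.1 < w.1 + rad N (t (n+2))) ∧
        w.2 - rad N (t (n+2)) < y.2 ∧ y.2 < w.2 + rad N (t (n+2))) := by
      intro y y1 y2 hy
      apply b
      rw [show n + 1 + 1 = n + 2 from rfl] at a
      rw [abs_le] at y1 y2
      have := abs_le.2 (show -(2 * (rad N (t (n+2)) : ℤ) + 1) ≤ v.1 - w.1 ∧ v.1 - w.1 ≤ 2 * (rad N (t (n+2)) : ℤ) + 1 by omega)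
      have := abs_le.2 (show -(2 * (rad N (t (n+2)) : ℤ) + 1) ≤ v.2 - w.2 ∧ v.2 - w.2 ≤ 2 * (rad N (t (n+2)) : ℤ) + 1 by omega)
      exact ⟨by omega, by omega⟩
    refine ⟨fun hc => key x (by simp) (by simp) hc.1, fun y hy hc => key y ?_ ?_ hc.1⟩ <;> rcases hy with hy | hy | hy | hy <;> simp [hy]
theorem hd_split {N : ℕ} {t c : ℕ → ℝ} {a b d : ℕ} (h1 : a ≤ b) (h2 : b ≤ d) (v : Vtx) :
    hd N t c (Ico a d) v = hd N t c (Ico a b) v + hd N t c (Ico b d) v :=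
  (Finset.sum_Ico_consecutive _ h1 h2).symm
theorem v2a (p a b ab d e A L V V' c : ℝ) (hc : 0 ≤ c) (hp0 : 0 ≤ p) (hp1 : p ≤ 1) (h1 : a ≤ A * L + c) (h2 : b ≤ A * L + c)
    (h3 : 2 * ab ≤ a + b) (h4 : d ≤ V' * L + c) (h5 : e ≤ V' * L + c) (h6 : V' * L ≤ V * L) :
    p^2 * a + p * (2 * ab) + b + d + e ≤ ((1+p)^2 * A + 2 * V) * L + 6 * c := by
  have g3 : p^2 * a ≤ p^2 * (A * L + c) := by gcongr
  have g4 : p * (2 * ab) ≤ p * (2 * (A * L + c)) := mul_le_mul_of_nonneg_left (by linarith) hp0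
  have g6 : p^2 * c ≤ c := mul_le_of_le_one_left hc (pow_le_one₀ hp0 hp1)
  have g7 : p * c ≤ c := by nlinarith
  linarith
theorem v2b (κ x y f B δ L c : ℝ) (hc : 0 ≤ c) (hκ : 0 < κ) (hκ1 : κ ≤ 1) (h1 : x ≤ f * L + 6 * c) (h2 : y ≤ 8 * B * δ * L + 4 * c) :
    (1 + κ) * x + (1 + κ⁻¹) * y ≤ (1 + κ) * f * L + (1+κ⁻¹) * 8 * B * δ * L + 100 * c * κ⁻¹ := by
  have ki : 1 ≤ κ⁻¹ := (one_le_inv₀ hκ).2 hκ1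
  have g1 := mul_le_mul_of_nonneg_left h1 (by linarith : 0 ≤ 1 + κ)
  have g2 := mul_le_mul_of_nonneg_left h2 (by linarith : 0 ≤ 1 + κ⁻¹)
  have g3 : κ * c ≤ c := by nlinarith
  have g4 : c ≤ c * κ⁻¹ := by nlinarith
  linarith
theorem var2 : ∃ C : ℝ, 0 < C ∧ ∀ (K : ℕ) (t c : ℕ → ℝ) (N n : ℕ) (B p κ δ : ℝ) (v w : Vtx), Ptn K t → Rf K t N → 0 ≤ B → (∀ k < K, c k ^ 2 ≤ B) →
    0 ≤ p → p ≤ 1 → 0 < κ → κ ≤ 1 → (∀ k < K, t (k+1) - t k ≤ δ) → n ≤ K → (n = 0 ∨ nr (rad N (t n)) v w) →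
    (n < K → ¬ nr (rad N (t (n+1))) v w) →
    EV N (p • hd N t c (range n) v + hd N t c (Ico n K) v + hd N t c (range K) w)
      (p • hd N t c (range n) v + hd N t c (Ico n K) v + hd N t c (range K) w) ≤
      (1 + κ) * ((1+p)^2 * Vs t c (range n) + 2 * Vs t c (Ico n K)) * log N + (1+κ⁻¹) * 8 * B * δ * log N + C * B * (K+1) * κ⁻¹ := by
  obtain ⟨C, hC, hb⟩ := hd_bd
  refine ⟨100 * C, by positivity, fun K t c N n B p κ δ v w h hR hB0 hB hp0 hp1 hκ hκ1 hδ hn hn1 hn2 => ?_⟩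
  obtain ⟨q, hq1, hq2, hq3⟩ : ∃ q, n ≤ q ∧ q ≤ K ∧ (q = n + 2 ∨ (q = K ∧ K ≤ n + 2)) := by
    rcases le_total (n+2) K with h | h
    · exact ⟨n+2, by omega, h, .inl rfl⟩
    · exact ⟨K, hn, le_rfl, .inr ⟨rfl, h⟩⟩
  have hN := hR.1
  set hv := hd N t c (range n) v
  set hw := hd N t c (range n) w
  set mv := hd N t c (Ico n q) v
  set mw := hd N t c (Ico n q) w
  set tv := hd N t c (Ico q K) v
  set tw := hd N t c (Ico q K) w
  have sn : range n ⊆ range K := Finset.range_mono hn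
  have sm : Ico n q ⊆ range K := fun x hx => by simp at hx ⊢; omega
  have st : Ico q K ⊆ range K := fun x hx => by simp at hx ⊢; omega
  have ihv : hv ∈ Sp (Vi N) := hd_V h hN c sn v
  have ihw : hw ∈ Sp (Vi N) := hd_V h hN c sn w
  have imv : mv ∈ Sp (Vi N) := hd_V h hN c sm v
  have imw : mw ∈ Sp (Vi N) := hd_V h hN c sm w
  have itv : tv ∈ Sp (Vi N) := hd_V h hN c st v
  have itw : tw ∈ Sp (Vi N) := hd_V h hN c st w
  have e1 : hd N t c (Ico n K) v = mv + tv := hd_split hq1 hq2 v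
  have e2 : hd N t c (range K) w = hw + (mw + tw) := by
    rw [Finset.range_eq_Ico, hd_split (Nat.zero_le n) hn, hd_split hq1 hq2, ← Finset.range_eq_Ico]
  have e3 : p • hv + hd N t c (Ico n K) v + hd N t c (range K) w = (p • hv + hw + tv + tw) + (mv + mw) := by
    rw [e1, e2]; abel
  have nrs : nr (rad N (t n)) v w → nr (rad N (t n)) w v := fun ⟨a, b⟩ => ⟨by rwa [abs_sub_comm], by rwa [abs_sub_comm]⟩
  have hor : n < q ∨ n = K := by omega
  have o1 : ∀ {x y : Vtx}, (n = 0 ∨ nr (rad N (t n)) x y) → EV N (hd N t c (range n) y) (hd N t c (Ico q K) x) = 0 := fun {x y} hxy => by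
    rcases hxy with h0 | hxy
    · have : hd N t c (range n) y = 0 := by rw [h0]; simp [hd]
      rw [this]; simp [EV]
    · exact En_orth (Ha_anti (D_in h hR hq1 hq2 hor hxy) (hd_Ha h hN c hn y)) (hd_Sp h hN c q x)
  have self : ∀ x, nr (rad N (t n)) x x := fun x => by simp [nr]
  have o2 : EV N tw tv = 0 := En_orth (D_sep h hR (by omega) hn2 (hd_Sp h hN c q w)) (hd_Sp h hN c q v)
  have o3 : EV N hv tv = 0 := o1 (.inr (self v))
  have o4 : EV N hw tv = 0 := o1 hn1
  have o5 : EV N hv tw = 0 := o1 (hn1.imp id nrs)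
  have o6 : EV N hw tw = 0 := o1 (.inr (self w))
  have L0 : 0 ≤ log N := Real.log_natCast_nonneg N
  have b1 := (hb K t c N B h hR hB _ sn v).1
  have b2 := (hb K t c N B h hR hB _ sn w).1
  have b3 := (hb K t c N B h hR hB _ sm v).1
  have b4 := (hb K t c N B h hR hB _ sm w).1
  have b5 := (hb K t c N B h hR hB _ st v).1
  have b6 := (hb K t c N B h hR hB _ st w).1
  have cr : C * B * (range n).card ≤ C * B * (K + 1) := by
    have : ((range n).card : ℝ) ≤ K := by rw [Finset.card_range]; exact_mod_cast hn
    gcongr; linarith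
  have cr2 : C * B * (Ico n q).card ≤ C * B * (K + 1) := by
    have : ((Ico n q).card : ℝ) ≤ K := by rw [Nat.card_Ico]; exact_mod_cast (by omega)
    gcongr; linarith
  have cr3 : C * B * (Ico q K).card ≤ C * B * (K + 1) := by
    have : ((Ico q K).card : ℝ) ≤ K := by rw [Nat.card_Ico]; exact_mod_cast (by omega)
    gcongr; linarith
  have vm : Vs t c (Ico n q) ≤ 2 * B * δ := by
    have : Vs t c (Ico n q) ≤ ∑ k ∈ Ico n q, B * δ := sum_le_sum fun k hk => by
      have hk' := mem_range.1 (sm hk)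
      have := h.2.2.2 k hk'
      exact mul_le_mul (hB k hk') (hδ k hk') (by linarith) hB0
    refine this.trans ?_
    rw [Finset.sum_const, Nat.card_Ico, nsmul_eq_mul]
    have : ((q - n : ℕ) : ℝ) ≤ 2 := by exact_mod_cast (by omega)
    have d0 : 0 ≤ δ := by have := h.2.2.2 0 h.1; have := hδ 0 h.1; linarith
    nlinarith [mul_nonneg hB0 d0]
  have vt : Vs t c (Ico q K) ≤ Vs t c (Ico n K) := Vs_mono h c (Finset.Ico_subset_Ico_left hq1)
    (fun x hx => by simp at hx ⊢; omega)
  rw [e3]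
  have i1 : p • hv + hw ∈ Sp (Vi N) := (Sp _).add_mem ((Sp _).smul_mem _ ihv) ihw
  refine (En_ka ((Sp _).add_mem ((Sp _).add_mem i1 itv) itw) ((Sp _).add_mem imv imw) hκ).trans ?_
  have f1 : EV N (mv + mw) (mv + mw) ≤ 8 * B * δ * log N + 4 * (C * B * (K+1)) := by
    refine (En_add_le imv imw).trans ?_
    have := mul_le_mul_of_nonneg_right vm L0
    linarith
  have cs := En_cs ihv ihw one_pos
  rw [inv_one] at cs
  have f2 : EV N (p • hv + hw + tv + tw) (p • hv + hw + tv + tw) ≤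
      ((1+p)^2 * Vs t c (range n) + 2 * Vs t c (Ico n K)) * log N + 6 * (C * B * (K+1)) := by
    have s1 := En_symm ihv itv; have s2 := En_symm ihw itv; have s3 := En_symm ihv itw; have s4 := En_symm ihw itw
    have s5 := En_symm itv itw; have s6 := En_symm ihv ihw
    have ex : EV N (p • hv + hw + tv + tw) (p • hv + hw + tv + tw) =
        p^2 * EV N hv hv + p * (2 * EV N hv hw) + EV N hw hw + EV N tv tv + EV N tw tw := by
      simp only [EV, map_add, map_smul, LinearMap.add_apply, LinearMap.smul_apply, smul_eq_mul] at *
      rw [s5, ← s1, ← s2, ← s3, ← s4, o2, o3, o4, o5, o6, ← s6]; ring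
    rw [ex]
    exact v2a p _ _ _ _ _ _ _ _ _ _ (by positivity) hp0 hp1 (b1.trans (by linarith only [cr])) (b2.trans (by linarith only [cr])) (by linarith only [cs])
      (b5.trans (by linarith only [cr3])) (b6.trans (by linarith only [cr3])) (mul_le_mul_of_nonneg_right vt L0)
  refine (v2b κ _ _ _ B δ _ _ (by positivity) hκ hκ1 f2 f1).trans_eq (by ring)
def oe (x : ℝ) : ENNReal := ENNReal.ofReal (exp x)
theorem oe_add (x y : ℝ) : oe (x + y) = oe x * oe y := by
  rw [oe, exp_add, ENNReal.ofReal_mul (exp_pos _).le]; rfl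
theorem oe_rpow (x p : ℝ) : oe x ^ p = oe (p * x) := by
  rw [oe, ENNReal.ofReal_rpow_of_pos (exp_pos _), ← Real.exp_mul, mul_comm]; rfl
theorem oe_le {x y : ℝ} : oe x ≤ oe y ↔ x ≤ y := by
  rw [oe, oe, ENNReal.ofReal_le_ofReal_iff (exp_pos _).le, exp_le_exp]
theorem oe_zero : oe 0 = 1 := by simp [oe]
theorem nat_oe {n : ℕ} {x : ℝ} (h : (n:ℝ) ≤ exp x) : (n : ENNReal) ≤ oe x := by
  rw [← ENNReal.ofReal_natCast]; exact ENNReal.ofReal_le_ofReal h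
theorem sum_oe {ι : Type*} {A : Finset ι} (hA : A.Nonempty) (x : ι → ℝ) : ∑ v ∈ A, oe (x v) = oe (lse A x) := by
  rw [oe, exp_lse hA, ENNReal.ofReal_sum_of_nonneg fun _ _ => (exp_pos _).le]; rfl
theorem rpow_sum_le' {ι : Type*} (A : Finset ι) (a : ι → ENNReal) {p : ℝ} (h0 : 0 < p) (h1 : p ≤ 1) :
    (∑ i ∈ A, a i) ^ p ≤ ∑ i ∈ A, a i ^ p := by
  induction A using Finset.induction_on with
  | empty => simp [h0]
  | insert i A hi ih =>
    rw [Finset.sum_insert hi, Finset.sum_insert hi]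
    exact (ENNReal.rpow_add_le_add_rpow _ _ h0.le h1).trans (by gcongr)
theorem oe_meas (N : ℕ) (g : Vtx → ℝ) : Measurable fun ω => oe (X N g ω) :=
  ENNReal.measurable_ofReal.comp (measurable_exp.comp (X_meas N g))
theorem lint_X {N : ℕ} {P : Measure FieldSp} (h : IsGFF N P) {g : Vtx → ℝ} (hg : g ∈ Sp (Vi N)) :
    ∫⁻ ω, oe (X N g ω) ∂P = oe (EV N g g / 2) := by
  obtain ⟨h1, h2⟩ := X_int h hg 1
  simp only [one_mul, one_pow] at h1 h2
  rw [oe, ← h2, ofReal_integral_eq_lintegral_ofReal h1 (Eventually.of_forall fun _ => (exp_pos _).le)]; rfl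
theorem oe_X (N : ℕ) (g g' : Vtx → ℝ) (ω : FieldSp) : oe (X N g ω) * oe (X N g' ω) = oe (X N (g + g') ω) := by
  rw [← oe_add]; simp [X]
theorem hol {N : ℕ} {P : Measure FieldSp} (h : IsGFF N P) {g A : Vtx → ℝ} (hg : g ∈ Sp (Vi N)) (hA : A ∈ Sp (Vi N))
    {S : FieldSp → ENNReal} (hS : Measurable S) {p p' : ℝ} (hp : 0 < p) (hp' : p ≤ p') :
    ∫⁻ ω, oe (X N g ω) * S ω ^ p ∂P ≤ oe (EV N (g + p • A) (g + p • A) / 2) ^ (1 - p / p') *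
      (∫⁻ ω, oe (X N (g + (p - p') • A) ω) * S ω ^ p' ∂P) ^ (p / p') := by
  have p0 : 0 < p' := hp.trans_le hp'
  have r1 : p / p' ≤ 1 := (div_le_one p0).2 hp'
  have r0 : 0 < p / p' := by positivity
  rw [← lint_X h ((Sp _).add_mem hg ((Sp _).smul_mem p hA))]
  refine (le_of_eq (lintegral_congr fun ω => ?_)).trans (ENNReal.lintegral_mul_norm_pow_le (oe_meas N _).aemeasurable
    ((oe_meas N _).mul (hS.pow_const _)).aemeasurable (by linarith) r0.le (by ring))
  simp only [Pi.mul_apply]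
  rw [ENNReal.mul_rpow_of_nonneg _ _ r0.le, ← ENNReal.rpow_mul, mul_div_cancel₀ p p0.ne', oe_rpow, oe_rpow, ← mul_assoc, ← oe_add]
  congr 2
  simp only [X, map_add, map_smul, LinearMap.add_apply, LinearMap.smul_apply, smul_eq_mul]
  field_simp; ring
def bulk (N : ℕ) : Finset Vtx := (VN N).filter fun v => N ≤ 4 * dd N v
theorem VN_card {N : ℕ} (hN : 1 ≤ N) : ((VN N).card : ℝ) ≤ exp (2 * log N + 2) := by
  have h1 : (1:ℝ) ≤ N := by exact_mod_cast hN
  have e : (VN N).card = (N+1)^2 := by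
    rw [VN, Finset.card_Icc_prod, Int.card_Icc, sq, show ((N:ℤ)+1-0).toNat = N+1 by omega]
  have h2 := add_one_le_exp 1
  have : exp (2 * log N + 2) = N^2 * (exp 1)^2 := by
    rw [exp_add, mul_comm 2, ← Real.rpow_natCast, Real.exp_mul, exp_log (by linarith), ← Real.exp_nat_mul]; norm_num
  rw [this, e]; push_cast
  rw [← mul_pow]
  gcongr
  nlinarith
theorem bulk_card {N : ℕ} (hN : 8 ≤ N) : exp (2 * log N - 4) ≤ (bulk N).card := by
  have h1 : (8:ℝ) ≤ N := by exact_mod_cast hN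
  have sub : Finset.Icc (((N:ℤ)+3)/4) (((N:ℤ)+3)/4 + (N/4:ℕ)) ×ˢ Finset.Icc (((N:ℤ)+3)/4) (((N:ℤ)+3)/4 + (N/4:ℕ)) ⊆ bulk N := by
    intro x hx
    simp only [Finset.mem_product, Finset.mem_Icc, bulk] at hx ⊢
    refine Finset.mem_filter.2 ⟨mem_VN.2 (by omega), ?_⟩
    unfold dd; omega
  have := Finset.card_le_card sub
  rw [Finset.card_product, Int.card_Icc] at this
  have h3 : (((N:ℤ)+3)/4 + (N/4:ℕ) + 1 - ((N:ℤ)+3)/4).toNat = N/4+1 := by omega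
  rw [h3] at this
  have h4 : (N:ℝ)/4 ≤ ((N/4+1 : ℕ) : ℝ) := by
    rw [div_le_iff₀ (by norm_num)]; exact_mod_cast (by omega : N ≤ (N/4+1)*4)
  have h5 := add_one_le_exp 1
  have : exp (2 * log N - 4) = N^2 / (exp 1)^4 := by
    rw [exp_sub, mul_comm 2, Real.exp_mul, exp_log (by linarith), ← Real.exp_nat_mul]; norm_num
  rw [this]
  calc (N:ℝ)^2 / (exp 1)^4 ≤ N^2/2^4 := by gcongr; linarith
    _ = ((N:ℝ)/4) * ((N:ℝ)/4) := by ring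
    _ ≤ ((N/4+1 : ℕ) : ℝ) * ((N/4+1 : ℕ) : ℝ) := by gcongr
    _ ≤ _ := by exact_mod_cast ‹_›
theorem nr_card {K : ℕ} {t : ℕ → ℝ} {N : ℕ} (h : Ptn K t) (hR : Rf K t N) {n : ℕ} (hn : n ≤ K) (v : Vtx) {W : Finset Vtx} (hW : W ⊆ VN N)
    (hW' : n = 0 ∨ ∀ w ∈ W, nr (rad N (t n)) v w) : (W.card : ℝ) ≤ exp (2 * (1 - t n) * log N + 6) := by
  rcases hW' with rfl | hW'
  · refine (Nat.cast_le.2 (Finset.card_le_card hW)).trans ((VN_card hR.1).trans (exp_le_exp.2 ?_))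
    rw [h.2.1]; linarith
  set r := rad N (t n)
  have sub : W ⊆ Finset.Icc (v.1 - (r/4:ℕ)) (v.1 + (r/4:ℕ)) ×ˢ Finset.Icc (v.2 - (r/4:ℕ)) (v.2 + (r/4:ℕ)) := by
    intro x hx
    obtain ⟨a, b⟩ := hW' x hx
    have := abs_le.1 (show |v.1 - x.1| ≤ ((r/4:ℕ):ℤ) by omega)
    have := abs_le.1 (show |v.2 - x.2| ≤ ((r/4:ℕ):ℤ) by omega)
    simp only [Finset.mem_product, Finset.mem_Icc]; omega
  have c := Finset.card_le_card sub
  rw [Finset.card_product, Int.card_Icc, Int.card_Icc, show (v.1 + (r/4:ℕ) + 1 - (v.1 - (r/4:ℕ))).toNat = 2*(r/4)+1 by omega,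
    show (v.2 + (r/4:ℕ) + 1 - (v.2 - (r/4:ℕ))).toNat = 2*(r/4)+1 by omega] at c
  have c2 : 2*(r/4)+1 ≤ max r 1 := by omega
  have c3 : ((max r 1 : ℕ):ℝ) ≤ exp ((1 - t n) * log N + 2) := by
    have hr := (abs_le.1 (hR.2.2 n hn)).2
    rcases Nat.eq_zero_or_pos r with h0 | h0
    · have : 0 ≤ (1 - t n) * log N := mul_nonneg (by linarith [h.le1 hn]) (Real.log_natCast_nonneg N)
      rw [h0]; simp; linarith
    · rw [max_eq_left h0, ← Real.log_le_iff_le_exp (by exact_mod_cast h0)]; linarith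
  calc (W.card : ℝ) ≤ ((max r 1 : ℕ):ℝ) * ((max r 1 : ℕ):ℝ) := by exact_mod_cast c.trans (Nat.mul_le_mul c2 c2)
    _ ≤ exp ((1 - t n) * log N + 2) * exp ((1 - t n) * log N + 2) := by gcongr
    _ ≤ _ := by rw [← exp_add, exp_le_exp]; linarith
theorem lbA (p κ B δ V R L τ c1 c2 : ℝ) (hp : 0 < p) (hp1 : p ≤ 1) (hκ : 0 < κ) (hκ1 : κ ≤ 1) (hBδ : 0 ≤ B * δ) (hV : 0 ≤ V) (hR : 0 ≤ R)
    (hL : 0 ≤ L) (h1 : V ≤ 4 * τ) (h2 : V + R ≤ 4) (hc1 : 0 ≤ c1) (hc2 : 0 ≤ c2) :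
    (1 - p) * ((((1+p)^2 * V + R) * L + c1) / 2) + p * (2 * (1 - τ) * L + 6 +
      ((1+κ) * ((1+p)^2 * V + 2 * R) * L + (1+κ⁻¹) * 8 * B * δ * L + c2) / 2) ≤
      ((1+p) * (V+R) / 2 + 2 * p + 2 * p^2 + p * (8 * κ + 8 * B * δ * κ⁻¹)) * L + (c1 + 6 + c2) := by
  have ki : 1 ≤ κ⁻¹ := (one_le_inv₀ hκ).2 hκ1
  have a1 : p * ((1+κ⁻¹) * 8 * B * δ) ≤ p * (16 * B * δ * κ⁻¹) := by nlinarith [mul_nonneg hp.le hBδ]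
  have q1 : (1+p)^2 ≤ 4 := by nlinarith
  have a2 : (1+p)^2 * V + 2 * R ≤ 16 := by nlinarith
  have a3 : p * κ * ((1+p)^2 * V + 2 * R) ≤ p * κ * 16 := by gcongr
  have a4 : p * V ≤ p * (4 * τ) := by gcongr
  have a5 : p^2 * V ≤ p^2 * 4 := by gcongr; linarith
  have a6 : p * c1 ≥ 0 := by positivity
  have a7 : p * c2 ≤ c2 := by nlinarith
  have key : (1 - p) * ((1+p)^2 * V + R) / 2 + p * (2 * (1 - τ) + ((1+κ) * ((1+p)^2 * V + 2 * R) + (1+κ⁻¹) * 8 * B * δ) / 2) ≤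
      (1+p) * (V+R) / 2 + 2 * p + 2 * p^2 + p * (8 * κ + 8 * B * δ * κ⁻¹) := by nlinarith
  have := mul_le_mul_of_nonneg_right key hL
  nlinarith
def lev (K : ℕ) (t : ℕ → ℝ) (N : ℕ) (v w : Vtx) : ℕ := Nat.findGreatest (fun n => nr (rad N (t n)) v w) K
theorem lb2 {K : ℕ} {t c : ℕ → ℝ} {B p κ δ : ℝ} (h : Ptn K t) (hB0 : 0 ≤ B) (hB : ∀ k < K, c k ^ 2 ≤ B) (hp : 0 < p) (hp1 : p ≤ 1)
    (hκ : 0 < κ) (hκ1 : κ ≤ 1) (hδ : ∀ k < K, t (k+1) - t k ≤ δ) (hV : ∀ n ≤ K, Vs t c (range n) ≤ 4 * t n) :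
    ∃ C : ℝ, ∀ N P, Rf K t N → IsGFF N P → ∀ A ⊆ VN N, ∫⁻ ω, (∑ v ∈ A, oe (X N (hd N t c (range K) v) ω)) ^ (1+p) ∂P ≤
      oe (((1+p) * (2 + Vs t c (range K) / 2) + 2 * p^2 + p * (8 * κ + 8 * B * δ * κ⁻¹)) * log N + C) := by
  obtain ⟨C1, hC1, h1⟩ := hd_bd
  obtain ⟨C2, hC2, h2⟩ := var2
  set c1 := C1 * (4 * B) * K
  set c2 := C2 * B * (K+1) * κ⁻¹
  refine ⟨c1 + 6 + c2 + 2 + (K+1), fun N P hR hP A hA => ?_⟩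
  have L0 : 0 ≤ log N := Real.log_natCast_nonneg N
  have hN := hR.1
  set H := fun v => hd N t c (range K) v
  have iH : ∀ v, H v ∈ Sp (Vi N) := fun v => hd_V h hN c subset_rfl v
  set E := ((1+p) * Vs t c (range K) / 2 + 2 * p + 2 * p^2 + p * (8 * κ + 8 * B * δ * κ⁻¹)) * log N + (c1 + 6 + c2)
  have d0 : 0 ≤ δ := by have := h.2.2.2 0 h.1; have := hδ 0 h.1; linarith
  have main : ∀ v ∈ A, ∀ n ∈ range (K+1),
      ∫⁻ ω, oe (X N (H v) ω) * (∑ w ∈ A.filter (fun w => lev K t N v w = n), oe (X N (H w) ω)) ^ p ∂P ≤ oe E := by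
    intro v hv n hn
    have hn : n ≤ K := by simp at hn; omega
    set W := A.filter (fun w => lev K t N v w = n)
    set a := hd N t c (range n) v
    have ia : a ∈ Sp (Vi N) := hd_V h hN c (Finset.range_mono hn) v
    have hW : ∀ w ∈ W, (n = 0 ∨ nr (rad N (t n)) v w) ∧ (n < K → ¬ nr (rad N (t (n+1))) v w) := by
      intro w hw
      have e := (Finset.mem_filter.1 hw).2
      refine ⟨?_, fun hnK => Nat.findGreatest_is_greatest (by rw [← lev, e]; omega) hnK⟩
      by_cases h0 : n = 0
      · exact .inl h0
      · right; rw [← e]; exact Nat.findGreatest_of_ne_zero (n := K) rfl (by rw [← lev, e]; exact h0)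
    have cd := nr_card h hR hn v (W := W) ((Finset.filter_subset _ _).trans hA) (by
      by_cases h0 : n = 0
      · exact .inl h0
      · exact .inr fun w hw => (hW w hw).1.resolve_left h0)
    have U1 : EV N (H v + p • a) (H v + p • a) ≤ ((1+p)^2 * Vs t c (range n) + Vs t c (Ico n K)) * log N + c1 := by
      set c' : ℕ → ℝ := fun k => if k < n then (1+p) * c k else c k
      have b := (h1 K t c' N (4*B) h hR (fun k hk => by
        have := hB k hk
        simp only [c']; split_ifs
        · rw [mul_pow]; gcongr; nlinarith
        · linarith) _ subset_rfl v).1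
      have e1 : hd N t c' (range K) v = H v + p • a := by
        simp only [H, a, hd, Finset.range_eq_Ico]
        rw [← Finset.sum_Ico_consecutive _ (Nat.zero_le n) hn, ← Finset.sum_Ico_consecutive (fun k => c k • ic N t k v) (Nat.zero_le n) hn,
          Finset.smul_sum, add_right_comm, ← sum_add_distrib]
        congr 1
        · refine sum_congr rfl fun k hk => ?_
          simp only [c', if_pos (mem_Ico.1 hk).2]; module
        · refine sum_congr rfl fun k hk => ?_
          simp only [c', if_neg (not_lt.2 (mem_Ico.1 hk).1)]
      have e2 : Vs t c' (range K) = (1+p)^2 * Vs t c (range n) + Vs t c (Ico n K) := by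
        simp only [Vs, Finset.range_eq_Ico]
        rw [← Finset.sum_Ico_consecutive _ (Nat.zero_le n) hn, mul_sum]
        congr 1
        · refine sum_congr rfl fun k hk => ?_
          simp only [c', if_pos (mem_Ico.1 hk).2]; ring
        · refine sum_congr rfl fun k hk => ?_
          simp only [c', if_neg (not_lt.2 (mem_Ico.1 hk).1)]
      rw [e1, e2, Finset.card_range] at b; exact b
    set u2 := (1+κ) * ((1+p)^2 * Vs t c (range n) + 2 * Vs t c (Ico n K)) * log N + (1+κ⁻¹) * 8 * B * δ * log N + c2
    have U2 : ∫⁻ ω, oe (X N (H v + (p - 1) • a) ω) * (∑ w ∈ W, oe (X N (H w) ω)) ^ (1:ℝ) ∂P ≤ oe (2 * (1 - t n) * log N + 6 + u2/2) := by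
      simp only [ENNReal.rpow_one, mul_sum, oe_X]
      rw [lintegral_finset_sum _ fun w _ => oe_meas N _]
      have : ∀ w ∈ W, ∫⁻ ω, oe (X N (H v + (p - 1) • a + H w) ω) ∂P ≤ oe (u2/2) := fun w hw => by
        rw [lint_X hP ((Sp _).add_mem ((Sp _).add_mem (iH v) ((Sp _).smul_mem _ ia)) (iH w)), oe_le]
        have := h2 K t c N n B p κ δ v w h hR hB0 hB hp.le hp1 hκ hκ1 hδ hn (hW w hw).1 (hW w hw).2
        have e : H v + (p-1) • a = p • a + hd N t c (Ico n K) v := by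
          simp only [H, a]; rw [Finset.range_eq_Ico, hd_split (Nat.zero_le n) hn, ← Finset.range_eq_Ico]; module
        rw [e]; linarith
      refine (Finset.sum_le_card_nsmul _ _ _ this).trans ?_
      rw [nsmul_eq_mul, oe_add]
      gcongr; exact nat_oe cd
    have ho := hol hP (iH v) ia (S := fun ω => ∑ w ∈ W, oe (X N (H w) ω)) (Finset.measurable_fun_sum _ fun w _ => oe_meas N _) hp hp1
    rw [div_one] at ho
    refine ho.trans ((mul_le_mul' (ENNReal.rpow_le_rpow (oe_le.2 (div_le_div_of_nonneg_right U1 zero_le_two)) (by linarith))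
      (ENNReal.rpow_le_rpow U2 hp.le)).trans ?_)
    rw [oe_rpow, oe_rpow, ← oe_add, oe_le]
    have vs : Vs t c (range n) + Vs t c (Ico n K) = Vs t c (range K) := by
      simp only [Vs, Finset.range_eq_Ico]; exact Finset.sum_Ico_consecutive _ (Nat.zero_le n) hn
    have v4 := hV K le_rfl
    rw [h.2.2.1] at v4
    have pos : ∀ S ⊆ range K, 0 ≤ Vs t c S := fun S hS => by simpa [Vs] using Vs_mono h c (Finset.empty_subset S) hS
    have := lbA p κ B δ (Vs t c (range n)) (Vs t c (Ico n K)) (log N) (t n) c1 c2 hp hp1 hκ hκ1 (by positivity)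
      (pos _ (Finset.range_mono hn)) (pos _ fun x hx => by simp at hx ⊢; omega) L0 (hV n hn) (by linarith) (by positivity) (by positivity)
    rw [vs] at this
    exact this
  calc ∫⁻ ω, (∑ v ∈ A, oe (X N (H v) ω)) ^ (1+p) ∂P
      ≤ ∫⁻ ω, ∑ v ∈ A, ∑ n ∈ range (K+1), oe (X N (H v) ω) * (∑ w ∈ A.filter (fun w => lev K t N v w = n), oe (X N (H w) ω)) ^ p ∂P := by
        refine lintegral_mono fun ω => ?_
        simp only
        rw [ENNReal.rpow_add_of_nonneg _ _ zero_le_one hp.le, ENNReal.rpow_one, Finset.sum_mul]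
        refine sum_le_sum fun v _ => ?_
        rw [← mul_sum]
        gcongr
        rw [← Finset.sum_fiberwise_of_maps_to (s := A) (t := range (K+1)) (g := fun w => lev K t N v w)
          (fun w _ => mem_range.2 (Nat.lt_succ_of_le (Nat.findGreatest_le K)))]
        exact rpow_sum_le' _ _ hp hp1
    _ = ∑ v ∈ A, ∑ n ∈ range (K+1), ∫⁻ ω, oe (X N (H v) ω) * (∑ w ∈ A.filter (fun w => lev K t N v w = n), oe (X N (H w) ω)) ^ p ∂P := by
        have ms : ∀ v n, Measurable fun ω => oe (X N (H v) ω) * (∑ w ∈ A.filter (fun w => lev K t N v w = n), oe (X N (H w) ω)) ^ p := fun v n =>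
          (oe_meas N _).mul ((Finset.measurable_fun_sum _ fun w _ => oe_meas N _).pow_const _)
        rw [lintegral_finset_sum _ fun v _ => Finset.measurable_fun_sum _ fun n _ => ms v n]
        exact sum_congr rfl fun v _ => lintegral_finset_sum _ fun n _ => ms v n
    _ ≤ A.card • ((K+1) • oe E) := Finset.sum_le_card_nsmul _ _ _ fun v hv =>
        (Finset.sum_le_card_nsmul _ _ _ (main v hv)).trans (by rw [Finset.card_range])
    _ ≤ oe (2 * log N + 2) * (oe (K+1) * oe E) := by
        rw [nsmul_eq_mul, nsmul_eq_mul]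
        gcongr
        · exact nat_oe ((Nat.cast_le.2 (Finset.card_le_card hA)).trans (VN_card hN))
        · exact nat_oe (by push_cast; linarith [add_one_le_exp ((K:ℝ)+1)])
    _ ≤ _ := by
        rw [← oe_add, ← oe_add, oe_le]; simp only [E]; linarith
theorem logN_ev (C : ℝ) : ∀ᶠ N : ℕ in atTop, C ≤ log N :=
  (Real.tendsto_log_atTop.comp tendsto_natCast_atTop_atTop).eventually_ge_atTop C
theorem lbB (τ p a m L x ε e1 C1 C2 C3 : ℝ) (hτ : 0 < τ) (hτ1 : 100 * τ ≤ ε) (hp : p = τ^2) (ha : p ≤ 2 * a) (ha0 : 0 < a) (ha1 : a ≤ 1)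
    (haτ : a * τ + (1 - a) * (1 + p) = 1) (hL : 0 ≤ L) (he : e1 ≤ 18 * p^2) (hLL : |C1| + |C2| + |C3| ≤ a * τ * ε / 4 * L)
    (h : m * L - C1 ≤ a * (τ * x + 2 * τ^2 * (4 * L + C3)) + (1 - a) * (((1+p) * m + e1) * L + C2)) (hτ2 : τ ≤ 1/2) : (m - ε) * L ≤ x := by
  by_contra hx
  push Not at hx
  have t0 : a * τ * x ≤ a * τ * ((m - ε) * L) := mul_le_mul_of_nonneg_left hx.le (by positivity)
  have t1 : (1 - a) * (e1 * L) ≤ 18 * p^2 * L := by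
    have : e1 * L ≤ 18 * p^2 * L := by gcongr
    have h0 : 0 ≤ 18 * p^2 * L := by positivity
    nlinarith
  have t2 : (1 - a) * C2 ≤ |C2| := (mul_le_mul_of_nonneg_left (le_abs_self C2) (by linarith)).trans (by nlinarith [abs_nonneg C2])
  have t3 : 2 * a * τ^2 * C3 ≤ |C3| := by
    have h1 : 2 * a * τ^2 ≤ 1 := by nlinarith
    have h2 : 0 ≤ 2 * a * τ^2 := by positivity
    nlinarith [le_abs_self C3, abs_nonneg C3]
  have t4 : C1 ≤ |C1| := le_abs_self _
  have e1' : (1 - a) * (1+p) * m * L = (1 - a * τ) * (m * L) := by rw [show (1-a)*(1+p) = 1 - a*τ by linarith]; ring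
  have t5 : a * τ * ε * L ≤ 8 * a * τ^2 * L + 18 * p^2 * L + a * τ * ε / 4 * L := by nlinarith
  have t6 : 8 * a * τ^2 * L ≤ a * τ * ε * L * (8/100) := by
    have : 0 ≤ a * τ * L := by positivity
    nlinarith
  have t7 : 18 * p^2 * L ≤ a * τ * ε * L * (36/100) := by
    have : 18 * p^2 ≤ 36 * a * τ^2 := by rw [hp] at ha ⊢; nlinarith [sq_nonneg τ]
    have h2 : 36 * a * τ^2 ≤ a * τ * ε * (36/100) := by nlinarith [mul_pos ha0 hτ]
    nlinarith
  have hε : 0 < ε := by linarith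
  have : 0 ≤ a * τ * ε * L := by positivity
  have : a * τ * ε * L = 0 := by linarith
  have hL0 : L = 0 := by
    rcases mul_eq_zero.1 this with h | h
    · exact absurd h (by positivity)
    · exact h
  subst hL0
  have := abs_nonneg C1; have := abs_nonneg C2; have := abs_nonneg C3
  nlinarith [mul_pos ha0 hτ]
theorem LB {B ε : ℝ} (hB0 : 0 ≤ B) (hε : 0 < ε) : ∃ δ > 0, ∀ (K : ℕ) (t c : ℕ → ℝ), Ptn K t → (∀ k < K, t (k+1) - t k ≤ δ) → (∀ k < K, c k ^ 2 ≤ B) →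
    (∀ n ≤ K, Vs t c (range n) ≤ 4 * t n) → ∀ᶠ N in atTop, ∀ P, IsGFF N P →
    (2 + Vs t c (range K) / 2 - ε) * log N ≤ ∫ ω, lse (bulk N) (fun v => X N (hd N t c (range K) v) ω) ∂P := by
  obtain ⟨C0, hC0, hb⟩ := hd_bd
  set τ := min (ε/100) (1/2)
  have τ0 : 0 < τ := lt_min (by positivity) (by norm_num)
  have τ1 : 100 * τ ≤ ε := by have := min_le_left (ε/100) (1/2 : ℝ); simp only [τ]; linarith
  have τ2 : τ ≤ 1/2 := min_le_right _ _
  set p := τ^2 with hp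
  have p0 : 0 < p := by positivity
  have p1 : p ≤ 1 := by nlinarith
  refine ⟨p^2/(B+1), by positivity, fun K t c h hδ hB hV => ?_⟩
  obtain ⟨C, hC⟩ := lb2 h hB0 hB p0 p1 p0 p1 hδ hV
  set V := Vs t c (range K)
  set a := p / (1 + p - τ)
  have dn : 0 < 1 + p - τ := by linarith
  have a0 : 0 < a := by positivity
  have a1 : a ≤ 1 := (div_le_one dn).2 (by linarith)
  have a2 : p ≤ 2 * a := by
    simp only [a]; rw [← mul_div_assoc, le_div_iff₀ dn]; nlinarith
  have aτ : a * τ + (1 - a) * (1 + p) = 1 := by simp only [a]; field_simp; ring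
  have ee : 2 * p^2 + p * (8 * p + 8 * B * (p^2/(B+1)) * p⁻¹) ≤ 18 * p^2 := by
    have : B * (p^2/(B+1)) * p⁻¹ ≤ p := by
      rw [show B * (p^2/(B+1)) * p⁻¹ = p * (B/(B+1)) by field_simp]
      have : B/(B+1) ≤ 1 := (div_le_one (by linarith)).2 (by linarith)
      nlinarith
    nlinarith
  have V4 : V ≤ 4 := by have := hV K le_rfl; rw [h.2.2.1] at this; linarith
  set c1 := C0 * B * K
  filter_upwards [Rf_ev h, logN_ev ((|4 + c1/2| + |C| + |c1|) / (a * τ * ε / 4)), eventually_ge_atTop 8] with N hR hL h8 P hP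
  have := hP.1
  have L0 : 0 ≤ log N := Real.log_natCast_nonneg N
  set H := fun v => hd N t c (range K) v
  have iH : ∀ v, H v ∈ Sp (Vi N) := fun v => hd_V h hR.1 c subset_rfl v
  have bd := fun v => hb K t c N B h hR hB _ subset_rfl v
  simp only [Finset.card_range] at bd
  have cb := bulk_card h8
  have ne : (bulk N).Nonempty := by
    rw [← Finset.card_pos]; exact_mod_cast (exp_pos _).trans_le cb
  set F := fun ω => lse (bulk N) (fun v => X N (H v) ω)
  have Fe : ∀ ω, ∑ v ∈ bulk N, oe (X N (H v) ω) = oe (F ω) := fun ω => sum_oe ne _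
  have Fm : Measurable F :=
    Real.measurable_log.comp (Finset.measurable_fun_sum _ fun v _ => measurable_exp.comp (X_meas N (H v)))
  have om : ∀ s : ℝ, Measurable fun ω => oe (s * F ω) := fun s => ENNReal.measurable_ofReal.comp (measurable_exp.comp (Fm.const_mul s))
  have s1 : oe ((2 + V/2) * log N - (4 + c1/2)) ≤ ∫⁻ ω, oe (F ω) ∂P := by
    simp only [← Fe]
    rw [lintegral_finset_sum _ fun w _ => oe_meas N _]
    have : ∀ v ∈ bulk N, oe ((V * log N - c1)/2) ≤ ∫⁻ ω, oe (X N (H v) ω) ∂P := fun v hv => by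
      rw [lint_X hP (iH v), oe_le]
      have := (bd v).2 (Finset.mem_filter.1 hv).2
      simp only [c1, V]; linarith
    refine le_trans ?_ (Finset.card_nsmul_le_sum _ _ _ this)
    rw [nsmul_eq_mul, ← ENNReal.ofReal_natCast, show (2 + V/2) * log N - (4 + c1/2) = (2 * log N - 4) + (V * log N - c1)/2 by ring, oe_add]
    gcongr
    exact ENNReal.ofReal_le_ofReal cb
  have s2 := hC N P hR hP (bulk N) (Finset.filter_subset _ _)
  rw [lintegral_congr fun ω => show _ = oe ((1+p) * F ω) by rw [← oe_rpow, ← Fe]] at s2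
  have s3 : ∫⁻ ω, oe (τ * F ω) ∂P ≤ oe (τ * ∫ ω, F ω ∂P + 2 * τ^2 * (4 * log N + c1)) := by
    simp only [oe]
    rw [← ofReal_integral_eq_lintegral_ofReal ((lse_X hP ne H iH).2 τ) (Eventually.of_forall fun _ => (exp_pos _).le)]
    exact ENNReal.ofReal_le_ofReal (mp_X hP ne H iH (fun v _ => (bd v).1.trans (by simp only [c1]; gcongr)) τ0)
  have s4 : ∫⁻ ω, oe (F ω) ∂P ≤ (∫⁻ ω, oe (τ * F ω) ∂P)^a * (∫⁻ ω, oe ((1+p) * F ω) ∂P)^(1-a) := by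
    refine (le_of_eq (lintegral_congr fun ω => ?_)).trans (ENNReal.lintegral_mul_norm_pow_le (om τ).aemeasurable (om (1+p)).aemeasurable a0.le
      (by linarith) (by ring))
    rw [oe_rpow, oe_rpow, ← oe_add, ← mul_assoc, ← mul_assoc, ← add_mul, aτ, one_mul]
  have s5 := (s1.trans s4).trans (mul_le_mul' (ENNReal.rpow_le_rpow s3 a0.le) (ENNReal.rpow_le_rpow s2 (by linarith)))
  rw [oe_rpow, oe_rpow, ← oe_add, oe_le] at s5
  exact lbB τ p a (2 + V/2) (log N) (∫ ω, F ω ∂P) ε _ (4 + c1/2) C c1 τ0 τ1 rfl a2 a0 a1 aτ L0 ee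
    (by rw [div_le_iff₀ (by positivity)] at hL; linarith) (s5.trans_eq (by ring)) τ2
def gg (q : ℕ → ℝ) (s : ℕ → Vtx → Vtx) (a : ℕ → Vtx → Vtx → ℝ) (n : ℕ) (u : Vtx) : Vtx → ℝ :=
  ∑ j ∈ range n, (q (j+1) - q (j+2)) • a (j+1) (s (j+1) u)
theorem ubrec {N : ℕ} {P : Measure FieldSp} (hP : IsGFF N P) {K : ℕ} (hK : 1 ≤ K) (q : ℕ → ℝ) (s : ℕ → Vtx → Vtx) (a : ℕ → Vtx → Vtx → ℝ) (ν U : ℕ → ℝ)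
    (q0 : ∀ j, 0 < q j) (q1 : ∀ j, q j ≤ 1) (qm : ∀ j, q j ≤ q (j+1)) (qK : q (K+1) = q K) (sK : ∀ v, s K v = v)
    (ia : ∀ j w, a j w ∈ Sp (Vi N)) (hU : ∀ n < K, ∀ u ∈ VN N,
      EV N (gg q s a n u + q (n+1) • a (n+1) (s (n+1) u)) (gg q s a n u + q (n+1) • a (n+1) (s (n+1) u)) ≤ U (n+1))
    (hν : ∀ n < K, ∀ u ∈ VN N, ∀ C ⊆ VN N, (∀ v ∈ C, ∀ j ≤ n, s j v = s j u) → ((C.image (s (n+1))).card : ℝ) ≤ exp (ν (n+1))) :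
    ∀ d n, n + d = K → ∀ u ∈ VN N, ∀ C ⊆ VN N, (∀ v ∈ C, ∀ j ≤ n, s j v = s j u) →
    ∫⁻ ω, oe (X N (gg q s a n u) ω) * (∑ v ∈ C, oe (X N (a K v) ω)) ^ q (n+1) ∂P ≤
      oe (U n / 2 + q (n+1) * ∑ j ∈ Finset.Ioc n K, (ν j + (U j - U (j-1)) / 2) / q j) := by
  have ig : ∀ n u, gg q s a n u ∈ Sp (Vi N) := fun n u => (Sp _).sum_mem fun j _ => (Sp _).smul_mem _ (ia _ _)
  intro d
  induction d with
  | zero =>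
    rintro n rfl u hu C hC hs
    obtain ⟨k, rfl⟩ : ∃ k, n = k + 1 := ⟨n-1, by omega⟩
    simp only [add_zero, Finset.Ioc_self, Finset.sum_empty, mul_zero] at *
    have sub : C ⊆ {u} := fun v hv => by
      have := hs v hv (k+1) le_rfl; rw [sK, sK] at this; simp [this]
    calc ∫⁻ ω, oe (X N (gg q s a (k+1) u) ω) * (∑ v ∈ C, oe (X N (a (k+1) v) ω)) ^ q (k+1+1) ∂P
        ≤ ∫⁻ ω, oe (X N (gg q s a k u + q (k+1) • a (k+1) (s (k+1) u)) ω) ∂P := by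
          refine lintegral_mono fun ω => ?_
          have : ∑ v ∈ C, oe (X N (a (k+1) v) ω) ≤ oe (X N (a (k+1) u) ω) := by
            have := Finset.sum_le_sum_of_subset (f := fun v => oe (X N (a (k+1) v) ω)) sub
            simpa using this
          refine (mul_le_mul' le_rfl (ENNReal.rpow_le_rpow this (q0 _).le)).trans (le_of_eq ?_)
          rw [oe_rpow, ← oe_add, qK, sK]
          congr 1
          simp [X, gg, sum_range_succ, qK]
      _ ≤ _ := by
          rw [lint_X hP ((Sp _).add_mem (ig _ _) ((Sp _).smul_mem _ (ia _ _))), oe_le]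
          linarith [hU k (by omega) u hu]
  | succ d ih =>
    intro n hn u hu C hC hs
    have hnK : n < K := by omega
    set r := q (n+1) / q (n+2)
    have r0 : 0 < r := div_pos (q0 _) (q0 _)
    have r1 : r ≤ 1 := (div_le_one (q0 _)).2 (qm _)
    set b := U (n+1) / 2 + q (n+2) * ∑ j ∈ Finset.Ioc (n+1) K, (ν j + (U j - U (j-1)) / 2) / q j
    have ch : ∀ w ∈ C.image (s (n+1)), ∫⁻ ω, oe (X N (gg q s a n u) ω) * (∑ v ∈ C.filter (fun v => s (n+1) v = w), oe (X N (a K v) ω)) ^ q (n+1) ∂P ≤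
        oe ((1 - r) * (U (n+1) / 2) + r * b) := by
      intro w hw
      obtain ⟨u', hu', rfl⟩ := Finset.mem_image.1 hw
      have e : gg q s a n u = gg q s a n u' := sum_congr rfl fun j hj => by
        rw [hs u' hu' (j+1) (mem_range.1 hj)]
      rw [e]
      refine (hol hP (ig n u') (ia (n+1) (s (n+1) u')) (Finset.measurable_fun_sum _ fun w _ => oe_meas N _) (q0 (n+1)) (qm (n+1))).trans ?_
      rw [oe_add, ← oe_rpow, ← oe_rpow _ r]
      refine mul_le_mul' (ENNReal.rpow_le_rpow (oe_le.2 ?_) (by simp only [r] at r1; linarith)) (ENNReal.rpow_le_rpow ?_ r0.le)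
      · linarith [hU n hnK u' (hC hu')]
      · have := ih (n+1) (by omega) u' (hC hu') (C.filter (fun v => s (n+1) v = s (n+1) u')) ((Finset.filter_subset _ _).trans hC) (fun v hv j hj => by
          rw [Finset.mem_filter] at hv
          rcases Nat.lt_or_ge n j with h | h
          · rw [show j = n+1 by omega]; exact hv.2
          · rw [hs v hv.1 j h, hs u' hu' j h])
        rw [gg, sum_range_succ] at this
        exact this
    calc ∫⁻ ω, oe (X N (gg q s a n u) ω) * (∑ v ∈ C, oe (X N (a K v) ω)) ^ q (n+1) ∂P
        ≤ ∫⁻ ω, ∑ w ∈ C.image (s (n+1)), oe (X N (gg q s a n u) ω) * (∑ v ∈ C.filter (fun v => s (n+1) v = w), oe (X N (a K v) ω)) ^ q (n+1) ∂P := by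
          refine lintegral_mono fun ω => ?_
          simp only
          rw [← mul_sum, ← Finset.sum_fiberwise_of_maps_to (s := C) (t := C.image (s (n+1))) (g := s (n+1)) (fun v hv => Finset.mem_image_of_mem _ hv)]
          gcongr
          exact rpow_sum_le' _ _ (q0 _) (q1 _)
      _ = ∑ w ∈ C.image (s (n+1)), ∫⁻ ω, oe (X N (gg q s a n u) ω) * (∑ v ∈ C.filter (fun v => s (n+1) v = w), oe (X N (a K v) ω)) ^ q (n+1) ∂P :=
          lintegral_finset_sum _ fun w _ => (oe_meas N _).mul ((Finset.measurable_fun_sum _ fun w _ => oe_meas N _).pow_const _)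
      _ ≤ oe (ν (n+1)) * oe ((1 - r) * (U (n+1) / 2) + r * b) := by
          refine (Finset.sum_le_card_nsmul _ _ _ ch).trans ?_
          rw [nsmul_eq_mul]
          gcongr
          exact nat_oe (hν n hnK u hu C hC hs)
      _ ≤ _ := by
          rw [← oe_add, oe_le]
          refine le_of_eq ?_
          have a1 := (q0 (n+1)).ne'
          have a2 := (q0 (n+2)).ne'
          rw [show Finset.Ioc n K = insert (n+1) (Finset.Ioc (n+1) K) by ext x; simp; omega, Finset.sum_insert (by simp)]
          simp only [b, r, Nat.succ_eq_add_one, Nat.add_sub_cancel]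
          set Sg := ∑ j ∈ Finset.Ioc (n+1) K, (ν j + (U j - U (j-1)) / 2) / q j
          field_simp; ring
theorem En_sum {ι : Type*} {N : ℕ} (S : Finset ι) (x : ι → Vtx → ℝ) {D : ℝ} (hx : ∀ i ∈ S, x i ∈ Sp (Vi N)) (hD : 0 ≤ D)
    (hb : ∀ i ∈ S, EV N (x i) (x i) ≤ D) : EV N (∑ i ∈ S, x i) (∑ i ∈ S, x i) ≤ 4 ^ S.card * D := by
  induction S using Finset.induction_on with
  | empty => simpa using hD
  | insert i S hi ih =>
    rw [Finset.sum_insert hi, Finset.card_insert_of_notMem hi, pow_succ]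
    have h1 := ih (fun i h => hx i (Finset.mem_insert_of_mem h)) (fun i h => hb i (Finset.mem_insert_of_mem h))
    have h2 := hb i (Finset.mem_insert_self _ _)
    have h3 := En_add_le (hx i (Finset.mem_insert_self _ _)) ((Sp _).sum_mem fun i h => hx i (Finset.mem_insert_of_mem h))
    have h4 : D ≤ 4 ^ S.card * D := le_mul_of_one_le_left hD (one_le_pow₀ (by norm_num))
    simp only [EV] at *; linarith
def mm (N : ℕ) (t : ℕ → ℝ) (j : ℕ) : ℕ := if j = 0 then N + 1 else max 1 (rad N (t j) / 64)
def sn (N : ℕ) (t : ℕ → ℝ) (j : ℕ) (v : Vtx) : Vtx := (mm N t j * (v.1 / mm N t j), mm N t j * (v.2 / mm N t j))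
theorem mm_pos (N : ℕ) (t : ℕ → ℝ) (j : ℕ) : 1 ≤ mm N t j := by unfold mm; split_ifs <;> omega
theorem mm_log {K : ℕ} {t : ℕ → ℝ} {N : ℕ} (h : Ptn K t) (hR : Rf K t N) {j : ℕ} (hj : j ≤ K) :
    |log (mm N t j) - (1 - t j) * log N| ≤ 10 := by
  have hN : (1:ℝ) ≤ N := by exact_mod_cast hR.1
  have r := abs_le.1 (hR.2.2 j hj)
  have l2 := Real.log_two_lt_d9
  rw [abs_le]
  rcases Nat.eq_zero_or_pos j with rfl | j0
  · have h1 : log N ≤ log (N+1 : ℕ) := log_le_log (by linarith) (by push_cast; linarith)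
    have h2 : log (N+1 : ℕ) ≤ log (2 * N) := log_le_log (by positivity) (by push_cast; linarith)
    rw [log_mul (by norm_num) (by linarith)] at h2
    rw [h.2.1, mm, if_pos rfl]; constructor <;> linarith
  · rcases hj.lt_or_eq with hj | rfl
    · have b := hR.2.1 j hj
      rw [mm, if_neg (by omega), max_eq_right (by omega)]
      set ρ := rad N (t j)
      have p1 : (0:ℝ) < (ρ/64:ℕ) := by exact_mod_cast (by omega : 0 < ρ/64)
      have p2 : (0:ℝ) < ρ := by exact_mod_cast (by omega : 0 < ρ)
      have h1 : log (ρ/64:ℕ) ≤ log ρ := log_le_log p1 (by exact_mod_cast (by omega : ρ/64 ≤ ρ))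
      have h2 : log ρ ≤ log (2^7 * (ρ/64:ℕ)) := log_le_log p2 (by exact_mod_cast (by omega : ρ ≤ 2^7*(ρ/64)))
      rw [log_mul (by norm_num) p1.ne', Real.log_pow] at h2
      push_cast at h2
      constructor <;> linarith
    · rw [mm, if_neg (by omega), rK N h, h.2.2.1]; norm_num
theorem sn_K {K : ℕ} {t : ℕ → ℝ} {N : ℕ} (h : Ptn K t) (v : Vtx) : sn N t K v = v := by
  have : mm N t K = 1 := by rw [mm, if_neg (by have := h.1; omega), rK N h]; norm_num
  simp [sn, this]
theorem sn_nr {t : ℕ → ℝ} {N : ℕ} {j : ℕ} (hj : j ≠ 0) (hK : rad N (t j) ≠ 0) (v : Vtx) :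
    nr (rad N (t j)) (sn N t j v) v := by
  have m1 := mm_pos N t j
  have m2 : 4 * (mm N t j - 1) ≤ rad N (t j) := by unfold mm; rw [if_neg hj]; omega
  set m := mm N t j with hm
  have key : ∀ x : ℤ, 4 * |m * (x / m) - x| ≤ rad N (t j) := fun x => by
    have e := Int.mul_ediv_add_emod x m
    have e1 := Int.emod_nonneg x (b := m) (by omega)
    have e2 := Int.emod_lt_of_pos x (b := m) (by omega)
    have : |m * (x / m) - x| ≤ m - 1 := abs_le.2 ⟨by linarith, by linarith⟩
    omega
  exact ⟨key _, key _⟩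
theorem sn_card {K : ℕ} {t : ℕ → ℝ} {N : ℕ} (h : Ptn K t) (hR : Rf K t N) {n : ℕ} (hn : n < K) (u : Vtx) (C : Finset Vtx)
    (hC : ∀ v ∈ C, sn N t n v = sn N t n u) :
    ((C.image (sn N t (n+1))).card : ℝ) ≤ exp (2 * (t (n+1) - t n) * log N + 44) := by
  have p1 := mm_pos N t n
  have p2 := mm_pos N t (n+1)
  have l1 := abs_le.1 (mm_log h hR hn.le)
  have l2 := abs_le.1 (mm_log h hR hn)
  simp only [sn, Prod.mk.injEq] at hC
  set m := mm N t n
  set m' := mm N t (n+1)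
  have m0 : (0:ℤ) < m := by omega
  have m0' : (0:ℤ) < m' := by omega
  set I : ℤ → Finset ℤ := fun a => Finset.Icc (m * (a / m) / m') (m * (a/m) / m' + (m/m' + 1 : ℕ))
  have mem : ∀ x a : ℤ, m * (x / m) = m * (a/m) → x / m' ∈ I a := by
    intro x a hx
    have e := Int.mul_ediv_add_emod x m
    have e1 := Int.emod_nonneg x m0.ne'
    have e2 := Int.emod_lt_of_pos x m0
    rw [hx] at e
    simp only [I, Finset.mem_Icc]
    refine ⟨Int.ediv_le_ediv m0' (by linarith), ?_⟩
    rw [← Int.lt_add_one_iff, Int.ediv_lt_iff_lt_mul m0']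
    set A := m * (a / m)
    have f := Int.mul_ediv_add_emod A m'
    have f2 := Int.emod_lt_of_pos A m0'
    have g := Int.mul_ediv_add_emod m m'
    have g2 := Int.emod_lt_of_pos (m:ℤ) m0'
    push_cast
    linarith
  have sub : C.image (sn N t (n+1)) ⊆ (I u.1 ×ˢ I u.2).image (fun z : ℤ × ℤ => ((m' * z.1, m' * z.2) : Vtx)) := by
    intro w hw
    obtain ⟨v, hv, rfl⟩ := Finset.mem_image.1 hw
    exact Finset.mem_image.2 ⟨(v.1/m', v.2/m'), Finset.mem_product.2 ⟨mem _ _ (hC v hv).1, mem _ _ (hC v hv).2⟩, rfl⟩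
  have c1 := (Finset.card_le_card sub).trans Finset.card_image_le
  have c2 : ∀ a, (I a).card = m/m' + 2 := fun a => by
    simp only [I, Int.card_Icc]
    generalize m / m' = k
    generalize (m:ℤ) * (a / m) / m' = z
    omega
  rw [Finset.card_product, c2, c2] at c1
  set E := exp ((t (n+1) - t n) * log N + 22)
  have dl : 0 ≤ (t (n+1) - t n) * log N := mul_nonneg (by linarith [h.2.2.2 n hn]) (Real.log_natCast_nonneg N)
  have c3 : ((m/m' + 2 : ℕ):ℝ) ≤ E := by
    have q1 : ((m/m':ℕ):ℝ) ≤ (m:ℝ)/m' := Nat.cast_div_le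
    have pm : (0:ℝ) < m := by exact_mod_cast m0
    have pm' : (0:ℝ) < m' := by exact_mod_cast m0'
    have q2 : (m:ℝ)/m' ≤ exp ((t (n+1) - t n) * log N + 20) := by
      rw [← Real.log_le_iff_le_exp (by positivity), Real.log_div pm.ne' pm'.ne']; linarith
    set y := exp ((t (n+1) - t n) * log N + 20)
    have y1 : 1 ≤ y := Real.one_le_exp (by linarith)
    have e2 : E = y * exp 2 := by simp only [E, y]; rw [← exp_add]; congr 1; ring
    have := add_one_le_exp 2
    push_cast
    nlinarith
  calc ((C.image (sn N t (n+1))).card : ℝ) ≤ ((m/m' + 2 : ℕ):ℝ) * ((m/m' + 2 : ℕ):ℝ) := by exact_mod_cast c1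
    _ ≤ E * E := by gcongr
    _ ≤ _ := by rw [← exp_add, exp_le_exp]; linarith
theorem hd_sn : ∃ C : ℝ, 0 < C ∧ ∀ (K : ℕ) (t c : ℕ → ℝ) (N : ℕ) (B : ℝ), Ptn K t → Rf K t N → 0 ≤ B → (∀ k < K, c k ^ 2 ≤ B) →
    ∀ j, 1 ≤ j → j ≤ K → ∀ u, EV N (hd N t c (range j) (sn N t j u) - hd N t c (range j) u)
      (hd N t c (range j) (sn N t j u) - hd N t c (range j) u) ≤ 4 ^ K * (B * C) := by
  obtain ⟨C, hC, hr⟩ := regR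
  refine ⟨4 * C, by linarith, fun K t c N B h hR hB0 hB j j1 hj u => ?_⟩
  rcases hj.lt_or_eq with hj | rfl
  swap
  · rw [sn_K h, sub_self]; simp only [EV, map_zero]; positivity
  have e : hd N t c (range j) (sn N t j u) - hd N t c (range j) u =
      ∑ k ∈ range j, c k • (ic N t k (sn N t j u) - ic N t k u) := by
    simp only [hd, smul_sub, sum_sub_distrib]
  have key : ∀ i ≤ j, EV N (xi N (sn N t j u) (t i) - xi N u (t i)) (xi N (sn N t j u) (t i) - xi N u (t i)) ≤ C := fun i hi => by
    have r1 := rad_anti hR.1 (h.nn (hi.trans hj.le)) (h.mono hi hj.le) (h.le1 hj.le)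
    have r2 := hR.2.1 j hj
    have n := sn_nr (N := N) (t := t) (j := j) (by omega) (by omega) u
    refine hr N (rad N (t i)) (sn N t j u) (sn N t j u) u u (by omega) ?_
    have a1 := n.1
    have a2 := n.2
    rw [abs_sub_comm] at a1 a2
    simp only [List.mem_cons, List.not_mem_nil, or_false, forall_eq_or_imp, forall_eq, sub_self, abs_zero]
    omega
  rw [e]
  refine (En_sum _ _ (D := B * (4 * C)) (fun k hk => ?_) (by positivity) (fun k hk => ?_)).trans ?_
  · have hk' : k < K := (mem_range.1 hk).trans hj
    exact (Sp _).smul_mem _ ((Sp _).sub_mem (ic_V h hR.1 hk' _) (ic_V h hR.1 hk' _))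
  · have hk' := mem_range.1 hk
    have e2 : ic N t k (sn N t j u) - ic N t k u = (xi N (sn N t j u) (t (k+1)) - xi N u (t (k+1))) - (xi N (sn N t j u) (t k) - xi N u (t k)) := by
      unfold ic; abel
    have hs : ∀ i, xi N (sn N t j u) (t i) - xi N u (t i) ∈ Sp (Vi N) := fun i => (Sp _).sub_mem (xi_Sp _ _ _) (xi_Sp _ _ _)
    have a := En_sub_le (hs (k+1)) (hs k)
    rw [← e2] at a
    have b := key k hk'.le
    have d := key (k+1) hk'
    have f := En_nonneg ((Sp (Vi N)).sub_mem (ic_V h hR.1 (hk'.trans hj) (sn N t j u)) (ic_V h hR.1 (hk'.trans hj) u))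
    simp only [EV, map_smul, LinearMap.smul_apply, smul_eq_mul] at *
    rw [← mul_assoc, ← sq]
    exact mul_le_mul (hB k (hk'.trans hj)) (by linarith) f hB0
  · rw [Finset.card_range]
    exact mul_le_mul_of_nonneg_right (pow_le_pow_right₀ (by norm_num) hj.le) (by positivity)
theorem abel {V : Type*} [AddCommGroup V] [Module ℝ V] (p : ℕ → ℝ) (A : ℕ → V) (A0 : A 0 = 0) (n : ℕ) :
    ∑ j ∈ range n, (p j - p (j+1)) • A (j+1) + p n • A (n+1) = ∑ j ∈ range (n+1), p j • (A (j+1) - A j) := by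
  induction n with
  | zero => simp [A0]
  | succ n ih => rw [sum_range_succ _ (n+1), ← ih, sum_range_succ]; module
theorem UB {K : ℕ} {t c p : ℕ → ℝ} (h : Ptn K t) (p0 : ∀ k, 0 < p k) (p1 : ∀ k, p k ≤ 1) (pm : Monotone p) {η : ℝ} (hη : 0 < η) :
    ∀ᶠ N in atTop, ∀ P, IsGFF N P → ∫⁻ ω, (∑ v ∈ VN N, oe (X N (hd N t c (range K) v) ω)) ^ p 0 ∂P ≤
      oe ((p 0 * ∑ k ∈ range K, (2 + p k ^ 2 * c k ^ 2 / 2) * (t (k+1) - t k) / p k + η) * log N) := by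
  obtain ⟨C1, hC1, hb⟩ := hd_bd
  obtain ⟨C2, hC2, hs⟩ := hd_sn
  set B := ∑ k ∈ range K, c k ^ 2 with hBd
  have hB0 : 0 ≤ B := sum_nonneg fun _ _ => sq_nonneg _
  have hB : ∀ k < K, c k ^ 2 ≤ B := fun k hk => single_le_sum (f := fun k => c k ^ 2) (fun _ _ => sq_nonneg _) (mem_range.2 hk)
  set S := p 0 * ∑ k ∈ range K, p k * c k ^ 2 * (t (k+1) - t k) / 2 with hS
  have hS0 : 0 ≤ S := mul_nonneg (p0 0).le (sum_nonneg fun k hk => by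
    have := h.2.2.2 k (mem_range.1 hk)
    have := mul_nonneg (mul_nonneg (p0 k).le (sq_nonneg (c k))) (sub_nonneg.2 this.le)
    linarith)
  set s := η / (2 * (S + 1)) with hsd
  have s0 : 0 < s := by positivity
  set W := (1 + s) * (C1 * B * K) + (1 + s⁻¹) * (4 ^ K * (4 ^ K * (B * C2))) with hW
  have W0 : 0 ≤ W := by positivity
  set T := p 0 * ∑ k ∈ range K, (44 + W / 2) / p k with hT
  filter_upwards [Rf_ev h, logN_ev (T / (η/2)), logN_ev 0] with N hR hL hL0 P hP
  set L := log N
  set q : ℕ → ℝ := fun j => p (min (j-1) (K-1)) with hq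
  set a : ℕ → Vtx → Vtx → ℝ := fun j w => hd N t c (range (min j K)) w with ha
  set pc : ℕ → ℝ := fun k => p k * c k
  set U : ℕ → ℝ := fun j => if j = 0 then 0 else (1 + s) * (Vs t pc (range j) * L) + W with hU
  have qq : ∀ j < K, q (j+1) = p j := fun j hj => by simp only [hq]; congr 1; omega
  have sub : ∀ j, range (min j K) ⊆ range K := fun j => Finset.range_subset_range.2 (min_le_right _ _)
  have aV : ∀ j w, a j w ∈ Sp (Vi N) := fun j w => hd_V h hR.1 c (sub j) w
  have main := ubrec hP h.1 q (sn N t) a (fun j => 2 * (t j - t (j-1)) * L + 44) U (fun j => p0 _) (fun j => p1 _)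
    (fun j => pm (by omega)) (by simp only [hq]; congr 1; omega) (sn_K h) aV ?_ ?_ K 0 (by omega) (0,0) (by simp [mem_VN]) (VN N) subset_rfl ?_
  · refine (le_of_eq ?_).trans (main.trans (oe_le.2 ?_))
    · refine lintegral_congr fun ω => ?_
      rw [qq 0 h.1]
      simp [gg, ha, X, oe_zero]
    · rw [qq 0 h.1]
      have e : ∑ j ∈ Finset.Ioc 0 K, (2 * (t j - t (j-1)) * L + 44 + (U j - U (j-1)) / 2) / q j =
          ∑ k ∈ range K, (2 * (t (k+1) - t k) * L + 44 + (U (k+1) - U k) / 2) / p k := by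
        rw [Finset.range_eq_Ico, Finset.sum_Ico_eq_sum_range, show Finset.Ioc 0 K = Ico (0+1) (K+1) by ext; simp; omega, ← Finset.sum_Ico_add' _ 0 K 1, Finset.sum_Ico_eq_sum_range]
        refine sum_congr rfl fun k hk => ?_
        rw [mem_range] at hk
        rw [qq _ (by omega)]; rfl
      rw [e]
      have f : ∀ k ∈ range K, (2 * (t (k+1) - t k) * L + 44 + (U (k+1) - U k) / 2) / p k ≤
          (2 + p k ^ 2 * c k ^ 2 / 2) * (t (k+1) - t k) / p k * L + s * L * (p k * c k ^ 2 * (t (k+1) - t k) / 2) + (44 + W / 2) / p k := by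
        intro k hk
        have := p0 k
        have uu : U (k+1) - U k ≤ (1 + s) * (p k ^ 2 * c k ^ 2 * (t (k+1) - t k) * L) + W := by
          simp only [hU, Nat.succ_ne_zero, if_false, Vs, sum_range_succ, pc]
          split_ifs with k0
          · subst k0; simp; nlinarith
          · linarith
        have e3 : (2 + p k ^ 2 * c k ^ 2 / 2) * (t (k+1) - t k) / p k * L + s * L * (p k * c k ^ 2 * (t (k+1) - t k) / 2) + (44 + W / 2) / p k =
          (2 * (t (k+1) - t k) * L + 44 + ((1 + s) * (p k ^ 2 * c k ^ 2 * (t (k+1) - t k) * L) + W) / 2) / p k := by field_simp; ring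
        rw [e3]
        exact div_le_div_of_nonneg_right (by linarith) this.le
      have g := mul_le_mul_of_nonneg_left (sum_le_sum f) (p0 0).le
      rw [sum_add_distrib, sum_add_distrib, ← Finset.sum_mul, ← mul_sum] at g
      have i1 : T ≤ η / 2 * L := by rwa [div_le_iff₀' (by positivity)] at hL
      have i2 : s * S ≤ η / 2 := by
        rw [hsd, div_mul_eq_mul_div, div_le_iff₀ (by positivity)]; nlinarith
      have i3 := mul_le_mul_of_nonneg_right i2 hL0
      simp only [hU, if_true]
      have : p 0 * (∑ k ∈ range K, (2 + p k ^ 2 * c k ^ 2 / 2) * (t (k+1) - t k) / p k * L + s * L * ∑ k ∈ range K, p k * c k ^ 2 * (t (k+1) - t k) / 2 + ∑ k ∈ range K, (44 + W / 2) / p k)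
        = p 0 * (∑ k ∈ range K, (2 + p k ^ 2 * c k ^ 2 / 2) * (t (k+1) - t k) / p k) * L + s * S * L + T := by rw [hS, hT, ← Finset.sum_mul]; ring
      simp only [← Finset.sum_mul] at g this
      linarith
  · intro n hn u hu
    set δ : ℕ → Vtx → ℝ := fun j => hd N t c (range (j+1)) (sn N t (j+1) u) - hd N t c (range (j+1)) u with hδ
    set e : ℕ → ℝ := fun j => if j < n then p j - p (j+1) else p j with he
    have dV : ∀ j < K, δ j ∈ Sp (Vi N) := fun j hj => (Sp _).sub_mem (hd_V h hR.1 c (Finset.range_subset_range.2 hj) _) (hd_V h hR.1 c (Finset.range_subset_range.2 hj) _)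
    have split : gg q (sn N t) a n u + q (n+1) • a (n+1) (sn N t (n+1) u) =
        hd N t pc (range (n+1)) u + ∑ j ∈ range (n+1), e j • δ j := by
      have a1 : hd N t pc (range (n+1)) u = ∑ j ∈ range n, (p j - p (j+1)) • hd N t c (range (j+1)) u + p n • hd N t c (range (n+1)) u := by
        rw [abel p (fun j => hd N t c (range j) u) (by simp [hd]) n]
        refine sum_congr rfl fun j _ => ?_
        simp only [hd, sum_range_succ, add_sub_cancel_left, smul_smul, pc]
      have a2 : gg q (sn N t) a n u = ∑ j ∈ range n, (p j - p (j+1)) • hd N t c (range (j+1)) (sn N t (j+1) u) :=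
        sum_congr rfl fun j hj => by
          rw [mem_range] at hj
          rw [qq j (by omega), qq (j+1) (by omega)]
          simp only [ha, min_eq_left (show j + 1 ≤ K by omega)]
      rw [a1, a2, qq n hn, sum_range_succ, add_add_add_comm, ← sum_add_distrib]
      congr 1
      · refine sum_congr rfl fun j hj => ?_
        simp only [he, if_pos (mem_range.1 hj), hδ]; module
      · simp only [he, lt_irrefl, if_false, hδ, ha, min_eq_left (show n + 1 ≤ K by omega)]; module
    have E1 : EV N (∑ j ∈ range (n+1), e j • δ j) (∑ j ∈ range (n+1), e j • δ j) ≤ 4 ^ K * (4 ^ K * (B * C2)) := by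
      refine (En_sum _ _ (D := 4 ^ K * (B * C2)) (fun j hj => (Sp _).smul_mem _ (dV j (by rw [mem_range] at hj; omega))) (by positivity) fun j hj => ?_).trans ?_
      · rw [mem_range] at hj
        have i1 := hs K t c N B h hR hB0 hB (j+1) (by omega) (by omega) u
        have i2 : e j ^ 2 ≤ 1 := by
          have := p0 j; have := p1 j; have := p0 (j+1); have := p1 (j+1)
          rw [sq_le_one_iff_abs_le_one, abs_le]
          simp only [he]; split_ifs <;> constructor <;> linarith
        have i3 := En_nonneg (dV j (by omega))
        simp only [EV, map_smul, LinearMap.smul_apply, smul_eq_mul] at *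
        rw [← mul_assoc, ← sq]
        nlinarith
      · rw [Finset.card_range]
        exact mul_le_mul_of_nonneg_right (pow_le_pow_right₀ (by norm_num) hn) (by positivity)
    have E2 := (hb K t pc N B h hR (fun k hk => by
      simp only [pc, mul_pow]
      have := pow_le_one₀ (p0 k).le (p1 k) (n := 2)
      nlinarith [hB k hk, sq_nonneg (c k)]) (range (n+1)) (Finset.range_subset_range.2 hn) u).1
    have E3 : C1 * B * (range (n+1)).card ≤ C1 * B * K := by
      rw [Finset.card_range]; gcongr; exact hn
    rw [split]
    refine (En_ka (hd_V h hR.1 _ (Finset.range_subset_range.2 hn) u) ((Sp _).sum_mem fun j hj => (Sp _).smul_mem _ (dV j (by rw [mem_range] at hj; omega))) s0).trans ?_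
    simp only [hU, Nat.succ_ne_zero, if_false, hW]
    have F1 := mul_le_mul_of_nonneg_left (E2.trans (add_le_add_right E3 _)) (by linarith : 0 ≤ 1 + s)
    have F2 := mul_le_mul_of_nonneg_left E1 (by positivity : 0 ≤ 1 + s⁻¹)
    simp only [EV] at F1 F2
    linarith
  · intro n hn u hu C hC hv
    exact sn_card h hR hn u C fun v hv' => hv v hv' n le_rfl
  · intro v hv j hj
    obtain rfl : j = 0 := by omega
    rw [mem_VN] at hv
    have z : ∀ x : ℤ, 0 ≤ x → x ≤ N → x / ((N+1 : ℕ) : ℤ) = 0 := fun x h1 h2 => Int.ediv_eq_zero_of_lt h1 (by push_cast; omega)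
    simp only [sn, mm, if_true]
    rw [z v.1 (by omega) (by omega), z v.2 (by omega) (by omega)]
    simp
theorem lse_conv {ι : Type*} {A : Finset ι} (hA : A.Nonempty) (x y : ι → ℝ) {w w' : ℝ} (h0 : 0 ≤ w) (h1 : 0 ≤ w') (h2 : w + w' = 1) :
    lse A (fun v => w * x v + w' * y v) ≤ w * lse A x + w' * lse A y := by
  have n : ∀ z : ι → ℝ, ∑ v ∈ A, exp (z v - lse A z) = 1 := fun z => by
    simp only [exp_sub, ← Finset.sum_div, exp_lse hA]; exact div_self (se_pos hA z).ne'
  have k : ∑ v ∈ A, exp (w * (x v - lse A x) + w' * (y v - lse A y)) ≤ 1 := by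
    calc _ ≤ ∑ v ∈ A, (w * exp (x v - lse A x) + w' * exp (y v - lse A y)) :=
          sum_le_sum fun v _ => convexOn_exp.2 (Set.mem_univ _) (Set.mem_univ _) h0 h1 h2
      _ = 1 := by rw [sum_add_distrib, ← mul_sum, ← mul_sum, n, n]; linarith
  rw [← exp_le_exp, exp_lse hA]
  calc _ = exp (w * lse A x + w' * lse A y) * ∑ v ∈ A, exp (w * (x v - lse A x) + w' * (y v - lse A y)) := by
        rw [mul_sum]; refine sum_congr rfl fun v _ => ?_; rw [← exp_add]; congr 1; ring
    _ ≤ _ := mul_le_of_le_one_right (exp_pos _).le k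
theorem annl {N : ℕ} {P : Measure FieldSp} (h : IsGFF N P) (hN : 1 ≤ N) {A : Finset Vtx} (hA : A.Nonempty) (hAV : A ⊆ VN N) (g : Vtx → Vtx → ℝ)
    (hg : ∀ v, g v ∈ Sp (Vi N)) {D : ℝ} (hD : ∀ v, EV N (g v) (g v) ≤ D) :
    ∫ ω, lse A (fun v => X N (g v) ω) ∂P ≤ 2 * log N + 2 + D / 2 := by
  have := h.1
  obtain ⟨i1, i2⟩ := lse_X h hA g hg
  have i3 := i2 1
  simp only [one_mul] at i3
  have j := jensen_exp i1 i3
  rw [← exp_le_exp]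
  refine j.trans ?_
  simp only [exp_lse hA]
  have e : ∀ v, Integrable (fun ω => exp (X N (g v) ω)) P ∧ ∫ ω, exp (X N (g v) ω) ∂P = exp (EV N (g v) (g v) / 2) := fun v => by
    simpa using X_int h (hg v) 1
  rw [integral_finset_sum _ fun v _ => (e v).1]
  calc ∑ v ∈ A, ∫ ω, exp (X N (g v) ω) ∂P ≤ A.card • exp (D / 2) :=
        Finset.sum_le_card_nsmul _ _ _ fun v _ => by rw [(e v).2, exp_le_exp]; linarith [hD v]
    _ ≤ _ := by
      rw [nsmul_eq_mul, exp_add]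
      exact mul_le_mul_of_nonneg_right ((Nat.cast_le.2 (Finset.card_le_card hAV)).trans (VN_card hN)) (exp_pos _).le
theorem hd_lin (N : ℕ) (t c c' : ℕ → ℝ) (w w' : ℝ) (S : Finset ℕ) (v : Vtx) (ω : FieldSp) :
    X N (hd N t (fun k => w * c k + w' * c' k) S v) ω = w * X N (hd N t c S v) ω + w' * X N (hd N t c' S v) ω := by
  rw [show hd N t (fun k => w * c k + w' * c' k) S v = w • hd N t c S v + w' • hd N t c' S v by
    simp only [hd, Finset.smul_sum, ← sum_add_distrib, smul_smul, add_smul]]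
  simp [X]
theorem LB2 {β S η : ℝ} (hβ : 0 < β) (hS : 0 ≤ S) (hη : 0 < η) : ∃ δ > 0, ∀ (K : ℕ) (t σ θ : ℕ → ℝ), Ptn K t → (∀ k < K, t (k+1) - t k ≤ δ) →
    (∀ k < K, 0 ≤ θ k ∧ θ k ≤ β ∧ σ k ^ 2 ≤ S) → (∀ n ≤ K, Vs t (fun k => θ k * σ k) (range n) ≤ 4 * t n) → ∀ᶠ N in atTop, ∀ P, IsGFF N P →
    (2 + Vs t (fun k => θ k * σ k) (range K) / 2 + (∑ k ∈ range K, (β - θ k) * θ k * σ k ^ 2 * (t (k+1) - t k)) - η) * log N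
      ≤ ∫ ω, lse (bulk N) (fun v => X N (hd N t (fun k => β * σ k) (range K) v) ω) ∂P := by
  set u := min 1 (η / (2 * (β^2 * S + 1))) with hu
  have u0 : 0 < u := lt_min one_pos (by positivity)
  have u1 : u ≤ 1 := min_le_left _ _
  have u2 : u * (β^2 * S) ≤ η / 2 := by
    have : u ≤ η / (2 * (β^2 * S + 1)) := min_le_right _ _
    rw [le_div_iff₀ (by positivity)] at this
    nlinarith
  obtain ⟨δ, δ0, hL⟩ := LB (B := β^2 * S) (ε := η * u / 8) (by positivity) (by positivity)
  obtain ⟨C1, hC1, hb⟩ := hd_bd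
  refine ⟨δ, δ0, fun K t σ θ h hm hp hV => ?_⟩
  have hB : ∀ k < K, (θ k * σ k)^2 ≤ β^2 * S := fun k hk => by
    obtain ⟨a, b, c⟩ := hp k hk
    rw [mul_pow]; exact mul_le_mul (pow_le_pow_left₀ a b 2) c (sq_nonneg _) (by positivity)
  set B' := 4 * (β^2 * S) with hB'
  set cm : ℕ → ℝ := fun k => (θ k - u * (β - θ k)) * σ k with hcm
  have hBm : ∀ k < K, cm k ^ 2 ≤ B' := fun k hk => by
    obtain ⟨a, b, c⟩ := hp k hk
    have : (θ k - u * (β - θ k))^2 ≤ 4 * β^2 := by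
      rw [show 4 * β^2 = (2*β)^2 by ring]; apply sq_le_sq'  <;> nlinarith
    simp only [hcm]
    rw [mul_pow, hB', ← mul_assoc]; exact mul_le_mul this c (sq_nonneg _) (by positivity)
  filter_upwards [hL K t _ h hm hB hV, Rf_ev h, eventually_ge_atTop 8, logN_ev ((2 + C1 * B' * K / 2) / (η * u / 8)), logN_ev 0] with N l0 hR hN hL hL0 P hP
  have hA : (bulk N).Nonempty := Finset.card_pos.1 (by
    have := (exp_pos _).trans_le (bulk_card hN); exact_mod_cast this)
  set L := log N
  have hd1 : ∀ c v, hd N t c (range K) v ∈ Sp (Vi N) := fun c v => hd_V h hR.1 c subset_rfl v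
  have l1 := l0 P hP
  have l2 := annl hP hR.1 hA (Finset.filter_subset _ _) (fun v => hd N t cm (range K) v) (hd1 cm)
    (fun v => (hb K t cm N B' h hR hBm _ subset_rfl v).1)
  have cv : ∫ ω, lse (bulk N) (fun v => X N (hd N t (fun k => θ k * σ k) (range K) v) ω) ∂P ≤
      u / (1+u) * ∫ ω, lse (bulk N) (fun v => X N (hd N t (fun k => β * σ k) (range K) v) ω) ∂P +
      1 / (1+u) * ∫ ω, lse (bulk N) (fun v => X N (hd N t cm (range K) v) ω) ∂P := by
    rw [← integral_const_mul, ← integral_const_mul, ← integral_add ((lse_X hP hA _ (hd1 _)).1.const_mul _) ((lse_X hP hA _ (hd1 _)).1.const_mul _)]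
    refine integral_mono (lse_X hP hA _ (hd1 _)).1 (((lse_X hP hA _ (hd1 _)).1.const_mul _).add ((lse_X hP hA _ (hd1 _)).1.const_mul _)) fun ω => ?_
    refine le_trans (le_of_eq ?_) (lse_conv hA _ _ (by positivity) (by positivity) (by field_simp; ring))
    congr 1; ext v
    rw [← hd_lin]
    congr 2; ext k; simp only [hcm]; field_simp; ring
  set ℓ1 := ∫ ω, lse (bulk N) (fun v => X N (hd N t (fun k => β * σ k) (range K) v) ω) ∂P
  set ℓ0 := ∫ ω, lse (bulk N) (fun v => X N (hd N t (fun k => θ k * σ k) (range K) v) ω) ∂P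
  set ℓm := ∫ ω, lse (bulk N) (fun v => X N (hd N t cm (range K) v) ω) ∂P
  have cv' : (1 + u) * ℓ0 ≤ u * ℓ1 + ℓm := by
    have := mul_le_mul_of_nonneg_left cv (by positivity : 0 ≤ 1 + u)
    field_simp at this; linarith
  set V0 := Vs t (fun k => θ k * σ k) (range K) with hV0
  set D := ∑ k ∈ range K, (β - θ k) * θ k * σ k ^ 2 * (t (k+1) - t k) with hD
  have vm : Vs t cm (range K) ≤ V0 - 2 * u * D + u^2 * (β^2 * S) := by
    have s1 : u^2 * (β^2 * S) = ∑ k ∈ range K, u^2 * (β^2 * S) * (t (k+1) - t k) := by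
      rw [← mul_sum, Finset.sum_range_sub, h.2.1, h.2.2.1]; ring
    rw [s1, hV0, hD, mul_sum, Vs, Vs, ← sum_sub_distrib, ← sum_add_distrib]
    refine sum_le_sum fun k hk => ?_
    rw [mem_range] at hk
    obtain ⟨a, b, c⟩ := hp k hk
    have : (β - θ k)^2 * σ k^2 ≤ β^2 * S := mul_le_mul (pow_le_pow_left₀ (by linarith) (by linarith) 2) c (sq_nonneg _) (by positivity)
    have := mul_le_mul_of_nonneg_left this (mul_nonneg (sq_nonneg u) (sub_nonneg.2 (h.2.2.2 k hk).le))
    simp only [hcm]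
    linarith
  rw [div_le_iff₀ (by positivity)] at hL
  rw [Finset.card_range] at l2
  have f1 := mul_le_mul_of_nonneg_left l1 (by positivity : 0 ≤ 1 + u)
  have f2 := mul_le_mul_of_nonneg_right vm hL0
  have f3 := mul_le_mul_of_nonneg_left u2 (mul_nonneg u0.le hL0)
  have f4 : u * (η * u / 8 * L) ≤ η * u / 8 * L := mul_le_of_le_one_left (by positivity) u1
  have f5 : 0 ≤ η * u / 8 * L := by positivity
  refine le_of_mul_le_mul_left ?_ u0
  linarith
theorem UBr {K : ℕ} {t c p : ℕ → ℝ} (h : Ptn K t) (p0 : ∀ k, 0 < p k) (p1 : ∀ k, p k ≤ 1) (pm : Monotone p) {η : ℝ} (hη : 0 < η) :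
    ∀ᶠ N in atTop, ∀ P, IsGFF N P → ∀ A ⊆ VN N, A.Nonempty → ∫ ω, exp (p 0 * lse A fun v => X N (hd N t c (range K) v) ω) ∂P ≤
      exp ((p 0 * ∑ k ∈ range K, (2 + p k ^ 2 * c k ^ 2 / 2) * (t (k+1) - t k) / p k + η) * log N) := by
  filter_upwards [UB h p0 p1 pm hη (c := c), eventually_ge_atTop 1] with N hU hN P hP A hA hAn
  have i := (lse_X hP hAn (fun v => hd N t c (range K) v) (fun v => hd_V h hN c subset_rfl v)).2 (p 0)
  rw [← ENNReal.ofReal_le_ofReal_iff (exp_pos _).le, ofReal_integral_eq_lintegral_ofReal i (Eventually.of_forall fun _ => (exp_pos _).le)]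
  refine le_trans (lintegral_mono fun ω => ?_) (hU P hP)
  change oe _ ≤ _
  rw [← oe_rpow, ← sum_oe hAn]
  exact ENNReal.rpow_le_rpow (Finset.sum_le_sum_of_subset hA) (p0 0).le
theorem exp_add_pow {a b q F : ℝ} (q0 : 0 < q) (q1 : q ≤ 1) (h : exp F ≤ exp a + exp b) :
    exp (q * F) ≤ exp (q * a) + exp (q * b) := by
  have e : ∀ x, exp (q * x) = (exp x) ^ q := fun x => by rw [← Real.exp_mul, mul_comm]
  rw [e, e, e]
  exact (Real.rpow_le_rpow (exp_pos _).le h q0.le).trans (Real.rpow_add_le_add_rpow (exp_pos _).le (exp_pos _).le q0.le q1)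
def gav (A : Finset Vtx) (a f : Vtx → ℝ) : ℝ := ∑ v ∈ A, exp (a v) / (∑ u ∈ A, exp (a u)) * f v
theorem gav_int {N : ℕ} {P : Measure FieldSp} {A : Finset Vtx} (a f : Vtx → FieldSp → ℝ) (ha : ∀ v, Measurable (a v))
    (hf : ∀ v, Integrable (f v) P) : Integrable (fun ω => gav A (fun v => a v ω) (fun v => f v ω)) P := by
  refine integrable_finset_sum _ fun v hv => ?_
  have m : ∀ v, Measurable fun ω => exp (a v ω) := fun v => measurable_exp.comp (ha v)
  refine (hf v).bdd_mul (c := 1) ((m v).div (Finset.measurable_fun_sum _ fun v _ => m v)).aestronglyMeasurable (Eventually.of_forall fun ω => ?_)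
  have p := se_pos ⟨v, hv⟩ (fun v => a v ω)
  rw [Real.norm_of_nonneg (by positivity), div_le_one p]
  exact single_le_sum (f := fun v => exp (a v ω)) (fun _ _ => (exp_pos _).le) hv
theorem core_alg (β u σ θ δ i : ℝ) (hβ : 0 < β) (hθ : 0 < θ) : (2 + (θ/β)^2 * ((β + u * i) * σ)^2 / 2) * δ / (θ/β) =
    2 * δ + (θ * σ)^2 * δ / 2 + (β - θ) * θ * σ^2 * δ - (β - θ) * (θ * σ^2 - 4/θ) * δ / 2 + u * (i * θ * σ^2 * δ) + u^2 / 2 * (i^2 * θ / β * σ^2 * δ) := by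
  field_simp; ring
theorem CORE {β S ε : ℝ} (hβ : 0 < β) (hS : 0 ≤ S) (hε : 0 < ε) : ∃ δ > 0, ∀ (K : ℕ) (t σ θ : ℕ → ℝ) (I : Finset ℕ), Ptn K t → I ⊆ range K →
    (∀ k < K, t (k+1) - t k ≤ δ) → (∀ k, 0 < θ k ∧ θ k ≤ β) → Monotone θ → (∀ k < K, σ k ^ 2 ≤ S) →
    (∀ n ≤ K, Vs t (fun k => θ k * σ k) (range n) ≤ 4 * t n) →
    ∑ k ∈ range K, (β - θ k) * (θ k * σ k ^ 2 - 4 / θ k) * (t (k+1) - t k) = 0 → ∀ᶠ N in atTop, ∀ P, IsGFF N P → ∀ A, bulk N ⊆ A → A ⊆ VN N →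
    ∫ ω, gav A (fun v => X N (hd N t (fun k => β * σ k) (range K) v) ω)
      (fun v => |X N (hd N t σ I v) ω - (∑ k ∈ I, θ k * σ k ^ 2 * (t (k+1) - t k)) * log N|) ∂P ≤ ε * log N := by
  set u := ε / (S + 4) with hu
  have u0 : 0 < u := by positivity
  obtain ⟨d, d0, hL⟩ := LB2 (η := u^2) hβ hS (by positivity)
  refine ⟨d, d0, fun K t σ θ I h hI hm hθ θm hσ h2 h3 => ?_⟩
  set p : ℕ → ℝ := fun k => θ k / β with hp
  have p0 : ∀ k, 0 < p k := fun k => div_pos (hθ k).1 hβ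
  have p1 : ∀ k, p k ≤ 1 := fun k => (div_le_one hβ).2 (hθ k).2
  have pm : Monotone p := fun i j hij => div_le_div_of_nonneg_right (θm hij) hβ.le
  set ii : ℕ → ℝ := fun k => if k ∈ I then 1 else 0 with hii
  set c : ℝ → ℕ → ℝ := fun s k => (β + s * ii k) * σ k with hc
  set x := ∑ k ∈ I, θ k * σ k ^ 2 * (t (k+1) - t k) with hx
  set Φ := 2 + Vs t (fun k => θ k * σ k) (range K) / 2 + (∑ k ∈ range K, (β - θ k) * θ k * σ k ^ 2 * (t (k+1) - t k)) with hΦ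
  have q0 := p0 0
  have hPs : ∀ s : ℝ, ∑ k ∈ range K, (2 + p k ^ 2 * c s k ^ 2 / 2) * (t (k+1) - t k) / p k ≤ Φ + s * x + s^2 / 2 * S := by
    intro s
    have s1 : s^2 / 2 * S = ∑ k ∈ range K, s^2 / 2 * (S * (t (k+1) - t k)) := by
      rw [← mul_sum, ← mul_sum, Finset.sum_range_sub, h.2.1, h.2.2.1]; ring
    have s2 : (2:ℝ) = ∑ k ∈ range K, 2 * (t (k+1) - t k) := by
      rw [← mul_sum, Finset.sum_range_sub, h.2.1, h.2.2.1]; ring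
    have s3 : x = ∑ k ∈ range K, ii k * θ k * σ k ^ 2 * (t (k+1) - t k) := by
      simp only [hx, hii, ite_mul, one_mul, zero_mul, ← Finset.sum_filter]
      rw [Finset.filter_mem_eq_inter, Finset.inter_eq_right.2 hI]
    have s4 : Vs t (fun k => θ k * σ k) (range K) / 2 = ∑ k ∈ range K, (θ k * σ k)^2 * (t (k+1) - t k) / 2 := by rw [Vs, Finset.sum_div]
    have s5 := congrArg (fun z => z / 2) h3
    simp only [zero_div, Finset.sum_div] at s5
    calc _ ≤ ∑ k ∈ range K, (2 * (t (k+1) - t k) + (θ k * σ k)^2 * (t (k+1) - t k) / 2 + (β - θ k) * θ k * σ k ^ 2 * (t (k+1) - t k)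
          - (β - θ k) * (θ k * σ k ^ 2 - 4 / θ k) * (t (k+1) - t k) / 2 + s * (ii k * θ k * σ k ^ 2 * (t (k+1) - t k)) + s^2 / 2 * (S * (t (k+1) - t k))) := by
          refine sum_le_sum fun k hk => ?_
          rw [mem_range] at hk
          simp only [hp, hc]
          rw [core_alg β s (σ k) (θ k) _ (ii k) hβ (hθ k).1]
          gcongr
          · have := h.2.2.2 k hk; linarith
          · have a : ii k ^ 2 * θ k / β ≤ 1 := by
              simp only [hii]; split_ifs
              · simpa using p1 k
              · simp
            calc _ ≤ 1 * σ k ^ 2 := by gcongr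
              _ ≤ S := by linarith [hσ k hk]
      _ = Φ + s * x + s^2 / 2 * S := by
        have s6 := congrArg (fun z => s * z) s3
        simp only [mul_sum] at s6
        rw [sum_add_distrib, sum_add_distrib, sum_sub_distrib, sum_add_distrib, sum_add_distrib, s5, ← s6, ← s1, ← s4, ← s2, hΦ]; ring
  filter_upwards [hL K t σ θ h hm (fun k hk => ⟨(hθ k).1.le, (hθ k).2, hσ k hk⟩) h2, UBr h p0 p1 pm (c := c u) (η := p 0 * u^2 / 2) (by positivity),
    UBr h p0 p1 pm (c := c (-u)) (η := p 0 * u^2 / 2) (by positivity), logN_ev (1 / (p 0 * u^2 / 2)), eventually_ge_atTop 8] with N l1 U1 U2 hL hN P hP A hA hAV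
  have := hP.1
  have hbn : (bulk N).Nonempty := Finset.card_pos.1 (by
    have := (exp_pos _).trans_le (bulk_card hN); exact_mod_cast this)
  have hAn : A.Nonempty := hbn.mono hA
  set L := log N
  have L0 : 0 ≤ L := le_trans (by positivity) hL
  set a : Vtx → FieldSp → ℝ := fun v ω => X N (hd N t (fun k => β * σ k) (range K) v) ω with ha
  set y : Vtx → FieldSp → ℝ := fun v ω => X N (hd N t σ I v) ω - x * L with hy
  have hV : ∀ c v, hd N t c (range K) v ∈ Sp (Vi N) := fun c v => hd_V h (by omega) c subset_rfl v
  have yi : ∀ v, Integrable (fun ω => |y v ω|) P := fun v =>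
    (((X_mem hP (hd_V h (by omega) σ hI v)).integrable (by norm_num)).sub (integrable_const _)).abs
  have gi : Integrable (fun ω => gav A (fun v => a v ω) (fun v => |y v ω|)) P := gav_int (N := N) a _ (fun v => X_meas _ _) yi
  have ai := (lse_X hP hAn _ (hV (fun k => β * σ k))).1
  set F : FieldSp → ℝ := fun ω => u * gav A (fun v => a v ω) (fun v => |y v ω|) + lse A (fun v => a v ω) with hF
  have Fi : Integrable F P := (gi.const_mul u).add ai
  have cs : ∀ s v ω, X N (hd N t (c s) (range K) v) ω = a v ω + s * (y v ω + x * L) := fun s v ω => by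
    have : hd N t σ I v = hd N t (fun k => ii k * σ k) (range K) v := by
      simp only [hd, hii, ite_mul, one_mul, zero_mul, ite_smul, zero_smul, ← Finset.sum_filter]
      rw [Finset.filter_mem_eq_inter, Finset.inter_eq_right.2 hI]
    simp only [ha, hy, this]
    have := hd_lin N t (fun k => β * σ k) (fun k => ii k * σ k) 1 s (range K) v ω
    rw [sub_add_cancel, ← one_mul (X N (hd N t (fun k => β * σ k) _ _) ω), ← this]
    congr 2; ext k; simp only [hc]; ring
  have key : ∀ ω, exp (F ω) ≤ exp (lse A (fun v => X N (hd N t (c u) (range K) v) ω) - u * x * L) +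
      exp (lse A (fun v => X N (hd N t (c (-u)) (range K) v) ω) + u * x * L) := fun ω => by
    have s1 := lse_sub hAn (fun v => a v ω) (fun v => a v ω + u * |y v ω|)
    have s2 : ∑ v ∈ A, exp (a v ω) / (∑ u ∈ A, exp (a u ω)) * (a v ω - (a v ω + u * |y v ω|)) = - (u * gav A (fun v => a v ω) (fun v => |y v ω|)) := by
      rw [gav, mul_sum, ← Finset.sum_neg_distrib]; exact sum_congr rfl fun v _ => by ring
    rw [s2] at s1
    have s3 : F ω ≤ lse A (fun v => a v ω + u * |y v ω|) := by simp only [hF]; linarith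
    refine (exp_le_exp.2 s3).trans ?_
    rw [exp_lse hAn, exp_sub, exp_add, exp_lse hAn, exp_lse hAn, Finset.sum_div, Finset.sum_mul, ← sum_add_distrib]
    refine sum_le_sum fun v _ => ?_
    rw [← exp_sub, ← exp_add, cs, cs]
    rcases abs_cases (y v ω) with ⟨h, -⟩ | ⟨h, -⟩
    · refine le_add_of_le_of_nonneg (exp_le_exp.2 ?_) (exp_pos _).le
      rw [h]; linarith
    · refine le_add_of_nonneg_of_le (exp_pos _).le (exp_le_exp.2 ?_)
      rw [h]; linarith
  have key2 := fun ω => exp_add_pow q0 (p1 0) (key ω)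
  have e1 := fun (s z : ℝ) => ((lse_X hP hAn _ (hV (c s))).2 (p 0)).mul_const (exp (p 0 * z))
  have r1 : ∀ s z ω, exp (p 0 * (lse A (fun v => X N (hd N t (c s) (range K) v) ω) + z)) =
    exp (p 0 * (lse A (fun v => X N (hd N t (c s) (range K) v) ω))) * exp (p 0 * z) := fun s z ω => by rw [← exp_add]; ring_nf
  simp only [sub_eq_add_neg _ (u * x * L), r1] at key2
  have mF : AEStronglyMeasurable (fun ω => exp (p 0 * F ω)) P := Real.continuous_exp.comp_aestronglyMeasurable (Fi.const_mul _).1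
  have iE : Integrable (fun ω => exp (p 0 * F ω)) P := ((e1 u (-(u*x*L))).add (e1 (-u) (u*x*L))).mono' mF
    (Eventually.of_forall fun ω => by rw [Real.norm_of_nonneg (exp_pos _).le]; exact key2 ω)
  have J := (jensen_exp (Fi.const_mul (p 0)) iE).trans (integral_mono iE ((e1 u (-(u*x*L))).add (e1 (-u) (u*x*L))) key2)
  simp only [Pi.add_apply] at J
  rw [integral_add (e1 _ _) (e1 _ _), integral_mul_const, integral_mul_const, integral_const_mul] at J
  have fin : ∀ s z : ℝ, s^2 = u^2 → z = s * x → ∀ w, w ≤ exp ((p 0 * ∑ k ∈ range K, (2 + p k ^ 2 * c s k ^ 2 / 2) * (t (k+1) - t k) / p k + p 0 * u^2 / 2) * L) →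
      w * exp (p 0 * -(z * L)) ≤ exp (p 0 * (Φ + u^2 / 2 * S + u^2 / 2) * L) := fun s z hs hz w hw => by
    refine (mul_le_mul_of_nonneg_right hw (exp_pos _).le).trans ?_
    rw [← exp_add, exp_le_exp]
    have := mul_le_mul_of_nonneg_left (hPs s) (mul_nonneg q0.le L0)
    rw [hs] at this
    rw [hz]; linarith
  have J1 := fin u (u*x) rfl rfl _ (U1 P hP A hAV hAn)
  have J2 := fin (-u) (-(u*x)) (by ring) (by ring) _ (U2 P hP A hAV hAn)
  rw [neg_mul, neg_neg] at J2
  have J3 : exp (p 0 * ∫ ω, F ω ∂P) ≤ exp (1 + p 0 * (Φ + u^2 / 2 * S + u^2 / 2) * L) := by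
    rw [exp_add 1]
    have : (2:ℝ) ≤ exp 1 := by linarith [add_one_le_exp 1]
    have := mul_le_mul_of_nonneg_right this (exp_pos (p 0 * (Φ + u^2 / 2 * S + u^2 / 2) * L)).le
    linarith
  rw [exp_le_exp] at J3
  rw [div_le_iff₀ (by positivity)] at hL
  have J4 : ∫ ω, F ω ∂P ≤ (Φ + u^2 / 2 * S + u^2) * L := by
    refine le_of_mul_le_mul_left ?_ q0; linarith
  simp only [hF] at J4
  rw [integral_add (gi.const_mul u) ai, integral_const_mul] at J4
  have J5 := (l1 P hP).trans (integral_mono (lse_X hP hbn _ (hV (fun k => β * σ k))).1 ai fun ω =>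
    log_le_log (se_pos hbn _) (Finset.sum_le_sum_of_subset_of_nonneg hA fun _ _ _ => (exp_pos _).le))
  have J6 : u * ∫ ω, gav A (fun v => a v ω) (fun v => |y v ω|) ∂P ≤ u * (ε * L) := by
    have : u * ε = u^2 * (S + 4) := by rw [hu]; field_simp
    have : u^2 * S * L ≥ 0 := by positivity
    have : u^2 * L ≥ 0 := by positivity
    nlinarith
  exact le_of_mul_le_mul_left J6 u0
theorem loc1 {K : ℕ} {t : ℕ → ℝ} (h : Ptn K t) {s : ℝ} (h0 : 0 < s) (h1 : s ≤ 1) : ∃ i < K, t i < s ∧ s ≤ t (i+1) := by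
  have ex : ∃ i, s ≤ t i := ⟨K, by rw [h.2.2.1]; exact h1⟩
  have a := Nat.find_spec ex
  have b : Nat.find ex ≠ 0 := fun e => by rw [e, h.2.1] at a; linarith
  have c : Nat.find ex ≤ K := Nat.find_min' ex (by rw [h.2.2.1]; exact h1)
  refine ⟨Nat.find ex - 1, by omega, ?_, by rwa [Nat.sub_add_cancel (by omega)]⟩
  have := Nat.find_min ex (m := Nat.find ex - 1) (by omega)
  linarith
theorem loc {K M : ℕ} {t l : ℕ → ℝ} (h : Ptn K t) (hl : Ptn M l) (hr : ∀ i ≤ M, ∃ k ≤ K, t k = l i) {k : ℕ} (hk : k < K) :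
    ∃ i < M, l i ≤ t k ∧ t (k+1) ≤ l (i+1) := by
  obtain ⟨i, hi, a, b⟩ := loc1 hl (s := t (k+1)) ((h.nn hk.le).trans_lt (h.2.2.2 k hk)) (h.le1 hk)
  refine ⟨i, hi, ?_, b⟩
  obtain ⟨j, hj, e⟩ := hr i hi.le
  rw [← e] at a ⊢
  refine h.mono ?_ hk.le
  by_contra hc
  exact absurd (h.mono (show k + 1 ≤ j by omega) hj) (not_le.2 a)
theorem step_int {K : ℕ} {t c : ℕ → ℝ} {f : ℝ → ℝ} (h : Ptn K t) (hf : ∀ k < K, ∀ s, t k < s → s ≤ t (k+1) → f s = c k) :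
    ∀ n ≤ K, IntervalIntegrable f volume 0 (t n) ∧ ∫ s in (0:ℝ)..(t n), f s = ∑ k ∈ range n, c k * (t (k+1) - t k) := by
  intro n
  induction n with
  | zero => intro _; rw [h.2.1]; simp
  | succ n ih =>
    intro hn
    obtain ⟨i1, e1⟩ := ih (by omega)
    have le := (h.2.2.2 n hn).le
    have eo : Set.EqOn (fun _ => c n) f (Set.uIoc (t n) (t (n+1))) := fun s hs => by
      rw [Set.uIoc_of_le le] at hs; exact (hf n hn s hs.1 hs.2).symm
    have i2 : IntervalIntegrable f volume (t n) (t (n+1)) := (intervalIntegrable_const (c := c n)).congr eo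
    refine ⟨i1.trans i2, ?_⟩
    rw [← intervalIntegral.integral_add_adjacent_intervals i1 i2, e1, sum_range_succ]
    congr 1
    rw [intervalIntegral.integral_of_le le, ← setIntegral_congr_fun measurableSet_Ioc (Set.uIoc_of_le le ▸ eo), ← intervalIntegral.integral_of_le le,
      intervalIntegral.integral_const, smul_eq_mul, mul_comm]
section
variable {M : ℕ} {sigv lamv : ℕ → ℝ} {m : ℕ} {sigb lamb : ℕ → ℝ} {sigbar : ℝ → ℝ}
theorem SP_ptn (hp : ScaleParams M sigv lamv) : Ptn M lamv := ⟨hp.1, hp.2.2.1, hp.2.2.2.1, hp.2.2.2.2⟩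
theorem EP_ptn (he : EffParams M sigv lamv m sigb lamb sigbar) : Ptn m lamb := ⟨he.1, he.2.2.1, he.2.2.2.1, he.2.2.2.2.1⟩
theorem stepFn_eq (hp : ScaleParams M sigv lamv) {i : ℕ} (hi : i < M) {s : ℝ} (h1 : lamv i < s) (h2 : s ≤ lamv (i+1)) :
    stepFn M sigv lamv s = sigv (i+1) := by
  have h := SP_ptn hp
  have s0 : s ≠ 0 := ((h.nn hi.le).trans_lt h1).ne'
  rw [stepFn, if_neg s0, zero_add, Finset.sum_eq_single (i+1)]
  · rw [if_pos ⟨by simpa using h1, h2⟩]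
  · intro j hj hne
    rw [Finset.mem_Icc] at hj
    rw [if_neg]
    rintro ⟨a, b⟩
    rcases lt_or_gt_of_ne hne with c | c
    · linarith [h.mono (show j ≤ i by omega) hi.le]
    · linarith [h.mono (show i + 1 ≤ j - 1 by omega) (by omega)]
  · intro hh; exact absurd (Finset.mem_Icc.2 ⟨by omega, by omega⟩) hh
theorem sigb_eq (he : EffParams M sigv lamv m sigb lamb sigbar) {i : ℕ} (hi : i < m) {s : ℝ} (h1 : lamb i < s) (h2 : s ≤ lamb (i+1)) :
    sigbar s = sigb (i+1) :=
  he.2.2.2.2.2.2.2.2.1 (i+1) (Finset.mem_Icc.2 ⟨by omega, by omega⟩) s (by simpa using h1) h2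
theorem sigb_pos (he : EffParams M sigv lamv m sigb lamb sigbar) {i : ℕ} (hi : i < m) : 0 < sigb (i+1) :=
  he.2.2.2.2.2.2.1 _ (Finset.mem_Icc.2 ⟨by omega, by omega⟩)
theorem sigb_anti (he : EffParams M sigv lamv m sigb lamb sigbar) {i j : ℕ} (hij : i ≤ j) (hj : j < m) : sigb (j+1) ≤ sigb (i+1) := by
  induction j, hij using Nat.le_induction with
  | base => exact le_rfl
  | succ j hij ih => exact (he.2.2.2.2.2.1 (j+1) (by omega) (by omega)).le.trans (ih (by omega))
theorem hull (hp : ScaleParams M sigv lamv) (he : EffParams M sigv lamv m sigb lamb sigbar) :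
    (∀ x ∈ Set.Icc (0:ℝ) 1, Jsig2 M sigv lamv x ≤ ∫ r in (0:ℝ)..x, sigbar r ^ 2) ∧ Jsig2 M sigv lamv 1 = ∫ r in (0:ℝ)..1, sigbar r ^ 2 ∧
    ∀ j, j + 1 < m → Jsig2 M sigv lamv (lamb (j+1)) = ∫ r in (0:ℝ)..(lamb (j+1)), sigbar r ^ 2 := by
  have h := SP_ptn hp
  have h' := EP_ptn he
  set f : ℝ → ℝ := fun r => stepFn M sigv lamv r ^ 2 with hf
  set g : ℝ → ℝ := fun r => sigbar r ^ 2 with hg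
  set S := ∑ i ∈ range M, sigv (i+1) ^ 2 with hS
  have fi : IntervalIntegrable f volume 0 1 := by
    have := (step_int (f := f) (c := fun i => sigv (i+1) ^ 2) h (fun k hk s a b => by simp only [hf, stepFn_eq hp hk a b]) M le_rfl).1
    rwa [h.2.2.1] at this
  have gi : IntervalIntegrable g volume 0 1 := by
    have := (step_int (f := g) (c := fun i => sigb (i+1) ^ 2) h' (fun k hk s a b => by simp only [hg, sigb_eq he hk a b]) m le_rfl).1
    rwa [h'.2.2.1] at this
  have fS : ∀ s, 0 < s → s ≤ 1 → f s ≤ S := fun s a b => by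
    obtain ⟨i, hi, c, d⟩ := loc1 h a b
    simp only [hf, stepFn_eq hp hi c d]
    exact single_le_sum (f := fun i => sigv (i+1) ^ 2) (fun _ _ => sq_nonneg _) (mem_range.2 hi)
  have f0 : ∀ s, 0 ≤ f s := fun s => sq_nonneg _
  have sub : ∀ {F : ℝ → ℝ}, IntervalIntegrable F volume 0 1 → ∀ {x y : ℝ}, 0 ≤ x → x ≤ 1 → 0 ≤ y → y ≤ 1 → IntervalIntegrable F volume x y := fun hF x y a b c d =>
    hF.mono_set (by rw [Set.uIcc_of_le zero_le_one]; exact Set.uIcc_subset_Icc ⟨a, b⟩ ⟨c, d⟩)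
  have dif : ∀ {F : ℝ → ℝ}, IntervalIntegrable F volume 0 1 → ∀ {x y : ℝ}, 0 ≤ x → x ≤ 1 → 0 ≤ y → y ≤ 1 → (∫ r in (0:ℝ)..y, F r) - (∫ r in (0:ℝ)..x, F r) = ∫ r in x..y, F r :=
    fun hF x y a b c d => intervalIntegral.integral_interval_sub_left (sub hF le_rfl zero_le_one c d) (sub hF le_rfl zero_le_one a b)
  have ub : ∀ {F : ℝ → ℝ}, IntervalIntegrable F volume 0 1 → ∀ {x y B : ℝ}, 0 ≤ x → x ≤ y → y ≤ 1 → (∀ s, x < s → s ≤ y → F s ≤ B) → (∫ r in x..y, F r) ≤ B * (y - x) :=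
    fun {F} hF x y B a b c hB => by
      have := intervalIntegral.integral_mono_on_of_le_Ioo (g := fun _ => B) b (sub hF a (b.trans c) (a.trans b) c) intervalIntegrable_const (fun s hs => hB s hs.1 hs.2.le)
      rw [intervalIntegral.integral_const, smul_eq_mul] at this; linarith
  have lb : ∀ {F : ℝ → ℝ}, IntervalIntegrable F volume 0 1 → ∀ {x y B : ℝ}, 0 ≤ x → x ≤ y → y ≤ 1 → (∀ s, x < s → s ≤ y → B ≤ F s) → B * (y - x) ≤ (∫ r in x..y, F r) :=
    fun {F} hF x y B a b c hB => by
      have := intervalIntegral.integral_mono_on_of_le_Ioo (f := fun _ => B) b intervalIntegrable_const (sub hF a (b.trans c) (a.trans b) c) (fun s hs => hB s hs.1 hs.2.le)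
      rw [intervalIntegral.integral_const, smul_eq_mul] at this; linarith
  set J : ℝ → ℝ := fun x => ∫ r in (0:ℝ)..x, f r with hJ
  set H : ℝ → ℝ := fun x => ∫ r in (0:ℝ)..x, g r with hH
  have hu : ∀ s, 0 < s → s ≤ 1 → concaveHull J s = H s := he.2.2.2.2.2.2.2.2.2
  have Jm : ∀ x y, 0 ≤ x → x ≤ y → y ≤ 1 → J x ≤ J y ∧ J y ≤ J x + S * (y - x) := fun x y a b c => by
    have e := dif fi a (b.trans c) (a.trans b) c
    have e1 := lb fi (B := 0) a b c (fun s _ _ => f0 s)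
    have e2 := ub fi (B := S) a b c (fun s u v => fS s (by linarith) (by linarith))
    simp only [hJ]; constructor <;> linarith
  have bdd : ∀ x ∈ Set.Icc (0:ℝ) 1, BddBelow {y | ∃ g : ℝ → ℝ, ConcaveOn ℝ (Set.Icc (0:ℝ) 1) g ∧ (∀ t ∈ Set.Icc (0:ℝ) 1, J t ≤ g t) ∧ y = g x} :=
    fun x hx => ⟨J x, by rintro y ⟨g, -, b, rfl⟩; exact b x hx⟩
  have cst : ConcaveOn ℝ (Set.Icc (0:ℝ) 1) (fun _ => J 1) ∧ ∀ t ∈ Set.Icc (0:ℝ) 1, J t ≤ J 1 :=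
    ⟨concaveOn_const _ (convex_Icc _ _), fun t ht => (Jm t 1 ht.1 ht.2 le_rfl).1⟩
  have A1 : ∀ x ∈ Set.Icc (0:ℝ) 1, J x ≤ H x := fun x hx => by
    rcases hx.1.eq_or_lt with rfl | hx0
    · simp [hJ, hH]
    · rw [← hu x hx0 hx.2]
      exact le_csInf ⟨J 1, _, cst.1, cst.2, rfl⟩ (by rintro y ⟨g, -, b, rfl⟩; exact b x hx)
  refine ⟨A1, ?_, ?_⟩
  · refine le_antisymm (A1 1 ⟨zero_le_one, le_rfl⟩) ?_
    change H 1 ≤ J 1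
    rw [← hu 1 one_pos le_rfl]
    exact csInf_le (bdd 1 ⟨zero_le_one, le_rfl⟩) ⟨_, cst.1, cst.2, rfl⟩
  · intro j hj
    set x0 := lamb (j+1) with hx0
    have x01 : x0 ≤ 1 := h'.le1 hj.le
    have x00 : 0 < x0 := (h'.nn (by omega)).trans_lt (h'.2.2.2 j (by omega))
    refine le_antisymm (A1 x0 ⟨x00.le, x01⟩) (not_lt.1 fun hlt => ?_)
    change J x0 < H x0 at hlt
    set a := sigb (j+1) ^ 2
    set b := sigb (j+2) ^ 2
    have hab : b < a := pow_lt_pow_left₀ (he.2.2.2.2.2.1 (j+1) (by omega) (by omega)) (sigb_pos he hj).le two_ne_zero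
    have b0 : 0 ≤ b := sq_nonneg _
    have S0 : 0 ≤ S := sum_nonneg fun _ _ => sq_nonneg _
    set d := (a - b) / 2 with hd
    have d0 : 0 < d := by linarith
    set κ := (a + b) / 2 with hκ
    set ε := (H x0 - J x0) / (1 + (κ + S) / d) with hε
    have den : 0 < 1 + (κ + S) / d := by positivity
    have ε0 : 0 < ε := div_pos (by linarith) den
    have εe : ε + (κ + S) * (ε / d) = H x0 - J x0 := by
      rw [← div_mul_cancel₀ (H x0 - J x0) den.ne', ← hε]; ring
    have maj : ∀ x ∈ Set.Icc (0:ℝ) 1, J x ≤ H x0 - ε + κ * (x - x0) := by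
      intro x hx
      have h1 : H x ≤ H x0 + κ * (x - x0) - d * |x - x0| := by
        rcases le_total x x0 with c | c
        · have e := dif gi hx.1 hx.2 x00.le x01
          have e1 := lb gi (B := a) hx.1 c x01 (fun s u v => by
            obtain ⟨i, hi, p, q⟩ := loc1 h' (s := s) (by linarith [hx.1]) (by linarith)
            have ij : i ≤ j := by
              by_contra hc
              linarith [h'.mono (show j + 1 ≤ i by omega) hi.le]
            simp only [hg, sigb_eq he hi p q]
            exact pow_le_pow_left₀ (sigb_pos he (by omega)).le (sigb_anti he ij (by omega)) 2)
          have e3 : κ * (x - x0) - d * (-(x - x0)) = a * (x - x0) := by rw [hκ, hd]; ring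
          rw [abs_of_nonpos (by linarith)]; simp only [hH]; linarith
        · have e := dif gi x00.le x01 hx.1 hx.2
          have e1 := ub gi (B := b) x00.le c hx.2 (fun s u v => by
            obtain ⟨i, hi, p, q⟩ := loc1 h' (s := s) (by linarith) (by linarith [hx.2])
            have ij : j + 1 ≤ i := by
              by_contra hc
              linarith [h'.mono (show i + 1 ≤ j + 1 by omega) (by omega)]
            simp only [hg, sigb_eq he hi p q]
            exact pow_le_pow_left₀ (sigb_pos he hi).le (sigb_anti he ij hi) 2)
          have e3 : κ * (x - x0) - d * (x - x0) = b * (x - x0) := by rw [hκ, hd]; ring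
          rw [abs_of_nonneg (by linarith)]; simp only [hH]; linarith
      rcases le_total ε (d * |x - x0|) with c | c
      · linarith [A1 x hx]
      · have r : |x - x0| ≤ ε / d := by rw [le_div_iff₀ d0]; linarith
        have j1 : J x ≤ J x0 + S * |x - x0| := by
          rcases le_total x x0 with c | c
          · have := (Jm x x0 hx.1 c x01).1; have : 0 ≤ S * |x - x0| := by positivity
            linarith
          · rw [abs_of_nonneg (by linarith)]; exact (Jm x0 x x00.le c hx.2).2
        have j2 := mul_le_mul_of_nonneg_left r (by linarith : 0 ≤ κ + S)
        have j3 := mul_le_mul_of_nonneg_left (neg_abs_le (x - x0)) (by linarith : 0 ≤ κ)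
        linarith
    have cc : ConcaveOn ℝ (Set.Icc (0:ℝ) 1) (fun x => H x0 - ε + κ * (x - x0)) :=
      ⟨convex_Icc _ _, fun x _ y _ w w' _ _ hw => le_of_eq (by simp only [smul_eq_mul]; rw [← eq_sub_iff_add_eq'] at hw; rw [hw]; ring)⟩
    have := csInf_le (bdd x0 ⟨x00.le, x01⟩) ⟨_, cc, maj, rfl⟩
    have e := hu x0 x00 x01
    rw [concaveHull] at e
    rw [e] at this
    linarith
end
theorem ptn_ex (F : Finset ℝ) (hF : ∀ x ∈ F, 0 ≤ x ∧ x ≤ 1) {δ : ℝ} (hδ : 0 < δ) :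
    ∃ K t, Ptn K t ∧ (∀ k < K, t (k+1) - t k ≤ δ) ∧ ∀ x ∈ F, ∃ k ≤ K, t k = x := by
  obtain ⟨n, hn⟩ := exists_nat_gt (1/δ)
  have n0 : (0:ℝ) < n := lt_trans (by positivity) hn
  set T : Finset ℝ := F ∪ (range (n+1)).image (fun i : ℕ => (i:ℝ)/n) with hT
  have grid : ∀ i ≤ n, (i:ℝ)/n ∈ T := fun i hi => Finset.mem_union_right _ (Finset.mem_image.2 ⟨i, mem_range.2 (by omega), rfl⟩)
  have T0 : (0:ℝ) ∈ T := by simpa using grid 0 (by omega)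
  have T1 : (1:ℝ) ∈ T := by simpa [n0.ne'] using grid n le_rfl
  have T01 : ∀ x ∈ T, 0 ≤ x ∧ x ≤ 1 := fun x hx => by
    rcases Finset.mem_union.1 hx with h | h
    · exact hF x h
    · obtain ⟨i, hi, rfl⟩ := Finset.mem_image.1 h
      have : (i:ℝ) ≤ n := by exact_mod_cast Nat.lt_succ_iff.1 (mem_range.1 hi)
      exact ⟨by positivity, (div_le_one n0).2 this⟩
  have c2 : 1 < T.card := Finset.one_lt_card.2 ⟨0, T0, 1, T1, by norm_num⟩
  obtain ⟨K, hK⟩ : ∃ K, T.card = K + 1 := ⟨T.card - 1, by omega⟩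
  set f := T.orderEmbOfFin hK with hf
  have fs : ∀ x ∈ T, ∃ i, f i = x := fun x hx => by
    have := Finset.range_orderEmbOfFin T hK
    exact (this ▸ (Finset.mem_coe.2 hx) : x ∈ Set.range f)
  have fm : ∀ i, f i ∈ T := fun i => Finset.orderEmbOfFin_mem T hK i
  set t : ℕ → ℝ := fun k => f ⟨min k K, by omega⟩ with ht
  have tv : ∀ i : Fin (K+1), t i = f i := fun i => by
    simp only [ht]; congr 1; ext; simp; omega
  have ex : ∀ x ∈ T, ∃ k ≤ K, t k = x := fun x hx => by
    obtain ⟨i, hi⟩ := fs x hx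
    exact ⟨i, by omega, by rw [tv, hi]⟩
  have mn : ∀ i j, i ≤ j → t i ≤ t j := fun i j hij => f.monotone (by simp only [Fin.mk_le_mk]; omega)
  have sm : ∀ k < K, t k < t (k+1) := fun k hk => f.strictMono (by simp only [Fin.mk_lt_mk]; omega)
  refine ⟨K, t, ⟨by omega, ?_, ?_, sm⟩, ?_, fun x hx => ex x (Finset.mem_union_left _ hx)⟩
  · obtain ⟨i, hi, e⟩ := ex 0 T0
    exact le_antisymm (e ▸ mn 0 i (Nat.zero_le _)) (T01 _ (fm _)).1
  · obtain ⟨i, hi, e⟩ := ex 1 T1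
    exact le_antisymm (T01 _ (fm _)).2 (e ▸ mn i K hi)
  · intro k hk
    have a := T01 (t k) (fm _)
    have b : t k < 1 := (sm k hk).trans_le (T01 (t (k+1)) (fm _)).2
    have c := Nat.lt_floor_add_one (t k * n)
    have d := Nat.floor_le (mul_nonneg a.1 n0.le)
    have g := grid (⌊t k * n⌋₊ + 1) (by
      have : (⌊t k * n⌋₊ : ℝ) < n := by nlinarith
      exact_mod_cast this)
    obtain ⟨i, hi, e⟩ := ex _ g
    have lt : t k < t i := by rw [e, lt_div_iff₀ n0]; push_cast; exact c
    have ki : k + 1 ≤ i := by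
      by_contra hc
      exact absurd (mn i k (by omega)) (not_le.2 lt)
    have := mn _ _ ki
    rw [e] at this
    have u : ((⌊t k * n⌋₊ + 1 : ℕ) : ℝ) / n ≤ t k + 1 / n := by
      rw [div_le_iff₀ n0]; push_cast; rw [add_mul, one_div_mul_cancel n0.ne']; linarith
    have w : 1 / (n:ℝ) ≤ δ := by rw [div_le_iff₀ n0]; rw [div_lt_iff₀ hδ] at hn; linarith
    linarith
theorem abel_sum {c E : ℕ → ℝ} (E0 : E 0 = 0) : ∀ n, (∀ k < n, c (k+1) = c k ∨ E (k+1) = 0) →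
    ∑ k ∈ range (n+1), c k * (E (k+1) - E k) = c n * E (n+1) := by
  intro n
  induction n with
  | zero => intro _; simp [E0]
  | succ n ih =>
    intro h
    rw [sum_range_succ, ih fun k hk => h k (by omega)]
    rcases h n (by omega) with e | e <;> rw [e] <;> ring
theorem hd_tel (N : ℕ) {t c : ℕ → ℝ} {a b : ℕ} (hab : a ≤ b) {x : ℝ} (v : Vtx) (hc : ∀ k, a ≤ k → k < b → c k = x) :
    hd N t c (Ico a b) v = x • (xi N v (t b) - xi N v (t a)) := by
  induction b, hab using Nat.le_induction with
  | base => simp [hd]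
  | succ b hb ih =>
    have := ih fun k h1 h2 => hc k h1 (by omega)
    unfold hd at this ⊢
    rw [Finset.sum_Ico_succ_top hb, this, hc b hb (by omega), ← smul_add]
    congr 1; unfold ic; abel
section
variable {M : ℕ} {sigv lamv : ℕ → ℝ} {m : ℕ} {sigb lamb : ℕ → ℝ} {sigbar : ℝ → ℝ}
theorem inj {K : ℕ} {t : ℕ → ℝ} (h : Ptn K t) {i j : ℕ} (hi : i ≤ K) (hlt : t i < t j) : i < j := by
  by_contra hc
  exact absurd (h.mono (not_lt.1 hc) hi) (not_le.2 hlt)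
theorem regroup (hp : ScaleParams M sigv lamv) {K : ℕ} {t : ℕ → ℝ} (h : Ptn K t) (hr : ∀ i ≤ M, ∃ k ≤ K, t k = lamv i) (N : ℕ) (v : Vtx) :
    xs N M sigv lamv v 1 = hd N t (fun k => stepFn M sigv lamv (t (k+1))) (range K) v := by
  have hl := SP_ptn hp
  choose! a ha ta using hr
  have key : ∀ n ≤ M, ∑ j ∈ Finset.Icc 1 n, sigv j • (xi N v (min 1 (lamv j)) - xi N v (min 1 (lamv (j-1)))) =
      hd N t (fun k => stepFn M sigv lamv (t (k+1))) (Ico (a 0) (a n)) v := by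
    intro n
    induction n with
    | zero => intro _; simp [hd]
    | succ n ih =>
      intro hn
      have a1 : a n < a (n+1) := inj h (ha n (by omega)) (by rw [ta n (by omega), ta _ hn]; exact hl.2.2.2 n hn)
      have a0 : a 0 ≤ a n := by
        by_contra hc
        have := h.mono (show a n ≤ a 0 by omega) (ha 0 (by omega))
        rcases Nat.eq_zero_or_pos n with rfl | n0
        · omega
        · rw [ta n (by omega), ta 0 (by omega)] at this
          linarith [hl.2.2.2 0 (by omega), hl.mono (show 0 + 1 ≤ n by omega) (by omega)]
      rw [Finset.sum_Icc_succ_top (by omega), ih (by omega), hd_split a0 a1.le,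
        hd_tel N a1.le (x := sigv (n+1)) v, ta n (by omega), ta _ hn, Nat.add_sub_cancel, min_eq_right (hl.le1 hn), min_eq_right (hl.le1 (by omega))]
      intro k h1 h2
      refine stepFn_eq hp hn ?_ ?_
      · rw [← ta n (by omega)]; exact (h.mono h1 (by have := ha _ hn; omega)).trans_lt (h.2.2.2 k (by have := ha _ hn; omega))
      · rw [← ta _ hn]; exact h.mono (by omega) (ha _ hn)
  have e0 : a 0 = 0 := by
    by_contra hc
    have := h.mono (show 1 ≤ a 0 by omega) (ha 0 (by omega))
    rw [ta 0 (by omega), hl.2.1] at this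
    have := h.2.2.2 0 (by have := h.1; omega)
    rw [h.2.1] at this; simp at this; linarith
  have eM : a M = K := by
    by_contra hc
    have l := ha M le_rfl
    have := h.2.2.2 (a M) (by omega)
    rw [ta M le_rfl, hl.2.2.1] at this
    linarith [h.le1 (show a M + 1 ≤ K by omega)]
  rw [Finset.range_eq_Ico, ← e0, ← eM]
  exact key M le_rfl
theorem params (hp : ScaleParams M sigv lamv) (he : EffParams M sigv lamv m sigb lamb sigbar) {β : ℝ} (hβ : 0 < β) {K : ℕ} {t : ℕ → ℝ} (h : Ptn K t)
    (hr : ∀ i ≤ M, ∃ k ≤ K, t k = lamv i) (hr' : ∀ i ≤ m, ∃ k ≤ K, t k = lamb i) (σ : ℕ → ℝ) (hσ : σ = fun k => stepFn M sigv lamv (t (k+1))) :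
    (∀ k < K, σ k ^ 2 ≤ ∑ i ∈ range M, sigv (i+1) ^ 2) ∧
    ∃ θ : ℕ → ℝ, (∀ k, 0 < θ k ∧ θ k ≤ β) ∧ Monotone θ ∧ (∀ n ≤ K, Vs t (fun k => θ k * σ k) (range n) ≤ 4 * t n) ∧
    ∑ k ∈ range K, (β - θ k) * (θ k * σ k ^ 2 - 4 / θ k) * (t (k+1) - t k) = 0 := by
  have hl := SP_ptn hp
  have hl' := EP_ptn he
  have K1 := h.1
  obtain ⟨H1, H2, H3⟩ := hull hp he
  have dpos : ∀ k < K, 0 < t (k+1) - t k := fun k hk => sub_pos.2 (h.2.2.2 k hk)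
  have s1 : ∀ k < K, ∀ s, t k < s → s ≤ t (k+1) → stepFn M sigv lamv s ^ 2 = σ k ^ 2 := fun k hk s a b => by
    obtain ⟨i, hi, c, d⟩ := loc h hl hr hk
    rw [hσ]; simp only
    rw [stepFn_eq hp hi (c.trans_lt a) (b.trans d), stepFn_eq hp hi (c.trans_lt (h.2.2.2 k hk)) d]
  have exq : ∀ k, ∃ i, k < K → i < m ∧ lamb i ≤ t k ∧ t (k+1) ≤ lamb (i+1) := fun k => by
    by_cases hk : k < K
    · obtain ⟨i, a, b⟩ := loc h hl' hr' hk; exact ⟨i, fun _ => ⟨a, b⟩⟩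
    · exact ⟨0, fun a => absurd a hk⟩
  choose q hq using exq
  have s2 : ∀ k < K, ∀ s, t k < s → s ≤ t (k+1) → sigbar s ^ 2 = sigb (q k + 1) ^ 2 := fun k hk s a b => by
    obtain ⟨c, d, e⟩ := hq k hk
    rw [sigb_eq he c (d.trans_lt a) (b.trans e)]
  have qm : ∀ k l, k ≤ l → l < K → q k ≤ q l := fun k l kl hl1 => by
    by_contra hc
    obtain ⟨c, d, -⟩ := hq k (by omega)
    obtain ⟨-, -, e'⟩ := hq l hl1
    linarith [hl'.mono (show q l + 1 ≤ q k by omega) c.le, h.2.2.2 l hl1, h.mono kl hl1.le]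
  have bp : ∀ k < K, 0 < sigb (q k + 1) := fun k hk => sigb_pos he (hq k hk).1
  set E : ℕ → ℝ := fun n => Jsig2 M sigv lamv (t n) - ∫ r in (0:ℝ)..(t n), sigbar r ^ 2 with hE
  have E0 : E 0 = 0 := by simp [hE, h.2.1, Jsig2, Jint]
  have EK : E K = 0 := by simp only [hE, h.2.2.1, H2, sub_self]
  have Ele : ∀ n ≤ K, E n ≤ 0 := fun n hn => sub_nonpos.2 (H1 _ ⟨h.nn hn, h.le1 hn⟩)
  have Ed : ∀ k < K, E (k+1) - E k = (σ k ^ 2 - sigb (q k + 1) ^ 2) * (t (k+1) - t k) := fun k hk => by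
    have a := step_int h s1; have b := step_int h s2
    simp only [hE, Jsig2, Jint]
    rw [(a (k+1) hk).2, (a k hk.le).2, (b (k+1) hk).2, (b k hk.le).2, sum_range_succ, sum_range_succ]; ring
  set θ : ℕ → ℝ := fun k => min β (2 / sigb (q (min k (K-1)) + 1)) with hθ
  have θe : ∀ k < K, θ k = min β (2 / sigb (q k + 1)) := fun k hk => by simp only [hθ, show min k (K-1) = k by omega]
  have θp : ∀ k, 0 < θ k ∧ θ k ≤ β := fun k => ⟨lt_min hβ (div_pos two_pos (bp _ (by omega))), min_le_left _ _⟩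
  have θm : Monotone θ := fun i j hij => min_le_min_left _ (div_le_div_of_nonneg_left two_pos.le (bp _ (by omega))
    (sigb_anti he (qm _ _ (by omega) (by omega)) (hq _ (by omega)).1))
  have jmp : ∀ k, k + 1 < K → θ (k+1) = θ k ∨ E (k+1) = 0 := fun k hk => by
    by_cases e : q (k+1) = q k
    · left; rw [θe _ hk, θe k (by omega), e]
    · right
      have l := qm k (k+1) (by omega) hk
      obtain ⟨c, d, -⟩ := hq _ hk
      obtain ⟨-, -, f⟩ := hq k (by omega)
      have te : t (k+1) = lamb (q k + 1) := le_antisymm f ((hl'.mono (by omega) c.le).trans d)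
      simp only [hE, te, H3 (q k) (by omega), sub_self]
  have ab : ∀ (F : ℝ → ℝ) n, n ≤ K → ∑ k ∈ range n, F (θ k) * (E (k+1) - E k) = F (θ (n-1)) * E n := fun F n hn => by
    cases n with
    | zero => simp [E0]
    | succ n => exact abel_sum (c := fun k => F (θ k)) E0 n fun k hk => (jmp k (by omega)).imp (fun e => by simp only [e]) id
  refine ⟨fun k hk => ?_, θ, θp, θm, fun n hn => ?_, ?_⟩
  · obtain ⟨i, hi, c, d⟩ := loc h hl hr hk
    rw [hσ]; simp only
    rw [stepFn_eq hp hi (c.trans_lt (h.2.2.2 k hk)) d]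
    exact single_le_sum (f := fun i => sigv (i+1) ^ 2) (fun _ _ => sq_nonneg _) (mem_range.2 hi)
  · have a := ab (fun x => x ^ 2) n hn
    have a2 : θ (n-1) ^ 2 * E n ≤ 0 := mul_nonpos_of_nonneg_of_nonpos (sq_nonneg _) (Ele n hn)
    have tel : ∑ k ∈ range n, (t (k+1) - t k) = t n := by rw [Finset.sum_range_sub, h.2.1, sub_zero]
    rw [← tel, mul_sum]
    calc Vs t (fun k => θ k * σ k) (range n)
        = ∑ k ∈ range n, θ k ^ 2 * (E (k+1) - E k) + ∑ k ∈ range n, θ k ^ 2 * sigb (q k + 1) ^ 2 * (t (k+1) - t k) := by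
          rw [← sum_add_distrib]
          refine sum_congr rfl fun k hk => ?_
          rw [Ed k ((mem_range.1 hk).trans_le hn)]; ring
      _ ≤ 0 + _ := by gcongr; rw [a]; exact a2
      _ ≤ _ := by
          rw [zero_add]
          refine sum_le_sum fun k hk => ?_
          have hk' := (mem_range.1 hk).trans_le hn
          refine mul_le_mul_of_nonneg_right ?_ (dpos k hk').le
          have : θ k * sigb (q k + 1) ≤ 2 := by
            rw [← le_div_iff₀ (bp k hk'), θe k hk']; exact min_le_right _ _
          have := mul_nonneg (θp k).1.le (bp k hk').le
          nlinarith
  · have a := ab (fun x => (β - x) * x) K le_rfl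
    rw [EK, mul_zero] at a
    rw [← a]
    refine sum_congr rfl fun k hk => ?_
    have hk' := mem_range.1 hk
    rw [Ed k hk']
    have b0 := bp k hk'
    rcases le_total β (2 / sigb (q k + 1)) with c | c
    · have : θ k = β := by rw [θe k hk', min_eq_left c]
      rw [this]; ring
    · have : θ k = 2 / sigb (q k + 1) := by rw [θe k hk', min_eq_right c]
      rw [this]; field_simp; ring
end
theorem marg {A : Finset Vtx} {s : ℕ} (k : Fin s) (W g : Vtx → ℝ) (W1 : ∑ v ∈ A, W v = 1) :
    ∑ vv ∈ Fintype.piFinset (fun _ : Fin s => A), (∏ i, W (vv i)) * g (vv k) = ∑ v ∈ A, W v * g v := by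
  have e : ∀ vv : Fin s → Vtx, (∏ i, W (vv i)) * g (vv k) = ∏ i, (if i = k then W (vv i) * g (vv i) else W (vv i)) := fun vv => by
    rw [← Finset.mul_prod_erase _ _ (Finset.mem_univ k), ← Finset.mul_prod_erase Finset.univ (fun i => if i = k then _ else _) (Finset.mem_univ k), if_pos rfl,
      Finset.prod_congr rfl (g := fun i => W (vv i)) fun i hi => if_neg (Finset.ne_of_mem_erase hi)]
    ring
  simp only [e]
  rw [← Finset.prod_univ_sum (fun _ => A) (fun i v => if i = k then W v * g v else W v), ← Finset.mul_prod_erase _ _ (Finset.mem_univ k)]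
  rw [Finset.prod_eq_one fun i hi => ?_]
  · simp
  · simp only [if_neg (Finset.ne_of_mem_erase hi), W1]
theorem asm {P : Measure FieldSp} [IsProbabilityMeasure P] {A : Finset Vtx} {s : ℕ} (k : Fin s) (W Y : Vtx → FieldSp → ℝ)
    (Wm : ∀ v, Measurable (W v)) (W0 : ∀ v ω, 0 ≤ W v ω) (W1 : ∀ ω, ∑ v ∈ A, W v ω = 1) (Yi : ∀ v, Integrable (Y v) P) (c : ℝ)
    (h : (Fin s → Vtx) → ℝ) (C : ℝ) (hC : ∀ vv, |h vv| ≤ C) :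
    |(∫ ω, ∑ vv ∈ Fintype.piFinset (fun _ : Fin s => A), (∏ i, W (vv i) ω) * (Y (vv k) ω * h vv) ∂P) -
      (∫ ω, ∑ vv ∈ Fintype.piFinset (fun _ : Fin 1 => A), (∏ i, W (vv i) ω) * Y (vv 0) ω ∂P) *
      ∫ ω, ∑ vv ∈ Fintype.piFinset (fun _ : Fin s => A), (∏ i, W (vv i) ω) * h vv ∂P| ≤ 2 * C * ∫ ω, ∑ v ∈ A, W v ω * |Y v ω - c| ∂P := by
  have C0 : 0 ≤ C := (abs_nonneg _).trans (hC fun _ => 0)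
  have Wle : ∀ v ∈ A, ∀ ω, W v ω ≤ 1 := fun v hv ω => W1 ω ▸ single_le_sum (f := fun v => W v ω) (fun v _ => W0 v ω) hv
  have pm : ∀ {n : ℕ} (vv : Fin n → Vtx), Measurable fun ω => ∏ i, W (vv i) ω := fun vv => Finset.measurable_fun_prod _ fun i _ => Wm _
  have p0 : ∀ {n : ℕ} (vv : Fin n → Vtx) ω, 0 ≤ ∏ i, W (vv i) ω := fun vv ω => Finset.prod_nonneg fun i _ => W0 _ _
  have int : ∀ {n : ℕ} (F : (Fin n → Vtx) → FieldSp → ℝ), (∀ vv, Integrable (F vv) P) →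
      Integrable (fun ω => ∑ vv ∈ Fintype.piFinset (fun _ : Fin n => A), (∏ i, W (vv i) ω) * F vv ω) P := fun F hF =>
    integrable_finset_sum _ fun vv hv => (hF vv).bdd_mul (c := 1) (pm vv).aestronglyMeasurable (Eventually.of_forall fun ω => by
      rw [Real.norm_of_nonneg (p0 vv ω)]
      exact Finset.prod_le_one (fun i _ => W0 _ _) fun i _ => Wle _ (Fintype.mem_piFinset.1 hv i) ω)
  have Zi : ∀ v, Integrable (fun ω => Y v ω - c) P := fun v => (Yi v).sub (integrable_const c)
  have e1 : (∫ ω, ∑ vv ∈ Fintype.piFinset (fun _ : Fin s => A), (∏ i, W (vv i) ω) * (Y (vv k) ω * h vv) ∂P) =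
      (∫ ω, ∑ vv ∈ Fintype.piFinset (fun _ : Fin s => A), (∏ i, W (vv i) ω) * ((Y (vv k) ω - c) * h vv) ∂P) +
      c * ∫ ω, ∑ vv ∈ Fintype.piFinset (fun _ : Fin s => A), (∏ i, W (vv i) ω) * h vv ∂P := by
    rw [← integral_const_mul, ← integral_add (int _ fun vv => (Zi _).mul_const _) ((int (fun vv _ => h vv) fun vv => integrable_const _).const_mul c)]
    refine integral_congr_ae (Eventually.of_forall fun ω => ?_)
    simp only [mul_sum, ← sum_add_distrib]
    exact sum_congr rfl fun vv _ => by ring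
  have e2 : (∫ ω, ∑ vv ∈ Fintype.piFinset (fun _ : Fin 1 => A), (∏ i, W (vv i) ω) * Y (vv 0) ω ∂P) =
      (∫ ω, ∑ v ∈ A, W v ω * (Y v ω - c) ∂P) + c := by
    have i1 : Integrable (fun ω => ∑ v ∈ A, W v ω * (Y v ω - c)) P := by
      have := int (n := 1) (fun vv ω => Y (vv 0) ω - c) fun vv => Zi _
      exact this.congr (Eventually.of_forall fun ω => marg (0 : Fin 1) (fun v => W v ω) (fun v => Y v ω - c) (W1 ω))
    refine Eq.trans ?_ (congrArg (_ + ·) (show ∫ _ : FieldSp, c ∂P = c by simp))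
    rw [← integral_add i1 (integrable_const _)]
    refine integral_congr_ae (Eventually.of_forall fun ω => ?_)
    simp only [marg (A := A) (0 : Fin 1) (fun v => W v ω) (fun v => Y v ω) (W1 ω), mul_sub, sum_sub_distrib, ← Finset.sum_mul, W1]
    simp
  have iA : Integrable (fun ω => ∑ v ∈ A, W v ω * |Y v ω - c|) P := by
    have := int (n := 1) (fun vv ω => |Y (vv 0) ω - c|) fun vv => (Zi _).abs
    exact this.congr (Eventually.of_forall fun ω => marg (0 : Fin 1) (fun v => W v ω) (fun v => |Y v ω - c|) (W1 ω))
  have b1 : |∫ ω, ∑ vv ∈ Fintype.piFinset (fun _ : Fin s => A), (∏ i, W (vv i) ω) * ((Y (vv k) ω - c) * h vv) ∂P| ≤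
      C * ∫ ω, ∑ v ∈ A, W v ω * |Y v ω - c| ∂P := by
    rw [← integral_const_mul]
    refine abs_integral_le_integral_abs.trans (integral_mono (int _ fun vv => (Zi _).mul_const _).abs (iA.const_mul C) fun ω => ?_)
    refine (Finset.abs_sum_le_sum_abs _ _).trans ?_
    simp only
    rw [← marg k (fun v => W v ω) (fun v => |Y v ω - c|) (W1 ω), mul_sum]
    refine sum_le_sum fun vv _ => ?_
    rw [abs_mul, abs_mul, abs_of_nonneg (p0 vv ω)]
    have := mul_le_mul_of_nonneg_left (hC vv) (mul_nonneg (p0 vv ω) (abs_nonneg (Y (vv k) ω - c)))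
    linarith
  have b2 : |∫ ω, ∑ v ∈ A, W v ω * (Y v ω - c) ∂P| ≤ ∫ ω, ∑ v ∈ A, W v ω * |Y v ω - c| ∂P := by
    refine abs_integral_le_integral_abs.trans (integral_mono_of_nonneg (Eventually.of_forall fun _ => abs_nonneg _) iA (Eventually.of_forall fun ω => ?_))
    refine (Finset.abs_sum_le_sum_abs _ _).trans (sum_le_sum fun v _ => ?_)
    rw [abs_mul, abs_of_nonneg (W0 v ω)]
  have b3 : |∫ ω, ∑ vv ∈ Fintype.piFinset (fun _ : Fin s => A), (∏ i, W (vv i) ω) * h vv ∂P| ≤ C := by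
    have : ∀ ω, ‖∑ vv ∈ Fintype.piFinset (fun _ : Fin s => A), (∏ i, W (vv i) ω) * h vv‖ ≤ C := fun ω => by
      refine (Finset.abs_sum_le_sum_abs _ _).trans ?_
      have := marg k (fun v => W v ω) (fun _ => C) (W1 ω)
      rw [← Finset.sum_mul, ← Finset.sum_mul, W1, one_mul] at this
      rw [← this, Finset.sum_mul]
      refine sum_le_sum fun vv _ => ?_
      rw [abs_mul, abs_of_nonneg (p0 vv ω)]
      exact mul_le_mul_of_nonneg_left (hC vv) (p0 vv ω)
    simpa using norm_integral_le_of_norm_le_const (μ := P) (Eventually.of_forall this)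
  rw [e1, e2]
  set I := ∫ ω, ∑ v ∈ A, W v ω * |Y v ω - c| ∂P
  set a1 := ∫ ω, ∑ vv ∈ Fintype.piFinset (fun _ : Fin s => A), (∏ i, W (vv i) ω) * ((Y (vv k) ω - c) * h vv) ∂P
  set a2 := ∫ ω, ∑ v ∈ A, W v ω * (Y v ω - c) ∂P
  set a3 := ∫ ω, ∑ vv ∈ Fintype.piFinset (fun _ : Fin s => A), (∏ i, W (vv i) ω) * h vv ∂P
  rw [show a1 + c * a3 - (a2 + c) * a3 = a1 - a2 * a3 by ring]
  refine (abs_sub _ _).trans ?_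
  rw [abs_mul]
  have := mul_le_mul b2 b3 (abs_nonneg _) ((abs_nonneg _).trans b2)
  linarith
section
variable {M : ℕ} {sigv lamv : ℕ → ℝ} {m : ℕ} {sigb lamb : ℕ → ℝ} {sigbar : ℝ → ℝ}
theorem conc (hp : ScaleParams M sigv lamv) (he : EffParams M sigv lamv m sigb lamb sigbar) {β : ℝ} (hβ : 0 < β) {i : ℕ} (hi : i ∈ Finset.Icc 1 M)
    {α α' : ℝ} (h1 : lamv (i - 1) ≤ α) (h2 : α < α') (h3 : α' ≤ lamv i) {ε : ℝ} (hε : 0 < ε) :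
    ∃ x : ℝ, ∀ᶠ N in atTop, ∀ P, IsGFF N P → ∀ A, bulk N ⊆ A → A ⊆ VN N →
    ∫ ω, gav A (fun v => β * X N (xs N M sigv lamv v 1) ω) (fun v => |X N (sigv i • (xi N v α' - xi N v α)) ω - x * log N|) ∂P ≤ ε * log N := by
  have hl := SP_ptn hp
  have hl' := EP_ptn he
  rw [Finset.mem_Icc] at hi
  obtain ⟨δ, δ0, HC⟩ := CORE (β := β) (S := ∑ i ∈ range M, sigv (i+1) ^ 2) hβ (sum_nonneg fun _ _ => sq_nonneg _) hε
  have a0 : 0 ≤ α := (hl.nn (by omega)).trans h1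
  have a1 : α' ≤ 1 := h3.trans (hl.le1 hi.2)
  obtain ⟨K, t, h, mesh, hF⟩ := ptn_ex (((range (M+1)).image lamv ∪ (range (m+1)).image lamb) ∪ {α, α'}) (fun x hx => by
    simp only [Finset.mem_union, Finset.mem_image, mem_range, Finset.mem_insert, Finset.mem_singleton] at hx
    rcases hx with (⟨j, hj, rfl⟩ | ⟨j, hj, rfl⟩) | rfl | rfl
    · exact ⟨hl.nn (by omega), hl.le1 (by omega)⟩
    · exact ⟨hl'.nn (by omega), hl'.le1 (by omega)⟩
    · constructor <;> linarith
    · constructor <;> linarith) δ0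
  have hr : ∀ i ≤ M, ∃ k ≤ K, t k = lamv i := fun j hj => hF _ (Finset.mem_union_left _ (Finset.mem_union_left _ (Finset.mem_image_of_mem _ (mem_range.2 (by omega)))))
  have hr' : ∀ i ≤ m, ∃ k ≤ K, t k = lamb i := fun j hj => hF _ (Finset.mem_union_left _ (Finset.mem_union_right _ (Finset.mem_image_of_mem _ (mem_range.2 (by omega)))))
  obtain ⟨a, ha, ta⟩ := hF α (by simp)
  obtain ⟨b, hb, tb⟩ := hF α' (by simp)
  have ab : a < b := inj h ha (by rw [ta, tb]; exact h2)
  obtain ⟨p1, θ, p2, p3, p4, p5⟩ := params hp he hβ h hr hr' _ rfl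
  set σ : ℕ → ℝ := fun k => stepFn M sigv lamv (t (k+1)) with hσ
  refine ⟨∑ k ∈ Ico a b, θ k * σ k ^ 2 * (t (k+1) - t k), ?_⟩
  filter_upwards [HC K t σ θ (Ico a b) h (fun k hk => by rw [mem_Ico] at hk; exact mem_range.2 (by omega)) mesh p2 p3 p1 p4 p5] with N hN P hP A A1 A2
  refine le_of_eq_of_le ?_ (hN P hP A A1 A2)
  have e1 : ∀ v, sigv i • (xi N v α' - xi N v α) = hd N t σ (Ico a b) v := fun v => by
    rw [hd_tel N ab.le (x := sigv i) v, ta, tb]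
    intro k k1 k2
    have := stepFn_eq hp (i := i - 1) (s := t (k+1)) (by omega)
      ((h1.trans (ta ▸ h.mono k1 (by omega))).trans_lt (h.2.2.2 k (by omega)))
      (by rw [Nat.sub_add_cancel hi.1]; exact (h.mono (show k + 1 ≤ b by omega) hb).trans (tb ▸ h3))
    rw [Nat.sub_add_cancel hi.1] at this
    exact this
  have e2 : ∀ v ω, X N (hd N t (fun k => β * σ k) (range K) v) ω = β * X N (xs N M sigv lamv v 1) ω := fun v ω => by
    rw [regroup hp h hr]
    have := hd_lin N t σ σ β 0 (range K) v ω
    simpa using this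
  simp only [e1, e2]
end
theorem J_pos {M : ℕ} {sigv lamv : ℕ → ℝ} (hp : ScaleParams M sigv lamv) : 0 < Jsig2 M sigv lamv 1 := by
  have h := SP_ptn hp
  have := (step_int (f := fun r => stepFn M sigv lamv r ^ 2) (c := fun i => sigv (i+1) ^ 2) h (fun k hk s a b => by simp only [stepFn_eq hp hk a b]) M le_rfl).2
  rw [h.2.2.1] at this
  rw [Jsig2, Jint, this]
  refine Finset.sum_pos (fun k hk => ?_) ⟨0, mem_range.2 h.1⟩
  have hk := mem_range.1 hk
  have := hp.2.1 (k+1) (Finset.mem_Icc.2 (by omega))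
  have := sub_pos.2 (h.2.2.2 k hk)
  positivity
theorem bulk_ne {N : ℕ} {A : Finset Vtx} (hN : 8 ≤ N) (hA : bulk N ⊆ A) : A.Nonempty := by
  have := (exp_pos _).trans_le (bulk_card hN)
  exact (Finset.card_pos.1 (by exact_mod_cast this)).mono hA
theorem bulk_AN {ρ : ℝ} (hρ : 0 < ρ) : ∀ᶠ N in atTop, bulk N ⊆ AN N ρ := by
  have lim := ((tendsto_rpow_atTop hρ).comp tendsto_natCast_atTop_atTop).eventually_ge_atTop (4:ℝ)
  filter_upwards [lim, eventually_ge_atTop 1] with N h4 h1 v hv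
  have N0 : (0:ℝ) < N := by exact_mod_cast h1
  obtain ⟨hV, hd⟩ := Finset.mem_filter.1 hv
  refine Finset.mem_filter.2 ⟨hV, fun z hz => ?_⟩
  have a : (N:ℝ) ^ (1 - ρ) ≤ N / 4 := by
    rw [Real.rpow_sub N0, Real.rpow_one]
    exact div_le_div_of_nonneg_left N0.le (by norm_num) h4
  refine a.trans (Real.le_sqrt_of_sq_le ?_)
  rw [mem_VN] at hz
  have hd' : (N:ℤ) ≤ 4 * v.1 ∧ (N:ℤ) ≤ 4 * (N - v.1) ∧ (N:ℤ) ≤ 4 * v.2 ∧ (N:ℤ) ≤ 4 * (N - v.2) := by unfold dd at hd; omega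
  have cs : (N:ℤ) ≤ 4 * (v.1 - z.1) ∨ (N:ℤ) ≤ 4 * (z.1 - v.1) ∨ (N:ℤ) ≤ 4 * (v.2 - z.2) ∨ (N:ℤ) ≤ 4 * (z.2 - v.2) := by omega
  rcases cs with c | c | c | c <;>
  · have c' : ((N:ℤ):ℝ) ≤ _ := Int.cast_le.2 c
    push_cast at c'
    nlinarith [sq_nonneg ((v.1:ℝ) - z.1), sq_nonneg ((v.2:ℝ) - z.2)]
theorem gib_ae {M : ℕ} {sigv lamv : ℕ → ℝ} (hp : ScaleParams M sigv lamv) {N : ℕ} {P : Measure FieldSp} (hP : IsGFF N P) (hN : 1 ≤ N)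
    {i : ℕ} (hi : i ∈ Finset.Icc 1 M) {α α' : ℝ} (h1 : lamv (i - 1) ≤ α) (h2 : α ≤ α') (h3 : α' ≤ lamv i) {β ρ : ℝ} (hA : (AN N ρ).Nonempty)
    {s : ℕ} (k : Fin s) (c : ℝ) (h : (Fin s → Vtx) → ℝ) (C : ℝ) (hC : ∀ vv, |h vv| ≤ C) :
    |gibbsExpRes N M sigv lamv P β ρ s (fun vv ω => psiInc N M sigv lamv P (vv k) α α' ω * h vv) -
      gibbsExpRes N M sigv lamv P β ρ 1 (fun vv ω => psiInc N M sigv lamv P (vv 0) α α' ω) * gibbsExpRes N M sigv lamv P β ρ s (fun vv _ => h vv)| ≤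
    2 * C * ∫ ω, gav (AN N ρ) (fun v => β * X N (xs N M sigv lamv v 1) ω) (fun v => |X N (sigv i • (xi N v α' - xi N v α)) ω - c|) ∂P := by
  haveI := hP.1
  set W : Vtx → FieldSp → ℝ := fun v ω => exp (β * X N (xs N M sigv lamv v 1) ω) / ∑ u ∈ AN N ρ, exp (β * X N (xs N M sigv lamv u 1) ω) with hW
  have em : ∀ v, Measurable fun ω => exp (β * X N (xs N M sigv lamv v 1) ω) := fun v => measurable_exp.comp ((X_meas N _).const_mul β)
  have sp : ∀ ω, 0 < ∑ u ∈ AN N ρ, exp (β * X N (xs N M sigv lamv u 1) ω) := fun ω => Finset.sum_pos (fun _ _ => exp_pos _) hA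
  have key := asm (P := P) (A := AN N ρ) k W (fun v => X N (sigv i • (xi N v α' - xi N v α)))
    (fun v => (em v).div (Finset.measurable_fun_sum _ fun v _ => em v)) (fun v ω => (div_pos (exp_pos _) (sp ω)).le)
    (fun ω => by simp only [hW]; rw [← Finset.sum_div, div_self (sp ω).ne'])
    (fun v => (X_mem hP ((Sp _).smul_mem _ ((Sp _).sub_mem (xi_Sp _ _ _) (xi_Sp _ _ _)))).integrable one_le_two) c h C hC
  refine le_of_eq_of_le ?_ key
  have ae : ∀ᵐ ω ∂P, ∀ v ∈ AN N ρ, psiFld N M sigv lamv P v ω = X N (xs N M sigv lamv v 1) ω ∧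
      psiInc N M sigv lamv P v α α' ω = X N (sigv i • (xi N v α' - xi N v α)) ω := by
    refine (ae_ball_iff (AN N ρ).countable_toSet).2 fun v hv => ?_
    have hv' : v ∈ VN N := Finset.filter_subset _ _ hv
    exact (psi_ae hp hP hv').and (psiInc_ae hN hp hP hv' hi h1 h2 h3)
  have We : ∀ᵐ ω ∂P, ∀ v ∈ AN N ρ, gibbsWres N M sigv lamv P β ρ v ω = W v ω := by
    filter_upwards [ae] with ω hω v hv
    simp only [gibbsWres, ZNres, hW, (hω v hv).1]
    rw [sum_congr rfl fun u hu => by rw [(hω u hu).1]]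
  have E : ∀ {n : ℕ} (F G : (Fin n → Vtx) → FieldSp → ℝ), (∀ᵐ ω ∂P, ∀ vv ∈ Fintype.piFinset (fun _ : Fin n => AN N ρ), F vv ω = G vv ω) →
      gibbsExpRes N M sigv lamv P β ρ n F = ∫ ω, ∑ vv ∈ Fintype.piFinset (fun _ : Fin n => AN N ρ), (∏ i, W (vv i) ω) * G vv ω ∂P := fun F G hFG => by
    refine integral_congr_ae ?_
    filter_upwards [We, hFG] with ω h1 h2
    refine sum_congr rfl fun vv hv => ?_
    rw [h2 vv hv, Finset.prod_congr rfl fun i _ => h1 _ (Fintype.mem_piFinset.1 hv i)]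
  rw [E _ (fun vv ω => X N (sigv i • (xi N (vv k) α' - xi N (vv k) α)) ω * h vv), E _ (fun vv ω => X N (sigv i • (xi N (vv 0) α' - xi N (vv 0) α)) ω),
    E _ (fun vv _ => h vv)]
  · exact Eventually.of_forall fun _ _ _ => rfl
  · filter_upwards [ae] with ω hω vv hv using (hω _ (Fintype.mem_piFinset.1 hv 0)).2
  · filter_upwards [ae] with ω hω vv hv
    rw [(hω _ (Fintype.mem_piFinset.1 hv k)).2]
end HZ

/-- **Lemma (Gibbs concentration of the field increments).**
Let `λ_{i*−1} ≤ α < α' ≤ λ_{i*}`, `β ∈ ℬ` and `ρ ∈ (0,1]`. Then for every `s`, every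
`k ∈ {1,…,s}` and every uniformly bounded family `h : V_N^s → ℝ`,
`|E𝒢_{β,N,ρ}^{×s}[ψ_{v^k}(α,α') h] − E𝒢_{β,N,ρ}[ψ_{v}(α,α')]·E𝒢_{β,N,ρ}^{×s}[h]|`
divided by `β(𝒥_{σ²}(1) log N + C₀)` tends to `0`. -/
theorem gibbs_concentration_of_increments
    (M : ℕ) (sigv lamv : ℕ → ℝ) (hparams : ScaleParams M sigv lamv)
    (m : ℕ) (sigb lamb : ℕ → ℝ) (sigbar : ℝ → ℝ)
    (heff : EffParams M sigv lamv m sigb lamb sigbar)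
    (P : ℕ → MeasureTheory.Measure FieldSp) (hGFF : ∀ N, IsGFF N (P N))
    (C₀ : ℝ) (hC₀ : IsVarBound M sigv lamv P C₀)
    (β : ℝ) (hβ : β ∈ critSet m sigb)
    (istar : ℕ) (histar : istar ∈ Finset.Icc 1 M)
    (α α' : ℝ) (hα : lamv (istar - 1) ≤ α) (hαα' : α < α') (hα' : α' ≤ lamv istar)
    (ρ : ℝ) (hρ0 : 0 < ρ) (hρ1 : ρ ≤ 1)
    (s : ℕ) (k : Fin s)
    (h : ℕ → (Fin s → Vtx) → ℝ) (C : ℝ) (hC : ∀ N vv, |h N vv| ≤ C) :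
    Filter.Tendsto (fun N =>
        |gibbsExpRes N M sigv lamv (P N) β ρ s
            (fun vv ω => psiInc N M sigv lamv (P N) (vv k) α α' ω * h N vv) -
          gibbsExpRes N M sigv lamv (P N) β ρ 1
              (fun vv ω => psiInc N M sigv lamv (P N) (vv 0) α α' ω) *
            gibbsExpRes N M sigv lamv (P N) β ρ s (fun vv _ => h N vv)| /
          (β * (Jsig2 M sigv lamv 1 * Real.log N + C₀)))
      Filter.atTop (nhds 0) := by
  obtain ⟨hβ0, -⟩ := hβ
  have C00 := hC₀.1
  have C0 : 0 ≤ C := (abs_nonneg _).trans (hC 0 fun _ => 0)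
  have J0 := J_pos hparams
  set J := Jsig2 M sigv lamv 1
  rw [Metric.tendsto_nhds]
  intro ε hε
  set ε' := ε * β * J / (2 * C + 1) with hε'
  have ε0 : 0 < ε' := by positivity
  obtain ⟨x, hx⟩ := conc hparams heff hβ0 histar hα hαα' hα' ε0
  filter_upwards [hx, bulk_AN hρ0, logN_ev 1, Filter.eventually_ge_atTop 8] with N hN hA hL hN8
  have key := gib_ae hparams (hGFF N) (by omega) histar hα hαα'.le hα' (β := β) (ρ := ρ) (bulk_ne hN8 hA) k (x * Real.log N) (h N) C (hC N)
  have := hN (P N) (hGFF N) _ hA (Finset.filter_subset _ _)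
  have den : 0 < β * (J * Real.log N + C₀) := by positivity
  rw [Real.dist_eq, sub_zero, abs_of_nonneg (by positivity), div_lt_iff₀ den]
  have e : (2 * C + 1) * ε' = ε * β * J := by rw [hε']; field_simp
  have m1 := mul_le_mul_of_nonneg_left this (by positivity : 0 ≤ 2 * C)
  have m2 : 0 < ε * (β * C₀) := by positivity
  have m3 : 0 < ε' * Real.log N := by positivity
  have m4 : ((2 * C + 1) * ε') * Real.log N = (ε * β * J) * Real.log N := by rw [e]
  linarith
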